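/- arXiv:2201.08521 — 3 statements merged into one kernel-verified Lean document; each statement's English description precedes it below -/
import Mathlib

section
/- In PG(n,q), with n ≥ 4 and q a square prime power, every (n−1)-blocking set K of type (a,b,c)_{n-1} with a = θ_{n-2}, b = θ_{n-3} + (√q)^{2n−3} and c = θ_{n-2} + (√q)^{2n−3} is a unital cone, i.e. a cone whose vertex is an (n−3)-dimensional subspace and whose base is a unital. -/
open Module Set

noncomputable section

variable (F : Type) [Field F]

/-- The point set of `PG(n,q)`: the projectivization of `GF(q)^{n+1}`. -/
abbrev PGPoint (n : ℕ) := Projectivization F (Fin (n + 1) → F)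

/-- The set of points of the projective space lying in (the projectivization of)
a linear subspace `W`. A `d`-dimensional projective subspace corresponds to a
submodule `W` with `finrank F W = d + 1`; hyperplanes correspond to `finrank F W = n`. -/
def projSet (n : ℕ) (W : Submodule F (Fin (n + 1) → F)) : Set (PGPoint F n) :=
  {x | x.submodule ≤ W}

/-- `θ_m = (q^{m+1} - 1)/(q - 1)`, the number of points of `PG(m,q)`. -/
def theta (q m : ℕ) : ℕ := (q ^ (m + 1) - 1) / (q - 1)

/-- `K` is of type `(a,b,c)_{n-1}`: every hyperplane meets `K` in `a`, `b` or `c`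
points, and each of the three values is attained by some hyperplane. -/
def IsType3 (n : ℕ) (K : Set (PGPoint F n)) (a b c : ℕ) : Prop :=
  (∀ W : Submodule F (Fin (n + 1) → F), finrank F W = n →
      (K ∩ projSet F n W).ncard = a ∨ (K ∩ projSet F n W).ncard = b ∨
        (K ∩ projSet F n W).ncard = c) ∧
  (∃ W : Submodule F (Fin (n + 1) → F), finrank F W = n ∧ (K ∩ projSet F n W).ncard = a) ∧
  (∃ W : Submodule F (Fin (n + 1) → F), finrank F W = n ∧ (K ∩ projSet F n W).ncard = b) ∧
  (∃ W : Submodule F (Fin (n + 1) → F), finrank F W = n ∧ (K ∩ projSet F n W).ncard = c)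

/-- `tnum K m`: the number of hyperplanes meeting `K` in exactly `m` points. -/
def tnum (n : ℕ) (K : Set (PGPoint F n)) (m : ℕ) : ℕ :=
  {W : Submodule F (Fin (n + 1) → F) | finrank F W = n ∧ (K ∩ projSet F n W).ncard = m}.ncard

/-- `K` blocks every `t`-dimensional projective subspace of `PG(n,q)`,
i.e. `K` is an `(n-t)`-blocking set. -/
def BlocksDim (n t : ℕ) (K : Set (PGPoint F n)) : Prop :=
  ∀ W : Submodule F (Fin (n + 1) → F), finrank F W = t + 1 → (K ∩ projSet F n W).Nonempty

/-- `U` is a unital of the plane (rank-3 subspace) `Wt` of `PG(n,q)`, where `sq = √q`: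
a set of `√q³ + 1` points of the plane meeting every line of the plane in exactly
`1` or `√q + 1` points. -/
def IsUnital (n sq : ℕ) (Wt : Submodule F (Fin (n + 1) → F)) (U : Set (PGPoint F n)) : Prop :=
  U ⊆ projSet F n Wt ∧ U.ncard = sq ^ 3 + 1 ∧
  ∀ L : Submodule F (Fin (n + 1) → F), L ≤ Wt → finrank F L = 2 →
    (U ∩ projSet F n L).ncard = 1 ∨ (U ∩ projSet F n L).ncard = sq + 1

/-- `K` is a unital cone: there are an `(n-3)`-dimensional subspace `V ⊆ K` (of linear
rank `n-2`) and a plane `τ` disjoint from `V` such that `K ∩ τ` is a unital of `τ` and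
`K` is the union of `V` together with all points on lines joining a point of `V` to a
point of `K ∩ τ`. -/
def IsUnitalCone (n sq : ℕ) (K : Set (PGPoint F n)) : Prop :=
  ∃ Wv Wt : Submodule F (Fin (n + 1) → F),
    finrank F Wv = n - 2 ∧ finrank F Wt = 3 ∧ Wv ⊓ Wt = ⊥ ∧
    projSet F n Wv ⊆ K ∧
    IsUnital F n sq Wt (K ∩ projSet F n Wt) ∧
    K = projSet F n Wv ∪
      ⋃ y ∈ K ∩ projSet F n Wt, ⋃ x ∈ projSet F n Wv,
        projSet F n (x.submodule ⊔ y.submodule)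

section

variable {F} {n : ℕ}

lemma mem_projSet_iff (W : Submodule F (Fin (n + 1) → F)) (x : PGPoint F n) :
    x ∈ projSet F n W ↔ x.rep ∈ W := by
  change x.submodule ≤ W ↔ _
  rw [Projectivization.submodule_eq, Submodule.span_singleton_le_iff_mem]

/-- The set of all vectors that are zero or represent a point of `K`. -/
def affineCone (K : Set (PGPoint F n)) : Set (Fin (n + 1) → F) :=
  {v | ∀ h : v ≠ 0, Projectivization.mk F v h ∈ K}

lemma zero_mem_affineCone (K : Set (PGPoint F n)) : (0 : Fin (n + 1) → F) ∈ affineCone K :=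
  fun h => absurd rfl h

lemma smul_mem_affineCone {K : Set (PGPoint F n)} {v : Fin (n + 1) → F}
    (hv : v ∈ affineCone K) (t : F) : t • v ∈ affineCone K := by
  intro h
  have hv0 : v ≠ 0 := by rintro rfl; simp at h
  have : Projectivization.mk F (t • v) h = Projectivization.mk F v hv0 := by
    rw [Projectivization.mk_eq_mk_iff']
    exact ⟨t, rfl⟩
  rw [this]
  exact hv hv0

lemma rep_mem_affineCone (K : Set (PGPoint F n)) (x : PGPoint F n) :
    x.rep ∈ affineCone K ↔ x ∈ K := by
  constructor
  · intro h
    simpa using h x.rep_nonzero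
  · intro h h0
    simpa using h

lemma mk_mem_projSet_iff (W : Submodule F (Fin (n + 1) → F)) {v : Fin (n + 1) → F} (h : v ≠ 0) :
    Projectivization.mk F v h ∈ projSet F n W ↔ v ∈ W := by
  change (Projectivization.mk F v h).submodule ≤ W ↔ _
  rw [Projectivization.submodule_mk, Submodule.span_singleton_le_iff_mem]

lemma affineCone_inter_projSet (K : Set (PGPoint F n)) (W : Submodule F (Fin (n + 1) → F)) :
    affineCone (K ∩ projSet F n W) = affineCone K ∩ (W : Set (Fin (n + 1) → F)) := by
  ext v
  constructor
  · intro h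
    refine ⟨fun h0 => (h h0).1, ?_⟩
    by_cases h0 : v = 0
    · simp [h0]
    · exact (mk_mem_projSet_iff W h0).1 (h h0).2
  · rintro ⟨h1, h2⟩ h0
    exact ⟨h1 h0, (mk_mem_projSet_iff W h0).2 h2⟩

lemma ncard_affineCone [Fintype F] (K : Set (PGPoint F n)) :
    (affineCone K).ncard = 1 + (Fintype.card F - 1) * K.ncard := by
  classical
  have hb : Nat.card (K × Fˣ) = Nat.card ↥(affineCone K \ {0}) := by
    refine Nat.card_congr (Equiv.ofBijective (fun y => ⟨(y.2 : F) • y.1.1.rep,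
      smul_mem_affineCone ((rep_mem_affineCone K _).2 y.1.2) _, ?_⟩) ⟨?_, ?_⟩)
    · simp [y.1.1.rep_nonzero]
    · rintro ⟨⟨x, hx⟩, u⟩ ⟨⟨y, hy⟩, w⟩ h
      have h' : (u : F) • x.rep = (w : F) • y.rep := congrArg Subtype.val h
      have hxy : x = y := by
        rw [← x.mk_rep, ← y.mk_rep, Projectivization.mk_eq_mk_iff']
        refine ⟨(u : F)⁻¹ * w, ?_⟩
        rw [mul_smul, ← h', smul_smul, inv_mul_cancel₀ u.ne_zero, one_smul]
      subst hxy
      have : (u : F) = w := smul_left_injective F x.rep_nonzero h'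
      simp [Units.ext_iff, this]
    · rintro ⟨v, hv, hv0⟩
      have hv0' : v ≠ 0 := hv0
      obtain ⟨a, ha⟩ := Projectivization.exists_smul_eq_mk_rep F v hv0'
      refine ⟨⟨⟨_, hv hv0'⟩, a⁻¹⟩, ?_⟩
      apply Subtype.ext
      change ((a⁻¹ : Fˣ) : F) • (Projectivization.mk F v hv0').rep = v
      rw [← ha, Units.smul_def, smul_smul]
      simp
  have h1 := Set.ncard_sdiff_singleton_add_one (zero_mem_affineCone K) (Set.toFinite _)
  rw [← h1, ← Nat.card_coe_set_eq (affineCone K \ {0}), ← hb, Nat.card_prod,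
    Nat.card_coe_set_eq, Nat.card_eq_fintype_card, Fintype.card_units]
  ring

lemma ncard_submodule [Fintype F] (W : Submodule F (Fin (n + 1) → F)) :
    (W : Set (Fin (n + 1) → F)).ncard = Fintype.card F ^ finrank F W := by
  classical
  rw [← Nat.card_coe_set_eq]
  have : Fintype W := Fintype.ofFinite _
  rw [← Module.card_eq_pow_finrank (K := F) (V := W), ← Nat.card_eq_fintype_card]
  rfl

lemma affineCone_projSet (W : Submodule F (Fin (n + 1) → F)) :
    affineCone (projSet F n W) = (W : Set (Fin (n + 1) → F)) := by
  have := affineCone_inter_projSet (Set.univ) W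
  rw [Set.univ_inter] at this
  rw [this]
  exact Set.inter_eq_right.2 fun v _ _ => Set.mem_univ _

lemma affineCone_subset_iff {K L : Set (PGPoint F n)} :
    affineCone K ⊆ affineCone L ↔ K ⊆ L := by
  constructor
  · intro h x hx
    exact (rep_mem_affineCone L x).1 (h ((rep_mem_affineCone K x).2 hx))
  · intro h v hv h0
    exact h (hv h0)

/-- The equality case of the Bose–Burton theorem: a point set of a projective space meeting all
lines and having the size of a hyperplane is a hyperplane. -/
lemma exists_submodule_of_blocks_lines [Fintype F] {K : Set (PGPoint F n)}
    (hblock : BlocksDim F n 1 K) (W : Submodule F (Fin (n + 1) → F)) {d : ℕ}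
    (hW : finrank F W = d + 1)
    (hc : (affineCone K ∩ (W : Set (Fin (n + 1) → F))).ncard = Fintype.card F ^ d) :
    ∃ U : Submodule F (Fin (n + 1) → F), finrank F U = d ∧
      affineCone K ∩ (W : Set (Fin (n + 1) → F)) = U := by
  classical
  set C := affineCone K ∩ (W : Set (Fin (n + 1) → F)) with hC
  have hsmul : ∀ (t : F) (v), v ∈ C → t • v ∈ C := fun t v hv =>
    ⟨smul_mem_affineCone hv.1 t, W.smul_mem t hv.2⟩
  have h0 : (0 : Fin (n + 1) → F) ∈ C := ⟨zero_mem_affineCone K, W.zero_mem⟩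
  have hadd : ∀ x y, x ∈ C → y ∈ C → x + y ∈ C := by
    intro x y hx hy
    by_contra hP
    set P := x + y with hPdef
    have hPW : P ∈ W := W.add_mem hx.2 hy.2
    have hP0 : P ≠ 0 := by rintro h; exact hP (h ▸ h0)
    obtain ⟨T, hT⟩ := Submodule.exists_isCompl (F ∙ P)
    have hTfin : finrank F T = n := by
      have := Submodule.finrank_add_eq_of_isCompl hT
      rw [finrank_span_singleton hP0] at this
      simp at this
      omega
    have hTP : ∀ (z w : Fin (n + 1) → F) (t : F), z ∈ T → w ∈ T → z - w = t • P → z = w := by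
      intro z w t hz hw h
      have h1 : z - w ∈ (F ∙ P) ⊓ T :=
        ⟨h ▸ Submodule.smul_mem _ _ (Submodule.mem_span_singleton_self P), T.sub_mem hz hw⟩
      rw [hT.inf_eq_bot, Submodule.mem_bot] at h1
      exact sub_eq_zero.1 h1
    have hex : ∀ z : ↥(T ⊓ W), ∃ t : F, (z : Fin (n + 1) → F) + t • P ∈ C := by
      rintro ⟨z, hzT, hzW⟩
      by_cases hz0 : z = 0
      · exact ⟨0, by simpa [hz0] using h0⟩
      have hli : LinearIndependent F ![z, P] := by
        rw [LinearIndependent.pair_iff' hz0]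
        intro a ha
        have : (0 : Fin (n + 1) → F) = a • z := hTP 0 (a • z) (-1) T.zero_mem
          (T.smul_mem _ hzT) (by simp [ha])
        exact hP0 (by rw [← ha, ← this])
      have hfr : finrank F (Submodule.span F {z, P}) = 1 + 1 := by
        have := finrank_span_eq_card hli
        rw [Matrix.range_cons, Matrix.range_cons, Matrix.range_empty, Set.union_empty,
          Set.singleton_union] at this
        simpa using this
      obtain ⟨p, hpK, hpL⟩ := hblock _ hfr
      rw [mem_projSet_iff, Submodule.mem_span_pair] at hpL
      obtain ⟨α, β, hαβ⟩ := hpL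
      have hpC : p.rep ∈ C := by
        refine ⟨(rep_mem_affineCone K p).2 hpK, ?_⟩
        rw [← hαβ]
        exact W.add_mem (W.smul_mem _ hzW) (W.smul_mem _ hPW)
      have hα : α ≠ 0 := by
        rintro rfl
        have hβ : β ≠ 0 := by
          rintro rfl
          apply p.rep_nonzero
          rw [← hαβ]; simp
        apply hP
        have := hsmul β⁻¹ _ hpC
        rw [← hαβ] at this
        simpa [smul_smul, hβ] using this
      refine ⟨α⁻¹ * β, ?_⟩
      have := hsmul α⁻¹ _ hpC
      rw [← hαβ] at this
      simpa [smul_smul, hα] using this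
    choose t ht using hex
    let f : ↥(T ⊓ W) → C := fun z => ⟨_, ht z⟩
    have hf : Function.Injective f := by
      intro z w h
      have h' : (z : Fin (n + 1) → F) + t z • P = w + t w • P := congrArg Subtype.val h
      apply Subtype.ext
      refine hTP _ _ (t w - t z) z.2.1 w.2.1 ?_
      rw [sub_smul, sub_eq_sub_iff_add_eq_add, h']
      abel
    have hcard : Nat.card C ≤ Nat.card ↥(T ⊓ W) := by
      have h1 : Nat.card ↥(T ⊓ W) = Fintype.card F ^ finrank F ↥(T ⊓ W) := by
        rw [← ncard_submodule, ← Nat.card_coe_set_eq]; rfl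
      rw [Nat.card_coe_set_eq, hc, h1]
      apply Nat.pow_le_pow_right Fintype.card_pos
      have h2 := Submodule.finrank_sup_add_finrank_inf_eq T W
      have h3 := Submodule.finrank_le (T ⊔ W)
      simp at h3
      omega
    have hsurj := (hf.bijective_of_nat_card_le hcard).2
    obtain ⟨z, hz⟩ := hsurj ⟨_, hsmul (-1) x hx⟩
    obtain ⟨w, hw⟩ := hsurj ⟨y, hy⟩
    have hz' : (z : Fin (n + 1) → F) + t z • P = (-1 : F) • x := congrArg Subtype.val hz
    have hw' : (w : Fin (n + 1) → F) + t w • P = y := congrArg Subtype.val hw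
    have hzw : (z : Fin (n + 1) → F) = w := by
      refine hTP _ _ (t w - t z - 1) z.2.1 w.2.1 ?_
      rw [sub_smul, sub_smul, eq_sub_of_add_eq hz', eq_sub_of_add_eq hw', one_smul, hPdef]
      module
    have hzw' : z = w := Subtype.ext hzw
    subst hzw'
    apply hP0
    rw [hPdef, ← hw', hz']
    simp
  let U : Submodule F (Fin (n + 1) → F) :=
    { carrier := C
      add_mem' := fun {x y} hx hy => hadd x y hx hy
      zero_mem' := h0
      smul_mem' := hsmul }
  have hU : (U : Set (Fin (n + 1) → F)) = C := rfl
  refine ⟨U, ?_, hU.symm⟩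
  rw [← hU, ncard_submodule] at hc
  exact Nat.pow_right_injective Fintype.one_lt_card hc

end
section

variable {F} {n : ℕ}

lemma card_dual_vanishing [Fintype F] (U : Submodule F (Fin (n + 1) → F)) :
    Nat.card U.dualAnnihilator = Fintype.card F ^ (n + 1 - finrank F U) := by
  have : Finite U.dualAnnihilator := Module.finite_of_finite F
  have : Fintype U.dualAnnihilator := Fintype.ofFinite _
  rw [Nat.card_eq_fintype_card, Module.card_eq_pow_finrank (K := F)]
  congr 1
  have := Subspace.finrank_add_finrank_dualAnnihilator_eq U
  rw [Module.finrank_fin_fun] at this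
  omega

open Classical in
lemma card_filter_dual_vanishing [Fintype F] [Fintype (Dual F (Fin (n + 1) → F))]
    (x y : PGPoint F n) :
    (Finset.univ.filter fun φ : Dual F (Fin (n + 1) → F) => φ x.rep = 0 ∧ φ y.rep = 0).card =
      if x = y then Fintype.card F ^ n else Fintype.card F ^ (n - 1) := by
  have h1 : (Finset.univ.filter fun φ : Dual F (Fin (n + 1) → F) =>
      φ x.rep = 0 ∧ φ y.rep = 0).card =
      Nat.card (Submodule.span F {x.rep, y.rep}).dualAnnihilator := by
    rw [← Fintype.card_subtype, ← Nat.card_eq_fintype_card]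
    apply Nat.card_congr
    apply Equiv.subtypeEquivRight
    intro φ
    rw [Submodule.mem_dualAnnihilator]
    constructor
    · rintro ⟨hx, hy⟩ w hw
      rw [Submodule.mem_span_pair] at hw
      obtain ⟨a, b, rfl⟩ := hw
      simp [hx, hy]
    · intro h
      exact ⟨h _ (Submodule.subset_span (by simp)), h _ (Submodule.subset_span (by simp))⟩
  rw [h1, card_dual_vanishing]
  split_ifs with hxy
  · subst hxy
    rw [Set.pair_eq_singleton, finrank_span_singleton x.rep_nonzero]
    rfl
  · have hli := (Projectivization.linearIndependent_pair_iff_ne (D := x) (D' := y)).2 hxy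
    have := finrank_span_eq_card hli
    rw [Matrix.range_cons, Matrix.range_cons, Matrix.range_empty, Set.union_empty,
      Set.singleton_union] at this
    rw [this]
    simp

open Classical in
lemma ncard_inter_ker_eq_sum [Fintype F] (K : Set (PGPoint F n)) [Fintype K]
    (φ : Dual F (Fin (n + 1) → F)) :
    (K ∩ projSet F n (LinearMap.ker φ)).ncard =
      ∑ x ∈ K.toFinset, if φ x.rep = 0 then 1 else 0 := by
  rw [← Finset.card_filter, ← Set.ncard_coe_finset]
  congr 1
  ext x
  simp [mem_projSet_iff]

lemma sum_ncard_inter_ker [Fintype F] [Fintype (Dual F (Fin (n + 1) → F))]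
    (K : Set (PGPoint F n)) :
    ∑ φ : Dual F (Fin (n + 1) → F), (K ∩ projSet F n (LinearMap.ker φ)).ncard =
      K.ncard * Fintype.card F ^ n := by
  classical
  have : Fintype K := Fintype.ofFinite _
  simp_rw [ncard_inter_ker_eq_sum]
  rw [Finset.sum_comm, Set.ncard_eq_toFinset_card', ← smul_eq_mul, ← Finset.sum_const]
  refine Finset.sum_congr rfl fun x _ => ?_
  rw [← Finset.card_filter]
  simpa using card_filter_dual_vanishing x x

lemma sum_sq_ncard_inter_ker [Fintype F] [Fintype (Dual F (Fin (n + 1) → F))]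
    (K : Set (PGPoint F n)) :
    ∑ φ : Dual F (Fin (n + 1) → F), (K ∩ projSet F n (LinearMap.ker φ)).ncard ^ 2 +
      K.ncard * Fintype.card F ^ (n - 1) =
      K.ncard * Fintype.card F ^ n + K.ncard ^ 2 * Fintype.card F ^ (n - 1) := by
  classical
  have : Fintype K := Fintype.ofFinite _
  simp_rw [ncard_inter_ker_eq_sum, sq, Finset.sum_mul_sum]
  rw [Finset.sum_comm, Set.ncard_eq_toFinset_card', ← smul_eq_mul, ← Finset.sum_const,
    ← Finset.sum_add_distrib, ← smul_eq_mul, ← Finset.sum_const, mul_assoc, ← smul_eq_mul,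
    ← Finset.sum_const, ← Finset.sum_add_distrib]
  refine Finset.sum_congr rfl fun x hx => ?_
  rw [Finset.sum_comm]
  have hN : ∀ y : PGPoint F n, (∑ φ : Dual F (Fin (n + 1) → F),
      (if φ x.rep = 0 then 1 else 0) * (if φ y.rep = 0 then 1 else 0)) =
      if x = y then Fintype.card F ^ n else Fintype.card F ^ (n - 1) := by
    intro y
    rw [← card_filter_dual_vanishing, Finset.card_filter]
    refine Finset.sum_congr rfl fun φ _ => ?_
    by_cases h1 : φ x.rep = 0 <;> by_cases h2 : φ y.rep = 0 <;> simp [h1, h2]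
  simp_rw [hN]
  rw [← Finset.add_sum_erase _ _ hx, Finset.sum_congr rfl (g := fun _ => Fintype.card F ^ (n - 1))]
  · have h1 : (K.toFinset.erase x).card + 1 = K.toFinset.card := Finset.card_erase_add_one hx
    rw [Finset.sum_const, ← h1, if_pos rfl]
    simp only [smul_eq_mul]
    ring
  · intro y hy
    rw [if_neg (Finset.ne_of_mem_erase hy).symm]

/-- The second moment of the hyperplane intersection numbers, recentred. -/
lemma sum_nonzero_dual_mul [Fintype F] [Fintype (Dual F (Fin (n + 1) → F))]
    [DecidableEq (Dual F (Fin (n + 1) → F))] (K : Set (PGPoint F n)) (α β : ℤ) :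
    ∑ φ ∈ Finset.univ.erase (0 : Dual F (Fin (n + 1) → F)),
      (((K ∩ projSet F n (LinearMap.ker φ)).ncard : ℤ) - α) *
        (((K ∩ projSet F n (LinearMap.ker φ)).ncard : ℤ) - β) =
      (K.ncard : ℤ) * Fintype.card F ^ n +
        (K.ncard : ℤ) * (K.ncard - 1) * Fintype.card F ^ (n - 1)
        - (α + β) * (K.ncard * Fintype.card F ^ n) + α * β * Fintype.card F ^ (n + 1)
        - (K.ncard - α) * (K.ncard - β) := by
  have h0 : (K ∩ projSet F n (LinearMap.ker (0 : Dual F (Fin (n + 1) → F)))).ncard = K.ncard := by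
    congr 1
    ext x
    simp [mem_projSet_iff]
  have h1 := sum_ncard_inter_ker K
  have h2 := sum_sq_ncard_inter_ker K
  have hcard : Fintype.card (Dual F (Fin (n + 1) → F)) = Fintype.card F ^ (n + 1) := by
    rw [Module.card_eq_pow_finrank (K := F), Subspace.dual_finrank_eq, Module.finrank_fin_fun]
  have h := Finset.add_sum_erase Finset.univ (fun φ : Dual F (Fin (n + 1) → F) =>
      (((K ∩ projSet F n (LinearMap.ker φ)).ncard : ℤ) - α) *
        (((K ∩ projSet F n (LinearMap.ker φ)).ncard : ℤ) - β)) (Finset.mem_univ 0)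
  simp only [h0] at h
  have hexp : ∑ φ : Dual F (Fin (n + 1) → F),
      (((K ∩ projSet F n (LinearMap.ker φ)).ncard : ℤ) - α) *
        (((K ∩ projSet F n (LinearMap.ker φ)).ncard : ℤ) - β) =
      ((∑ φ : Dual F (Fin (n + 1) → F), (K ∩ projSet F n (LinearMap.ker φ)).ncard ^ 2 : ℕ) : ℤ)
      - (α + β) * ((∑ φ : Dual F (Fin (n + 1) → F),
        (K ∩ projSet F n (LinearMap.ker φ)).ncard : ℕ) : ℤ) +
      α * β * (Fintype.card (Dual F (Fin (n + 1) → F)) : ℤ) := by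
    push_cast
    rw [Finset.mul_sum, ← Finset.sum_sub_distrib, ← Finset.card_univ, mul_comm (α * β),
      ← nsmul_eq_mul, ← Finset.sum_const, ← Finset.sum_add_distrib]
    exact Finset.sum_congr rfl fun φ _ => by ring
  have h2' := congrArg (fun m : ℕ => (m : ℤ)) h2
  have h1' := congrArg (fun m : ℕ => (m : ℤ)) h1
  rw [hcard] at hexp
  push_cast at h1' h2' hexp
  rw [h1'] at hexp
  linear_combination h + hexp + h2'

end
section

variable {F} {n : ℕ}

/-- Double counting along the pencil of hyperplanes spanned by two hyperplanes, the first of which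
meets `K` inside the second. -/
lemma sum_pencil_ncard_inter_ker [Fintype F] (K : Set (PGPoint F n))
    (φ₀ φ₁ : Dual F (Fin (n + 1) → F))
    (h : K ∩ projSet F n (LinearMap.ker φ₀) ⊆ projSet F n (LinearMap.ker φ₁)) :
    ∑ t : F, (K ∩ projSet F n (LinearMap.ker (φ₁ + t • φ₀))).ncard +
        (K ∩ projSet F n (LinearMap.ker φ₀)).ncard =
      Fintype.card F * (K ∩ projSet F n (LinearMap.ker φ₀)).ncard + K.ncard := by
  classical
  have : Fintype K := Fintype.ofFinite _
  simp_rw [ncard_inter_ker_eq_sum]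
  rw [Finset.sum_comm, Set.ncard_eq_toFinset_card', Finset.card_eq_sum_ones, Finset.mul_sum,
    ← Finset.sum_add_distrib, ← Finset.sum_add_distrib]
  refine Finset.sum_congr rfl fun x hx => ?_
  rw [← Finset.card_filter]
  by_cases h0 : φ₀ x.rep = 0
  · have h1 : φ₁ x.rep = 0 := by
      have := h ⟨Set.mem_toFinset.1 hx, (mem_projSet_iff _ _).2 h0⟩
      rwa [mem_projSet_iff] at this
    simp [h0, h1]
  · have : (Finset.univ.filter fun t : F => (φ₁ + t • φ₀) x.rep = 0) =
        {-φ₁ x.rep / φ₀ x.rep} := by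
      ext t
      simp only [Finset.mem_filter, Finset.mem_univ, true_and, Finset.mem_singleton,
        LinearMap.add_apply, LinearMap.smul_apply, smul_eq_mul]
      rw [eq_div_iff h0]
      constructor
      · intro h; linear_combination h
      · intro h; linear_combination h
    rw [this]
    simp [h0]

end

/-- The recentred second moment, as a polynomial expression in the number `k` of points. -/
def secondMoment (q Q k α β : ℤ) : ℤ :=
  k * (q ^ 2 * Q) + k * (k - 1) * (q * Q) - (α + β) * (k * (q ^ 2 * Q)) + α * β * (q ^ 3 * Q)
    - (k - α) * (k - β)

lemma eq_cube_of_secondMoment (s Q θ m : ℤ) (hs : 2 ≤ s) (hQ : s ^ 4 ≤ Q)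
    (hθ : (s ^ 2 - 1) * θ + 1 = Q) (hm0 : 0 ≤ m) (hm : m ≤ s ^ 3)
    (hac : secondMoment (s ^ 2) Q (θ + Q + m * Q) (θ + Q) (θ + (s + 1) * Q) ≤ 0)
    (hab : 0 ≤ secondMoment (s ^ 2) Q (θ + Q + m * Q) (θ + Q) (θ + s * Q)) :
    m = s ^ 3 := by
  have hQ0 : 0 < Q := by nlinarith [pow_pos (by linarith : 0 < s) 4]
  have hac' : secondMoment (s ^ 2) Q (θ + Q + m * Q) (θ + Q) (θ + (s + 1) * Q) =
      Q ^ 2 * ((s ^ 2 * Q - 1) * ((s ^ 2 - m) * ((s + 1) * s ^ 2 - m)) +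
        m * ((s ^ 2 - s) * (s ^ 2 - 1))) := by
    subst hθ; unfold secondMoment; ring
  have hab' : secondMoment (s ^ 2) Q (θ + Q + m * Q) (θ + Q) (θ + s * Q) =
      Q ^ 2 * (m * ((s - 1) * (s ^ 3 + 1)) -
        (s ^ 2 * Q - 1) * ((m - s ^ 2) * (s ^ 3 - m))) := by
    subst hθ; unfold secondMoment; ring
  rw [hac'] at hac
  rw [hab'] at hab
  have hac2 := nonpos_of_mul_nonpos_right hac (by positivity)
  have hab2 := nonneg_of_mul_nonneg_right hab (by positivity)
  have hs2 : 4 ≤ s ^ 2 := by nlinarith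
  have hqQ : s ^ 6 - 1 ≤ s ^ 2 * Q - 1 := by nlinarith
  have hqQ0 : 0 < s ^ 2 * Q - 1 := by nlinarith
  have hlow : s ^ 2 < m := by
    by_contra! hle
    have h1 : 0 ≤ (s ^ 2 - m) * ((s + 1) * s ^ 2 - m) :=
      mul_nonneg (by linarith) (by nlinarith)
    have h2 : 0 < (s ^ 2 - s) * (s ^ 2 - 1) := mul_pos (by nlinarith) (by linarith)
    rcases hm0.eq_or_lt with h | h
    · subst h
      have : 0 < (s ^ 2 - 0) * ((s + 1) * s ^ 2 - 0) :=
        mul_pos (by linarith) (by nlinarith)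
      nlinarith [mul_pos hqQ0 this]
    · nlinarith [mul_nonneg hqQ0.le h1, mul_pos h h2]
  by_contra hne
  have hlt : m < s ^ 3 := lt_of_le_of_ne hm hne
  have h1 : s ^ 3 - s ^ 2 - 1 ≤ (m - s ^ 2) * (s ^ 3 - m) := by
    nlinarith [mul_nonneg (by linarith : 0 ≤ m - s ^ 2 - 1) (by linarith : 0 ≤ s ^ 3 - m - 1)]
  have h2 : (s ^ 6 - 1) * (s ^ 3 - s ^ 2 - 1) ≤ m * ((s - 1) * (s ^ 3 + 1)) := by
    have h3 : 0 ≤ s ^ 3 - s ^ 2 - 1 := by nlinarith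
    calc _ ≤ (s ^ 2 * Q - 1) * (s ^ 3 - s ^ 2 - 1) := by gcongr
      _ ≤ (s ^ 2 * Q - 1) * ((m - s ^ 2) * (s ^ 3 - m)) := by gcongr
      _ ≤ _ := by linarith
  have h3 : 0 < (s - 1) * (s ^ 3 + 1) := mul_pos (by linarith) (by positivity)
  have h4 : (s ^ 2 + s + 1) * (s ^ 3 - s ^ 2 - 1) * ((s - 1) * (s ^ 3 + 1)) ≤
      m * ((s - 1) * (s ^ 3 + 1)) := by
    calc _ = (s ^ 6 - 1) * (s ^ 3 - s ^ 2 - 1) := by ring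
      _ ≤ _ := h2
  have h5 := le_of_mul_le_mul_right h4 h3
  have h6 : s ^ 3 ≤ (s ^ 2 + s + 1) * (s ^ 3 - s ^ 2 - 1) := by
    obtain ⟨r, rfl⟩ : ∃ r, s = r + 2 := ⟨s - 2, by ring⟩
    have hr : 0 ≤ r := by linarith
    have : 0 ≤ (((r + 2) ^ 2 + (r + 2) + 1) * ((r + 2) ^ 3 - (r + 2) ^ 2 - 1) - (r + 2) ^ 3) := by
      ring_nf
      positivity
    linarith
  linarith

lemma secondMoment_cube (s Q θ : ℤ) (hθ : (s ^ 2 - 1) * θ + 1 = Q) :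
    secondMoment (s ^ 2) Q (θ + Q + s ^ 3 * Q) (θ + s * Q) (θ + (s + 1) * Q) =
      (s ^ 2 - 1) * (s ^ 3 + 1) * (((s - 1) * Q) * (s * Q)) := by
  subst hθ; unfold secondMoment; ring
section

variable {F} {n : ℕ}

lemma finrank_ker_of_ne_zero {φ : Dual F (Fin (n + 1) → F)} (h : φ ≠ 0) :
    finrank F (LinearMap.ker φ) = n := by
  have := Module.Dual.finrank_ker_add_one_of_ne_zero h
  rw [Module.finrank_fin_fun] at this
  omega

lemma exists_ker_ge {W : Submodule F (Fin (n + 1) → F)} (hW : finrank F W ≤ n) :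
    ∃ φ : Dual F (Fin (n + 1) → F), φ ≠ 0 ∧ W ≤ LinearMap.ker φ := by
  apply Submodule.exists_le_ker_of_lt_top
  apply Submodule.lt_top_of_finrank_lt_finrank
  rw [Module.finrank_fin_fun]
  omega

lemma exists_ker_eq {W : Submodule F (Fin (n + 1) → F)} (hW : finrank F W = n) :
    ∃ φ : Dual F (Fin (n + 1) → F), φ ≠ 0 ∧ LinearMap.ker φ = W := by
  obtain ⟨φ, h0, h⟩ := exists_ker_ge hW.le
  exact ⟨φ, h0, (Submodule.eq_of_le_of_finrank_eq h (by rw [hW, finrank_ker_of_ne_zero h0])).symm⟩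

/-- The submodules of codimension two that are the sections of `C` by hyperplanes. -/
def subspaceSections (C : Set (Fin (n + 1) → F)) : Set (Submodule F (Fin (n + 1) → F)) :=
  {U | finrank F U + 1 = n ∧ ∃ W : Submodule F (Fin (n + 1) → F), finrank F W = n ∧
    C ∩ (W : Set (Fin (n + 1) → F)) = U}

lemma exists_subspace_section [Fintype F] {s Q θ : ℕ} {K : Set (PGPoint F n)} (hn : 2 ≤ n)
    (hq : Fintype.card F = s ^ 2) (hQ : Q = (s ^ 2) ^ (n - 2)) (hθ : s ^ 2 * θ + 1 = Q + θ)
    (hblock : BlocksDim F n 1 K) {W : Submodule F (Fin (n + 1) → F)} (hW : finrank F W = n)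
    (hg : (K ∩ projSet F n W).ncard = θ + Q) :
    ∃ U : Submodule F (Fin (n + 1) → F), finrank F U + 1 = n ∧
      affineCone K ∩ (W : Set (Fin (n + 1) → F)) = U := by
  have hs : 0 < s ^ 2 := hq ▸ Fintype.card_pos
  obtain ⟨U, hU, h⟩ := exists_submodule_of_blocks_lines hblock W (d := n - 1) (by omega) (by
    rw [← affineCone_inter_projSet, ncard_affineCone, hg, hq,
      show n - 1 = n - 2 + 1 by omega, pow_succ (s ^ 2) (n - 2), ← hQ]
    zify [hs] at hθ ⊢
    linear_combination hθ)
  exact ⟨U, by omega, h⟩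

lemma inter_projSet_subset_of_section {K : Set (PGPoint F n)}
    {U W W' : Submodule F (Fin (n + 1) → F)}
    (h : affineCone K ∩ (W : Set (Fin (n + 1) → F)) = U) (hU : U ≤ W') :
    K ∩ projSet F n W ⊆ projSet F n W' := by
  rw [← affineCone_subset_iff, affineCone_inter_projSet, h, affineCone_projSet]
  exact hU

lemma exists_ne_smul_of_section [Fintype F] {K : Set (PGPoint F n)}
    {φ : Dual F (Fin (n + 1) → F)} (hφ : φ ≠ 0) {U : Submodule F (Fin (n + 1) → F)}
    (hUfin : finrank F U + 1 = n)
    (hU : affineCone K ∩ (LinearMap.ker φ : Set (Fin (n + 1) → F)) = U) :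
    ∃ ψ : Dual F (Fin (n + 1) → F), (∀ t : F, ψ + t • φ ≠ 0) ∧
      K ∩ projSet F n (LinearMap.ker φ) ⊆ projSet F n (LinearMap.ker ψ) := by
  obtain ⟨v, hv⟩ : ∃ v, φ v ≠ 0 := by
    by_contra! h
    exact hφ (LinearMap.ext h)
  obtain ⟨ψ, hψ, hle⟩ := exists_ker_ge (W := U ⊔ F ∙ v) (by
    have h1 := Submodule.finrank_add_le_finrank_add_finrank U (F ∙ v)
    have h2 : finrank F (F ∙ v) ≤ 1 := by
      simpa using finrank_span_le_card (R := F) ({v} : Set (Fin (n + 1) → F))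
    omega)
  refine ⟨ψ, fun t ht => ?_, inter_projSet_subset_of_section hU (le_sup_left.trans hle)⟩
  have h1 : ψ v = 0 := hle (Submodule.mem_sup_right (Submodule.mem_span_singleton_self v))
  have h2 : t = 0 := by
    have := LinearMap.congr_fun ht v
    simpa [h1, hv] using this
  subst h2
  simp at ht
  exact hψ ht

/-- The number of points of a set with the given hyperplane intersection numbers. -/
lemma ncard_eq_of_section_numbers [Fintype F] {s Q θ : ℕ} {K : Set (PGPoint F n)} (hn : 4 ≤ n)
    (hs : 2 ≤ s) (hq : Fintype.card F = s ^ 2) (hQ : Q = (s ^ 2) ^ (n - 2))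
    (hθ : s ^ 2 * θ + 1 = Q + θ) (hblock : BlocksDim F n 1 K)
    (htype : ∀ φ : Dual F (Fin (n + 1) → F), φ ≠ 0 →
      (K ∩ projSet F n (LinearMap.ker φ)).ncard = θ + Q ∨
      (K ∩ projSet F n (LinearMap.ker φ)).ncard = θ + s * Q ∨
      (K ∩ projSet F n (LinearMap.ker φ)).ncard = θ + (s + 1) * Q)
    (hex : ∃ φ : Dual F (Fin (n + 1) → F), φ ≠ 0 ∧
      (K ∩ projSet F n (LinearMap.ker φ)).ncard = θ + Q) :
    K.ncard = θ + Q + s ^ 3 * Q := by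
  classical
  have : Finite (Dual F (Fin (n + 1) → F)) := Module.finite_of_finite F
  have : Fintype (Dual F (Fin (n + 1) → F)) := Fintype.ofFinite _
  obtain ⟨φ, hφ, hg⟩ := hex
  obtain ⟨U, hUfin, hU⟩ := exists_subspace_section (by omega) hq hQ hθ hblock
    (finrank_ker_of_ne_zero hφ) hg
  obtain ⟨ψ, hψ, hsub⟩ := exists_ne_smul_of_section hφ hUfin hU
  have hpencil := sum_pencil_ncard_inter_ker K φ ψ hsub
  have hf : ∀ t : F, ∃ f : ℕ, f ≤ s ∧
      (K ∩ projSet F n (LinearMap.ker (ψ + t • φ))).ncard = θ + Q + f * Q := by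
    intro t
    rcases htype _ (hψ t) with h | h | h
    · exact ⟨0, by omega, by rw [h]; ring⟩
    · refine ⟨s - 1, by omega, ?_⟩
      obtain ⟨r, rfl⟩ := Nat.exists_eq_add_of_le' hs
      rw [h, show r + 2 - 1 = r + 1 by omega]
      ring
    · exact ⟨s, le_rfl, by rw [h]; ring⟩
  choose f hfs hf using hf
  have hsum : ∑ t, f t ≤ s ^ 3 := by
    calc ∑ t, f t ≤ ∑ _t : F, s := Finset.sum_le_sum fun t _ => hfs t
      _ = s ^ 3 := by rw [Finset.sum_const, Finset.card_univ, hq]; simp; ring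
  have hk : K.ncard = θ + Q + (∑ t, f t) * Q := by
    simp_rw [hf] at hpencil
    rw [hg, Finset.sum_add_distrib, Finset.sum_const, ← Finset.sum_mul, Finset.card_univ,
      smul_eq_mul] at hpencil
    linarith
  have hpow1 : Fintype.card F ^ n = s ^ 4 * Q := by
    obtain ⟨r, rfl⟩ := Nat.exists_eq_add_of_le' hn
    rw [hq, hQ, show r + 4 - 2 = r + 2 by omega]; ring
  have hpow2 : Fintype.card F ^ (n - 1) = s ^ 2 * Q := by
    obtain ⟨r, rfl⟩ := Nat.exists_eq_add_of_le' hn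
    rw [hq, hQ, show r + 4 - 2 = r + 2 by omega, show r + 4 - 1 = r + 3 by omega]; ring
  have hpow3 : Fintype.card F ^ (n + 1) = s ^ 6 * Q := by
    rw [pow_succ, hpow1, hq]; ring
  have hmom : ∀ α β : ℤ, ∑ φ ∈ Finset.univ.erase (0 : Dual F (Fin (n + 1) → F)),
      (((K ∩ projSet F n (LinearMap.ker φ)).ncard : ℤ) - α) *
        (((K ∩ projSet F n (LinearMap.ker φ)).ncard : ℤ) - β) =
      secondMoment (s ^ 2) Q K.ncard α β := by
    intro α β
    rw [sum_nonzero_dual_mul]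
    have h1 : (Fintype.card F : ℤ) ^ n = s ^ 4 * Q := by exact_mod_cast hpow1
    have h2 : (Fintype.card F : ℤ) ^ (n - 1) = s ^ 2 * Q := by exact_mod_cast hpow2
    have h3 : (Fintype.card F : ℤ) ^ (n + 1) = s ^ 6 * Q := by exact_mod_cast hpow3
    rw [h1, h2, h3]
    unfold secondMoment
    ring
  have hm : ((∑ t, f t : ℕ) : ℤ) = (s : ℤ) ^ 3 := by
    have hkz : (K.ncard : ℤ) = θ + Q + ((∑ t, f t : ℕ) : ℤ) * Q := by exact_mod_cast hk
    apply eq_cube_of_secondMoment s Q θ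
    · exact_mod_cast hs
    · have : s ^ 4 ≤ Q := by
        rw [hQ, ← pow_mul]
        exact Nat.pow_le_pow_right (by omega) (by omega)
      exact_mod_cast this
    · zify at hθ; linear_combination hθ
    · positivity
    · exact_mod_cast hsum
    · rw [← hkz, ← hmom]
      apply Finset.sum_nonpos
      intro ρ hρ
      rcases htype ρ (Finset.ne_of_mem_erase hρ) with h | h | h
      · rw [h]; push_cast; simp
      · have e : ((K ∩ projSet F n (LinearMap.ker ρ)).ncard : ℤ) = θ + s * Q := by
          exact_mod_cast h
        rw [e]
        have hs' : (2 : ℤ) ≤ s := by exact_mod_cast hs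
        have hQ' : (0 : ℤ) ≤ Q := by positivity
        have : 0 ≤ ((s : ℤ) - 1) * Q * Q := by
          apply mul_nonneg (mul_nonneg (by linarith) hQ') hQ'
        linarith
      · rw [h]; push_cast; simp
    · rw [← hkz, ← hmom]
      apply Finset.sum_nonneg
      intro ρ hρ
      rcases htype ρ (Finset.ne_of_mem_erase hρ) with h | h | h
      · rw [h]; push_cast; simp
      · rw [h]; push_cast; simp
      · have e : ((K ∩ projSet F n (LinearMap.ker ρ)).ncard : ℤ) = θ + (s + 1) * Q := by
          exact_mod_cast h
        rw [e]
        have : (0 : ℤ) ≤ s * Q * Q := by positivity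
        linarith
  have hm' : ∑ t, f t = s ^ 3 := by exact_mod_cast hm
  rw [hk, hm']

/-- All hyperplanes through a subspace section, except the one cutting it out, meet the point set
in the largest possible number of points. -/
lemma ncard_inter_ker_of_pencil [Fintype F] {s Q θ : ℕ} {K : Set (PGPoint F n)}
    (hs : 2 ≤ s) (hq : Fintype.card F = s ^ 2)
    (htype : ∀ φ : Dual F (Fin (n + 1) → F), φ ≠ 0 →
      (K ∩ projSet F n (LinearMap.ker φ)).ncard = θ + Q ∨
      (K ∩ projSet F n (LinearMap.ker φ)).ncard = θ + s * Q ∨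
      (K ∩ projSet F n (LinearMap.ker φ)).ncard = θ + (s + 1) * Q)
    (hk : K.ncard = θ + Q + s ^ 3 * Q)
    {φ ψ : Dual F (Fin (n + 1) → F)}
    (hg : (K ∩ projSet F n (LinearMap.ker φ)).ncard = θ + Q)
    (hψ : ∀ t : F, ψ + t • φ ≠ 0)
    (hsub : K ∩ projSet F n (LinearMap.ker φ) ⊆ projSet F n (LinearMap.ker ψ)) :
    (K ∩ projSet F n (LinearMap.ker ψ)).ncard = θ + (s + 1) * Q := by
  have hpencil := sum_pencil_ncard_inter_ker K φ ψ hsub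
  have hle : ∀ t ∈ (Finset.univ : Finset F),
      (K ∩ projSet F n (LinearMap.ker (ψ + t • φ))).ncard ≤ θ + (s + 1) * Q := by
    intro t _
    have h1 : s * Q ≤ (s + 1) * Q := Nat.mul_le_mul_right _ (by omega)
    have h2 : 1 * Q ≤ (s + 1) * Q := Nat.mul_le_mul_right _ (by omega)
    rcases htype _ (hψ t) with h | h | h <;> omega
  have heq := (Finset.sum_eq_sum_iff_of_le hle).1 (by
    rw [hg, hk] at hpencil
    rw [Finset.sum_const, Finset.card_univ, smul_eq_mul]
    rw [hq] at hpencil ⊢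
    linarith) 0 (Finset.mem_univ 0)
  simpa using heq

lemma exists_smul_of_add_smul_eq_zero {φ ψ : Dual F (Fin (n + 1) → F)} (hψ0 : ψ ≠ 0)
    (h : ∃ t : F, ψ + t • φ = 0) : ∃ t : F, t ≠ 0 ∧ t • φ = ψ := by
  obtain ⟨t, ht⟩ := h
  refine ⟨-t, ?_, ?_⟩
  · intro h0
    apply hψ0
    rw [neg_eq_zero] at h0
    simpa [h0] using ht
  · rw [eq_neg_of_add_eq_zero_left ht]
    ext
    simp

/-- The number of subspace sections. -/
lemma le_ncard_subspaceSections [Fintype F] {s Q θ : ℕ} {K : Set (PGPoint F n)} (hn : 4 ≤ n)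
    (hs : 2 ≤ s) (hq : Fintype.card F = s ^ 2) (hQ : Q = (s ^ 2) ^ (n - 2))
    (hθ : s ^ 2 * θ + 1 = Q + θ) (hblock : BlocksDim F n 1 K)
    (htype : ∀ φ : Dual F (Fin (n + 1) → F), φ ≠ 0 →
      (K ∩ projSet F n (LinearMap.ker φ)).ncard = θ + Q ∨
      (K ∩ projSet F n (LinearMap.ker φ)).ncard = θ + s * Q ∨
      (K ∩ projSet F n (LinearMap.ker φ)).ncard = θ + (s + 1) * Q)
    (hk : K.ncard = θ + Q + s ^ 3 * Q) :
    s ^ 3 + 1 ≤ (subspaceSections (affineCone K)).ncard := by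
  classical
  have : Finite (Dual F (Fin (n + 1) → F)) := Module.finite_of_finite F
  have : Fintype (Dual F (Fin (n + 1) → F)) := Fintype.ofFinite _
  have hQ0 : 0 < Q := by rw [hQ]; positivity
  set A := (Finset.univ.erase (0 : Dual F (Fin (n + 1) → F))).filter
    (fun φ => (K ∩ projSet F n (LinearMap.ker φ)).ncard = θ + Q) with hA
  have hmemA : ∀ φ, φ ∈ A ↔ φ ≠ 0 ∧ (K ∩ projSet F n (LinearMap.ker φ)).ncard = θ + Q := by
    intro φ; simp [hA]
  have hpow1 : Fintype.card F ^ n = s ^ 4 * Q := by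
    obtain ⟨r, rfl⟩ := Nat.exists_eq_add_of_le' hn
    rw [hq, hQ, show r + 4 - 2 = r + 2 by omega]; ring
  have hpow2 : Fintype.card F ^ (n - 1) = s ^ 2 * Q := by
    obtain ⟨r, rfl⟩ := Nat.exists_eq_add_of_le' hn
    rw [hq, hQ, show r + 4 - 2 = r + 2 by omega, show r + 4 - 1 = r + 3 by omega]; ring
  have hpow3 : Fintype.card F ^ (n + 1) = s ^ 6 * Q := by
    rw [pow_succ, hpow1, hq]; ring
  have hAcard : (A.card : ℤ) = (s ^ 2 - 1) * (s ^ 3 + 1) := by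
    have h1 : (Fintype.card F : ℤ) ^ n = s ^ 4 * Q := by exact_mod_cast hpow1
    have h2 : (Fintype.card F : ℤ) ^ (n - 1) = s ^ 2 * Q := by exact_mod_cast hpow2
    have h3 : (Fintype.card F : ℤ) ^ (n + 1) = s ^ 6 * Q := by exact_mod_cast hpow3
    have hkz : (K.ncard : ℤ) = θ + Q + s ^ 3 * Q := by exact_mod_cast hk
    have hmom := sum_nonzero_dual_mul K (θ + s * Q) (θ + (s + 1) * Q)
    have hS := secondMoment_cube s Q θ (by zify at hθ; linear_combination hθ)
    have hterm : ∑ φ ∈ Finset.univ.erase (0 : Dual F (Fin (n + 1) → F)),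
      (((K ∩ projSet F n (LinearMap.ker φ)).ncard : ℤ) - (θ + s * Q)) *
        (((K ∩ projSet F n (LinearMap.ker φ)).ncard : ℤ) - (θ + (s + 1) * Q)) =
        A.card * (((s - 1) * Q) * (s * Q) : ℤ) := by
      have hconst : A.card * (((s - 1) * Q) * (s * Q) : ℤ) =
          ∑ _φ ∈ A, (((s - 1) * Q) * (s * Q) : ℤ) := by
        rw [Finset.sum_const, nsmul_eq_mul]
      rw [hconst, hA, Finset.sum_filter]
      refine Finset.sum_congr rfl fun φ hφ => ?_
      split_ifs with h
      · rw [h]; push_cast; ring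
      · rcases htype φ (Finset.ne_of_mem_erase hφ) with h' | h' | h'
        · exact absurd h' h
        · rw [h']; push_cast; ring
        · rw [h']; push_cast; ring
    rw [hterm, h1, h2, h3, hkz] at hmom
    have hpos : (((s - 1) * Q) * (s * Q) : ℤ) ≠ 0 := by
      have : (2 : ℤ) ≤ s := by exact_mod_cast hs
      have hQz : (0 : ℤ) < Q := by exact_mod_cast hQ0
      have : (0 : ℤ) < s - 1 := by linarith
      positivity
    apply mul_right_cancel₀ hpos
    rw [hmom, ← hS]
    unfold secondMoment
    ring
  have hsec : ∀ φ : Dual F (Fin (n + 1) → F), ∃ U : Submodule F (Fin (n + 1) → F), φ ∈ A →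
      finrank F U + 1 = n ∧
        affineCone K ∩ (LinearMap.ker φ : Set (Fin (n + 1) → F)) = U := by
    intro φ
    by_cases h : φ ∈ A
    · obtain ⟨h0, hg⟩ := (hmemA φ).1 h
      obtain ⟨U, hU⟩ := exists_subspace_section (by omega) hq hQ hθ hblock
        (finrank_ker_of_ne_zero h0) hg
      exact ⟨U, fun _ => hU⟩
    · exact ⟨⊥, fun h' => absurd h' h⟩
  choose u hu using hsec
  have hfib := Finset.card_le_mul_card_image (f := u) A (s ^ 2 - 1) (by
    intro U hU
    obtain ⟨φ, hφ, rfl⟩ := Finset.mem_image.1 hU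
    obtain ⟨hφ0, hφg⟩ := (hmemA φ).1 hφ
    have hsubset : A.filter (fun ψ => u ψ = u φ) ⊆
        (Finset.univ.erase (0 : F)).image (fun t => t • φ) := by
      intro ψ hψ
      obtain ⟨hψA, hψu⟩ := Finset.mem_filter.1 hψ
      obtain ⟨hψ0, hψg⟩ := (hmemA ψ).1 hψA
      have hle : u φ ≤ LinearMap.ker ψ := by
        rw [← hψu]
        intro v hv
        have : v ∈ (u ψ : Set (Fin (n + 1) → F)) := hv
        rw [← (hu ψ hψA).2] at this
        exact this.2
      have hsub := inter_projSet_subset_of_section (hu φ hφ).2 hle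
      obtain ⟨t, ht0, ht⟩ := exists_smul_of_add_smul_eq_zero (φ := φ) hψ0 (by
        by_contra! hne
        have := ncard_inter_ker_of_pencil hs hq htype hk hφg hne hsub
        rw [hψg] at this
        nlinarith)
      exact Finset.mem_image.2 ⟨t, by simp [ht0], ht⟩
    refine (Finset.card_le_card hsubset).trans (Finset.card_image_le.trans ?_)
    rw [Finset.card_erase_of_mem (Finset.mem_univ _), Finset.card_univ, hq])
  have himg : (↑(A.image u) : Set (Submodule F (Fin (n + 1) → F))) ⊆
      subspaceSections (affineCone K) := by
    intro U hU
    obtain ⟨φ, hφ, rfl⟩ := Finset.mem_image.1 (Finset.mem_coe.1 hU)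
    exact ⟨(hu φ hφ).1, _, finrank_ker_of_ne_zero ((hmemA φ).1 hφ).1, (hu φ hφ).2⟩
  have h1 := Set.ncard_le_ncard himg (Set.toFinite _)
  rw [Set.ncard_coe_finset] at h1
  refine le_trans ?_ h1
  have hs1 : 1 ≤ s ^ 2 := Nat.one_le_pow _ _ (by omega)
  zify [hs1] at hfib ⊢
  rw [hAcard] at hfib
  refine le_of_mul_le_mul_left hfib ?_
  have : (2 : ℤ) ≤ s := by exact_mod_cast hs
  nlinarith

end
lemma card_mul_le_card_biUnion {ι α : Type*} [DecidableEq ι] [DecidableEq α] (I : Finset ι)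
    (D : ι → Finset α) (d e : ℕ) (hd : ∀ i ∈ I, d ≤ (D i).card)
    (he : ∀ i ∈ I, ∀ j ∈ I, i ≠ j → (D i ∩ D j).card ≤ e) :
    2 * I.card * d + I.card * e ≤ 2 * (I.biUnion D).card + I.card ^ 2 * e := by
  induction I using Finset.induction_on with
  | empty => simp
  | insert i I hi ih =>
    have ih' := ih (fun j hj => hd j (Finset.mem_insert_of_mem hj))
      (fun j hj k hk => he j (Finset.mem_insert_of_mem hj) k (Finset.mem_insert_of_mem hk))
    have h1 : (D i ∩ I.biUnion D).card ≤ I.card * e := by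
      rw [Finset.inter_biUnion]
      refine Finset.card_biUnion_le_card_mul _ _ _ fun j hj => ?_
      exact he i (Finset.mem_insert_self _ _) j (Finset.mem_insert_of_mem hj)
        (by rintro rfl; exact hi hj)
    have h2 := Finset.card_union_add_card_inter (D i) (I.biUnion D)
    have h3 := hd i (Finset.mem_insert_self _ _)
    rw [Finset.biUnion_insert, Finset.card_insert_of_notMem hi]
    nlinarith

section

variable {F} {n : ℕ}

lemma finrank_inf_of_sections {C : Set (Fin (n + 1) → F)} {U U' : Submodule F (Fin (n + 1) → F)}
    (hU : U ∈ subspaceSections C) (hU' : U' ∈ subspaceSections C) (hne : U ≠ U') :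
    finrank F ↥(U ⊓ U') + 2 = n := by
  obtain ⟨hUf, W, hW, hCW⟩ := hU
  obtain ⟨hUf', W', hW', hCW'⟩ := hU'
  have key : ∀ v, v ∈ U → v ∈ W' → v ∈ U' := by
    intro v hv hv'
    have h1 : v ∈ (U : Set (Fin (n + 1) → F)) := hv
    rw [← hCW] at h1
    have h2 : v ∈ C ∩ (W' : Set (Fin (n + 1) → F)) := ⟨h1.1, hv'⟩
    rw [hCW'] at h2
    exact h2
  have hle' : U' ≤ W' := by
    intro v hv
    have h1 : v ∈ (U' : Set (Fin (n + 1) → F)) := hv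
    rw [← hCW'] at h1
    exact h1.2
  have hnot : ¬ U ≤ W' := by
    intro hle
    exact hne (Submodule.eq_of_le_of_finrank_eq (fun v hv => key v hv (hle hv)) (by omega))
  have heq : U ⊓ U' = U ⊓ W' :=
    le_antisymm (inf_le_inf_left U hle') fun v hv => ⟨hv.1, key v hv.1 hv.2⟩
  have hlt : W' < U ⊔ W' := lt_of_le_of_ne le_sup_right fun h => hnot (h ▸ le_sup_left)
  have h1 := Submodule.finrank_lt_finrank_of_lt hlt
  have h2 := Submodule.finrank_le (U ⊔ W')
  rw [Module.finrank_fin_fun] at h2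
  have h3 := Submodule.finrank_sup_add_finrank_inf_eq U W'
  rw [heq]
  omega

lemma finrank_sup_of_sections {C : Set (Fin (n + 1) → F)} {U U' : Submodule F (Fin (n + 1) → F)}
    (hU : U ∈ subspaceSections C) (hU' : U' ∈ subspaceSections C) (hne : U ≠ U') :
    finrank F ↥(U ⊔ U') = n := by
  have h1 := finrank_inf_of_sections hU hU' hne
  have h2 := Submodule.finrank_sup_add_finrank_inf_eq U U'
  have h3 := hU.1
  have h4 := hU'.1
  omega

lemma subset_of_mem_subspaceSections {C : Set (Fin (n + 1) → F)}
    {U : Submodule F (Fin (n + 1) → F)} (hU : U ∈ subspaceSections C) :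
    (U : Set (Fin (n + 1) → F)) ⊆ C := by
  obtain ⟨-, W, -, h⟩ := hU
  rw [← h]
  exact Set.inter_subset_left

lemma ncard_sdiff_submodule [Fintype F] (U V : Submodule F (Fin (n + 1) → F)) :
    ((U : Set (Fin (n + 1) → F)) \ V).ncard + Fintype.card F ^ finrank F ↥(U ⊓ V) =
      Fintype.card F ^ finrank F U := by
  have := Set.ncard_inter_add_ncard_sdiff_eq_ncard (U : Set (Fin (n + 1) → F)) V (Set.toFinite _)
  rw [← ncard_submodule, ← ncard_submodule, ← this, Submodule.coe_inf]
  ring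

/-- A hyperplane through a subspace section contains few other subspace sections. -/
lemma card_sections_le [Fintype F] {s Q : ℕ} (hn : 3 ≤ n) (hs : 2 ≤ s)
    (hq : Fintype.card F = s ^ 2) (hQ : Q = (s ^ 2) ^ (n - 2)) {C : Set (Fin (n + 1) → F)}
    {U₀ G : Submodule F (Fin (n + 1) → F)} (hU₀ : U₀ ∈ subspaceSections C) (hG : U₀ ≤ G)
    (hCG : (C ∩ (G : Set (Fin (n + 1) → F))).ncard ≤ Q * (1 + (s ^ 2 - 1) * (s + 1)))
    (I : Finset (Submodule F (Fin (n + 1) → F)))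
    (hI : ∀ U ∈ I, U ∈ subspaceSections C ∧ U ≠ U₀ ∧ U ≤ G) : I.card ≤ s := by
  classical
  by_contra! hlt
  obtain ⟨J, hJI, hJ⟩ := Finset.exists_subset_card_eq (show s + 1 ≤ I.card from hlt)
  replace hI := fun U hU => hI U (hJI hU)
  clear hlt hJI
  obtain ⟨R, hR⟩ : ∃ R, R = (s ^ 2) ^ (n - 3) := ⟨_, rfl⟩
  have hR0 : 0 < R := by rw [hR]; positivity
  have hpow3 : Fintype.card F ^ (n - 3) = R := by rw [hq, hR]
  have hpow2 : Fintype.card F ^ (n - 2) = s ^ 2 * R := by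
    rw [show n - 2 = n - 3 + 1 by omega, pow_succ, hpow3, hq]; ring
  have hpow1 : Fintype.card F ^ (n - 1) = s ^ 4 * R := by
    rw [show n - 1 = n - 2 + 1 by omega, pow_succ, hpow2, hq]; ring
  have hQR : Q = s ^ 2 * R := by rw [hQ, ← hpow2, hq]
  have hs2 : 1 ≤ s ^ 2 := Nat.one_le_pow _ _ (by omega)
  let D : Submodule F (Fin (n + 1) → F) → Finset (Fin (n + 1) → F) := fun U =>
    ((U : Set (Fin (n + 1) → F)) \ U₀).toFinite.toFinset
  have hmemD : ∀ U v, v ∈ D U ↔ v ∈ U ∧ v ∉ U₀ := by intro U v; simp [D]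
  have hsieve := card_mul_le_card_biUnion J D (s ^ 2 * (s ^ 2 - 1) * R) ((s ^ 2 - 1) * R) (by
      intro U hU
      obtain ⟨hUs, hne, -⟩ := hI U hU
      have h1 := ncard_sdiff_submodule U U₀
      have h2 := finrank_inf_of_sections hUs hU₀ hne
      have h3 := hUs.1
      rw [show finrank F ↥(U ⊓ U₀) = n - 2 by omega, show finrank F U = n - 1 by omega, hpow1,
        hpow2, Set.ncard_eq_toFinset_card _ (Set.toFinite _)] at h1
      change _ ≤ ((U : Set (Fin (n + 1) → F)) \ U₀).toFinite.toFinset.card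
      zify [hs2] at h1 ⊢
      linarith) (by
      intro U hU U' hU' hne
      obtain ⟨hUs, hne0, -⟩ := hI U hU
      obtain ⟨hUs', hne0', -⟩ := hI U' hU'
      have h1 := ncard_sdiff_submodule (U ⊓ U') U₀
      have h2 := finrank_inf_of_sections hUs hUs' hne
      have h3 : n - 3 ≤ finrank F ↥(U ⊓ U' ⊓ U₀) := by
        have e1 := Submodule.finrank_sup_add_finrank_inf_eq (U ⊓ U₀) (U' ⊓ U₀)
        have e2 := finrank_inf_of_sections hUs hU₀ hne0
        have e3 := finrank_inf_of_sections hUs' hU₀ hne0'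
        have e4 : finrank F ↥(U ⊓ U₀ ⊔ U' ⊓ U₀) ≤ finrank F U₀ :=
          Submodule.finrank_mono (sup_le inf_le_right inf_le_right)
        have e5 := hU₀.1
        have e6 : U ⊓ U₀ ⊓ (U' ⊓ U₀) = U ⊓ U' ⊓ U₀ := by
          rw [← inf_inf_distrib_right]
        rw [e6] at e1
        omega
      have h4 : R ≤ Fintype.card F ^ finrank F ↥(U ⊓ U' ⊓ U₀) := by
        rw [← hpow3]
        exact Nat.pow_le_pow_right Fintype.card_pos h3
      rw [show finrank F ↥(U ⊓ U') = n - 2 by omega, hpow2] at h1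
      have h5 : (D U ∩ D U').card =
          (((U ⊓ U' : Submodule F (Fin (n + 1) → F)) : Set (Fin (n + 1) → F)) \ U₀).ncard := by
        rw [← Set.ncard_coe_finset]
        congr 1
        ext v
        simp only [Finset.coe_inter, Set.mem_inter_iff, hmemD, Set.mem_sdiff,
          SetLike.mem_coe, Submodule.mem_inf]
        tauto
      rw [h5]
      zify [hs2] at h1 h4 ⊢
      linarith)
  have hunion : (J.biUnion D).card + s ^ 4 * R ≤ Q * (1 + (s ^ 2 - 1) * (s + 1)) := by
    have h1 : (U₀ : Set (Fin (n + 1) → F)).ncard = s ^ 4 * R := by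
      rw [ncard_submodule, ← hpow1]
      congr 1
      have := hU₀.1
      omega
    rw [← h1, ← Set.ncard_coe_finset, ← Set.ncard_union_eq]
    · refine le_trans (Set.ncard_le_ncard ?_ (Set.toFinite _)) hCG
      rintro v (hv | hv)
      · obtain ⟨U, hU, hvU⟩ := Finset.mem_biUnion.1 (Finset.mem_coe.1 hv)
        have := ((hmemD U v).1 hvU).1
        exact ⟨subset_of_mem_subspaceSections (hI U hU).1 this, (hI U hU).2.2 this⟩
      · exact ⟨subset_of_mem_subspaceSections hU₀ hv, hG hv⟩
    · rw [Set.disjoint_left]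
      intro v hv
      obtain ⟨U, hU, hvU⟩ := Finset.mem_biUnion.1 (Finset.mem_coe.1 hv)
      exact ((hmemD U v).1 hvU).2
  rw [hJ] at hsieve
  rw [hQR] at hunion
  obtain ⟨r, rfl⟩ := Nat.exists_eq_add_of_le' hs
  zify [hs2] at hsieve hunion
  have hr : (0 : ℤ) ≤ r := by positivity
  have hfac : (0 : ℤ) < (((r : ℤ) + 2) ^ 2 - 1) * R := by
    apply mul_pos
    · nlinarith
    · exact_mod_cast hR0
  have : (((r : ℤ) + 2) ^ 2 - 1) * R * ((r + 2) * (r + 1)) ≤ 0 := by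
    linear_combination hsieve + 2 * hunion
  nlinarith [mul_pos hfac (by positivity : (0 : ℤ) < (r + 2) * (r + 1))]

lemma inf_le_of_sections {C : Set (Fin (n + 1) → F)} {A B X : Submodule F (Fin (n + 1) → F)}
    (hA : A ∈ subspaceSections C) (hB : B ∈ subspaceSections C) (hX : X ∈ subspaceSections C)
    (hAB : A ≠ B) (hXAB : ¬ X ≤ A ⊔ B) : A ⊓ B ≤ X := by
  have hXA : X ≠ A := by rintro rfl; exact hXAB le_sup_left
  have hXB : X ≠ B := by rintro rfl; exact hXAB le_sup_right
  have h1 := finrank_inf_of_sections hX hA hXA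
  have h2 := finrank_inf_of_sections hX hB hXB
  have h3 := finrank_inf_of_sections hA hB hAB
  by_cases h : X ⊓ A = X ⊓ B
  · have : X ⊓ A = A ⊓ B := by
      refine Submodule.eq_of_le_of_finrank_eq (le_inf inf_le_right ?_) (by omega)
      rw [h]
      exact inf_le_right
    rw [← this]
    exact inf_le_left
  · exfalso
    apply hXAB
    have hlt : X ⊓ A < X ⊓ A ⊔ X ⊓ B := by
      refine lt_of_le_of_ne le_sup_left fun heq => h ?_
      exact (Submodule.eq_of_le_of_finrank_eq (heq ▸ le_sup_right) (by omega)).symm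
    have h4 := Submodule.finrank_lt_finrank_of_lt hlt
    have h5 : X ⊓ A ⊔ X ⊓ B = X :=
      Submodule.eq_of_le_of_finrank_le (sup_le inf_le_left inf_le_left)
        (by have := hX.1; omega)
    rw [← h5]
    exact sup_le_sup inf_le_right inf_le_right

/-- All subspace sections share a common subspace of codimension three. -/
lemma exists_vertex [Fintype F] {s Q : ℕ} (hn : 3 ≤ n) (hs : 2 ≤ s)
    (hq : Fintype.card F = s ^ 2) (hQ : Q = (s ^ 2) ^ (n - 2)) {C : Set (Fin (n + 1) → F)}
    (hle : ∀ G : Submodule F (Fin (n + 1) → F), finrank F G = n →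
      (C ∩ (G : Set (Fin (n + 1) → F))).ncard ≤ Q * (1 + (s ^ 2 - 1) * (s + 1)))
    (hcard : s ^ 3 + 1 ≤ (subspaceSections C).ncard) :
    ∃ V : Submodule F (Fin (n + 1) → F), finrank F V + 2 = n ∧
      ∀ U ∈ subspaceSections C, V ≤ U := by
  classical
  have hs3 : 2 * s ≤ s ^ 3 := by nlinarith [Nat.pow_le_pow_left hs 2]
  obtain ⟨A, B, hA, hB, hAB⟩ := (Set.one_lt_ncard_iff (Set.toFinite _)).1
    (show 1 < (subspaceSections C).ncard by omega)
  have hfin := finrank_sup_of_sections hA hB hAB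
  obtain ⟨X, hX, hXAB⟩ : ∃ X ∈ subspaceSections C, ¬ X ≤ A ⊔ B := by
    by_contra! hall
    have h1 := card_sections_le hn hs hq hQ hA le_sup_left (hle _ hfin)
      ((Set.toFinite (subspaceSections C \ {A})).toFinset) (by
        intro U hU
        rw [Set.Finite.mem_toFinset] at hU
        exact ⟨hU.1, hU.2, hall U hU.1⟩)
    rw [← Set.ncard_eq_toFinset_card] at h1
    have h2 := Set.ncard_sdiff_singleton_add_one hA (Set.toFinite _)
    omega
  have hVX := inf_le_of_sections hA hB hX hAB hXAB
  have hAX : A ≠ X := by rintro rfl; exact hXAB le_sup_left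
  have h1 := finrank_inf_of_sections hA hB hAB
  have h2 := finrank_inf_of_sections hA hX hAX
  have hV : A ⊓ B = A ⊓ X :=
    Submodule.eq_of_le_of_finrank_eq (le_inf inf_le_left hVX) (by omega)
  refine ⟨A ⊓ B, h1, fun U hU => ?_⟩
  by_contra hVU
  have hUA : U ≠ A := by rintro rfl; exact hVU inf_le_left
  have hU1 : U ≤ A ⊔ B := by
    by_contra h
    exact hVU (inf_le_of_sections hA hB hU hAB h)
  have hU2 : U ≤ A ⊔ X := by
    by_contra h
    exact hVU (hV ▸ inf_le_of_sections hA hX hU hAX h)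
  have hfin' := finrank_sup_of_sections hA hX hAX
  have hlt : A ⊔ B < A ⊔ B ⊔ (A ⊔ X) :=
    lt_of_le_of_ne le_sup_left fun h => hXAB (h ▸ le_sup_right.trans le_sup_right)
  have h3 := Submodule.finrank_lt_finrank_of_lt hlt
  have h4 := Submodule.finrank_sup_add_finrank_inf_eq (A ⊔ B) (A ⊔ X)
  have h5 := hA.1
  have h6 := hU.1
  have h7 : A = (A ⊔ B) ⊓ (A ⊔ X) :=
    Submodule.eq_of_le_of_finrank_le (le_inf le_sup_left le_sup_left) (by omega)
  exact hUA (Submodule.eq_of_le_of_finrank_eq (h7 ▸ le_inf hU1 hU2) (by omega))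

/-- The subspace sections cover the cone. -/
lemma exists_section_of_mem [Fintype F] {s Q : ℕ} (hn : 2 ≤ n)
    (hq : Fintype.card F = s ^ 2) (hQ : Q = (s ^ 2) ^ (n - 2)) {C : Set (Fin (n + 1) → F)}
    (hC : C.ncard = Q * (1 + (s ^ 2 - 1) * (s ^ 3 + 1)))
    (hcard : s ^ 3 + 1 ≤ (subspaceSections C).ncard)
    {V : Submodule F (Fin (n + 1) → F)} (hV : finrank F V + 2 = n)
    (hVU : ∀ U ∈ subspaceSections C, V ≤ U) {v : Fin (n + 1) → F} (hv : v ∈ C) (hvV : v ∉ V) :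
    ∃ U ∈ subspaceSections C, v ∈ U := by
  classical
  set S := (Set.toFinite (subspaceSections C)).toFinset with hS
  have hmemS : ∀ U, U ∈ S ↔ U ∈ subspaceSections C := by simp [hS]
  have hs2 : 1 ≤ s ^ 2 := hq ▸ Fintype.card_pos
  have hVfin : finrank F V = n - 2 := by omega
  have hpow2 : Fintype.card F ^ (n - 2) = Q := by rw [hQ, hq]
  have hpow1 : Fintype.card F ^ (n - 1) = s ^ 2 * Q := by
    rw [show n - 1 = n - 2 + 1 by omega, pow_succ, hpow2, hq]; ring
  let D : Submodule F (Fin (n + 1) → F) → Finset (Fin (n + 1) → F) := fun U =>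
    ((U : Set (Fin (n + 1) → F)) \ V).toFinite.toFinset
  have hmemD : ∀ U v, v ∈ D U ↔ v ∈ U ∧ v ∉ V := by intro U v; simp [D]
  have hDcard : ∀ U ∈ S, (D U).card = (s ^ 2 - 1) * Q := by
    intro U hU
    have hU' := (hmemS U).1 hU
    have h1 := ncard_sdiff_submodule U V
    have h3 := hU'.1
    rw [inf_eq_right.2 (hVU U hU'), hVfin, show finrank F U = n - 1 by omega, hpow1,
      hpow2, Set.ncard_eq_toFinset_card _ (Set.toFinite _)] at h1
    change ((U : Set (Fin (n + 1) → F)) \ V).toFinite.toFinset.card = _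
    zify [hs2] at h1 ⊢
    linarith
  have hdisj : (S : Set (Submodule F (Fin (n + 1) → F))).PairwiseDisjoint D := by
    intro U hU U' hU' hne
    have hU1 := (hmemS U).1 hU
    have hU1' := (hmemS U').1 hU'
    have h1 := finrank_inf_of_sections hU1 hU1' hne
    have h2 : V = U ⊓ U' :=
      Submodule.eq_of_le_of_finrank_eq (le_inf (hVU U hU1) (hVU U' hU1')) (by omega)
    rw [Function.onFun, Finset.disjoint_left]
    intro w hw hw'
    rw [hmemD] at hw hw'
    apply hw.2
    rw [h2]
    exact ⟨hw.1, hw'.1⟩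
  have hunion : (S.biUnion D).card = S.card * ((s ^ 2 - 1) * Q) := by
    rw [Finset.card_biUnion hdisj, Finset.sum_congr rfl hDcard, Finset.sum_const, smul_eq_mul]
  have hne : (subspaceSections C).Nonempty := by
    rw [← Set.ncard_pos (Set.toFinite _)]
    omega
  obtain ⟨U₀, hU₀⟩ := hne
  have hVC : (V : Set (Fin (n + 1) → F)) ⊆ C :=
    fun w hw => subset_of_mem_subspaceSections hU₀ (hVU U₀ hU₀ hw)
  have hCV := Set.ncard_sdiff_add_ncard_of_subset hVC (Set.toFinite _)
  rw [ncard_submodule, hVfin, hpow2, hC] at hCV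
  have hsub : (S.biUnion D : Set (Fin (n + 1) → F)) ⊆ C \ V := by
    intro w hw
    obtain ⟨U, hU, hwU⟩ := Finset.mem_biUnion.1 (Finset.mem_coe.1 hw)
    rw [hmemD] at hwU
    exact ⟨subset_of_mem_subspaceSections ((hmemS U).1 hU) hwU.1, hwU.2⟩
  have heq := Set.eq_of_subset_of_ncard_le hsub (by
    rw [Set.ncard_coe_finset, hunion, hS, ← Set.ncard_eq_toFinset_card]
    have := Nat.mul_le_mul_right ((s ^ 2 - 1) * Q) hcard
    refine le_trans ?_ this
    zify [hs2] at hCV ⊢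
    linarith) (Set.toFinite _)
  have hvmem : v ∈ (S.biUnion D : Set (Fin (n + 1) → F)) := by
    rw [heq]
    exact ⟨hv, hvV⟩
  obtain ⟨U, hU, hwU⟩ := Finset.mem_biUnion.1 (Finset.mem_coe.1 hvmem)
  exact ⟨U, (hmemS U).1 hU, ((hmemD U v).1 hwU).1⟩

lemma ncard_inter_sup_of_add_mem [Fintype F] {C : Set (Fin (n + 1) → F)}
    {V L : Submodule F (Fin (n + 1) → F)} (hadd : ∀ v ∈ V, ∀ x ∈ C, v + x ∈ C)
    (hVL : V ⊓ L = ⊥) :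
    (C ∩ ((V ⊔ L : Submodule F (Fin (n + 1) → F)) : Set (Fin (n + 1) → F))).ncard =
      Fintype.card F ^ finrank F V * (C ∩ (L : Set (Fin (n + 1) → F))).ncard := by
  have hinj : Set.InjOn (fun p : (Fin (n + 1) → F) × (Fin (n + 1) → F) => p.1 + p.2)
      ((V : Set (Fin (n + 1) → F)) ×ˢ (C ∩ (L : Set (Fin (n + 1) → F)))) := by
    rintro ⟨v, l⟩ ⟨hv, -, hl⟩ ⟨v', l'⟩ ⟨hv', -, hl'⟩ h
    have h' : v + l = v' + l' := h
    have h1 : v - v' ∈ V ⊓ L := by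
      refine ⟨V.sub_mem hv hv', ?_⟩
      have : v - v' = l' - l := by
        rw [sub_eq_sub_iff_add_eq_add, h']
        abel
      rw [this]
      exact L.sub_mem hl' hl
    rw [hVL, Submodule.mem_bot, sub_eq_zero] at h1
    subst h1
    rw [add_left_cancel h']
  rw [← ncard_submodule, ← Set.ncard_prod, ← hinj.ncard_image]
  congr 1
  ext w
  constructor
  · rintro ⟨hw, hwVL⟩
    obtain ⟨v, hv, l, hl, rfl⟩ := Submodule.mem_sup.1 hwVL
    refine ⟨(v, l), ⟨hv, ?_, hl⟩, rfl⟩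
    simpa using hadd (-v) (V.neg_mem hv) _ hw
  · rintro ⟨⟨v, l⟩, ⟨hv, hlC, hl⟩, rfl⟩
    exact ⟨hadd v hv l hlC, Submodule.add_mem_sup hv hl⟩

end
section

variable {F} {n : ℕ}

lemma add_mem_of_sections {C : Set (Fin (n + 1) → F)} {V : Submodule F (Fin (n + 1) → F)}
    (hVC : (V : Set (Fin (n + 1) → F)) ⊆ C) (hVU : ∀ U ∈ subspaceSections C, V ≤ U)
    (hsec : ∀ x ∈ C, x ∉ V → ∃ U ∈ subspaceSections C, x ∈ U) :
    ∀ v ∈ V, ∀ x ∈ C, v + x ∈ C := by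
  intro v hv x hx
  by_cases hxV : x ∈ V
  · exact hVC (V.add_mem hv hxV)
  · obtain ⟨U, hU, hxU⟩ := hsec x hx hxV
    exact subset_of_mem_subspaceSections hU (U.add_mem (hVU U hU hv) hxU)

lemma ncard_inter_ne_of_section_le [Fintype F] {s Q θ : ℕ} {K : Set (PGPoint F n)} (hn : 2 ≤ n)
    (hs : 2 ≤ s) (hq : Fintype.card F = s ^ 2) (hQ : Q = (s ^ 2) ^ (n - 2))
    (hθ : s ^ 2 * θ + 1 = Q + θ)
    (htype : ∀ φ : Dual F (Fin (n + 1) → F), φ ≠ 0 →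
      (K ∩ projSet F n (LinearMap.ker φ)).ncard = θ + Q ∨
      (K ∩ projSet F n (LinearMap.ker φ)).ncard = θ + s * Q ∨
      (K ∩ projSet F n (LinearMap.ker φ)).ncard = θ + (s + 1) * Q)
    (hk : K.ncard = θ + Q + s ^ 3 * Q) {U : Submodule F (Fin (n + 1) → F)}
    (hU : U ∈ subspaceSections (affineCone K)) {ψ : Dual F (Fin (n + 1) → F)} (hψ : ψ ≠ 0)
    (hUψ : U ≤ LinearMap.ker ψ) :
    (K ∩ projSet F n (LinearMap.ker ψ)).ncard ≠ θ + s * Q := by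
  have hQ0 : 0 < Q := by rw [hQ]; positivity
  obtain ⟨hUf, W, hW, hKW⟩ := hU
  obtain ⟨φ, hφ, rfl⟩ := exists_ker_eq hW
  have hg : (K ∩ projSet F n (LinearMap.ker φ)).ncard = θ + Q := by
    have h1 := ncard_affineCone (K ∩ projSet F n (LinearMap.ker φ))
    have hs2 : 1 < s ^ 2 := by nlinarith
    rw [affineCone_inter_projSet, hKW, ncard_submodule, show finrank F U = n - 2 + 1 by omega, hq,
      pow_succ (s ^ 2) (n - 2), ← hQ] at h1
    zify [hs2.le] at h1 hθ hs2 ⊢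
    refine mul_left_cancel₀ (sub_ne_zero.2 hs2.ne') ?_
    linear_combination -h1 - hθ
  by_cases h : ∃ t : F, ψ + t • φ = 0
  · obtain ⟨t, ht, rfl⟩ := exists_smul_of_add_smul_eq_zero hψ h
    rw [LinearMap.ker_smul _ _ ht, hg]
    nlinarith
  · push Not at h
    rw [ncard_inter_ker_of_pencil hs hq htype hk hg h (inter_projSet_subset_of_section hKW hUψ)]
    nlinarith

/-- A point set invariant under translation by a subspace is a cone. -/
lemma eq_cone_of_add_mem {K : Set (PGPoint F n)} {V T : Submodule F (Fin (n + 1) → F)}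
    (hVT : V ⊔ T = ⊤) (hV : V ≠ ⊥) (hVK : projSet F n V ⊆ K)
    (hadd : ∀ v ∈ V, ∀ x ∈ affineCone K, v + x ∈ affineCone K) :
    K = projSet F n V ∪
      ⋃ y ∈ K ∩ projSet F n T, ⋃ x ∈ projSet F n V,
        projSet F n (x.submodule ⊔ y.submodule) := by
  ext z
  constructor
  · intro hz
    have hzr := (rep_mem_affineCone K z).2 hz
    obtain ⟨v, hv, t, ht, hvt⟩ := Submodule.mem_sup.1 (hVT ▸ Submodule.mem_top : z.rep ∈ V ⊔ T)
    by_cases ht0 : t = 0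
    · left
      rw [mem_projSet_iff, ← hvt, ht0, add_zero]
      exact hv
    right
    have htC : t ∈ affineCone K := by
      have := hadd (-v) (V.neg_mem hv) _ hzr
      rwa [← hvt, neg_add_cancel_left] at this
    obtain ⟨w, hw, hw0, hvw⟩ : ∃ w ∈ V, w ≠ 0 ∧ v ∈ F ∙ w := by
      by_cases hv0 : v = 0
      · obtain ⟨w, hw, hw0⟩ := V.ne_bot_iff.1 hV
        exact ⟨w, hw, hw0, hv0 ▸ Submodule.zero_mem _⟩
      · exact ⟨v, hv, hv0, Submodule.mem_span_singleton_self v⟩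
    simp only [Set.mem_iUnion]
    refine ⟨Projectivization.mk F t ht0, ⟨htC ht0, (mk_mem_projSet_iff T ht0).2 ht⟩,
      Projectivization.mk F w hw0, (mk_mem_projSet_iff V hw0).2 hw, ?_⟩
    rw [mem_projSet_iff, Projectivization.submodule_mk, Projectivization.submodule_mk, ← hvt]
    exact Submodule.add_mem_sup hvw (Submodule.mem_span_singleton_self t)
  · rintro (hz | hz)
    · exact hVK hz
    · simp only [Set.mem_iUnion] at hz
      obtain ⟨y, ⟨hyK, -⟩, x, hx, hz⟩ := hz
      rw [mem_projSet_iff, Projectivization.submodule_eq, Projectivization.submodule_eq] at hz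
      obtain ⟨v, hv, t, ht, hvt⟩ := Submodule.mem_sup.1 hz
      obtain ⟨α, rfl⟩ := Submodule.mem_span_singleton.1 hv
      obtain ⟨β, rfl⟩ := Submodule.mem_span_singleton.1 ht
      rw [← rep_mem_affineCone, ← hvt]
      exact hadd _ (V.smul_mem _ ((mem_projSet_iff V x).1 hx)) _
        (smul_mem_affineCone ((rep_mem_affineCone K y).2 hyK) β)

lemma ncard_eq_of_affineCone [Fintype F] {s m : ℕ} (hs : 2 ≤ s)
    (hq : Fintype.card F = s ^ 2) {K : Set (PGPoint F n)} {N : ℕ} (hN : 0 < N)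
    (h : N * (affineCone K).ncard = N * (1 + (s ^ 2 - 1) * m)) : K.ncard = m := by
  have hs2 : 0 < s ^ 2 - 1 := Nat.sub_pos_of_lt (Nat.one_lt_pow (by omega) (by omega))
  have h1 := Nat.eq_of_mul_eq_mul_left hN h
  rw [ncard_affineCone, hq] at h1
  exact Nat.eq_of_mul_eq_mul_left hs2 (by omega)

/-- The characterization of unital cones, with `θ = θ_{n-3}` and `Q = q^{n-2}`. -/
lemma isUnitalCone_of_section_numbers [Fintype F] {s Q θ : ℕ} {K : Set (PGPoint F n)}
    (hn : 4 ≤ n) (hs : 2 ≤ s) (hq : Fintype.card F = s ^ 2) (hQ : Q = (s ^ 2) ^ (n - 2))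
    (hθ : s ^ 2 * θ + 1 = Q + θ) (hblock : BlocksDim F n 1 K)
    (htype : ∀ φ : Dual F (Fin (n + 1) → F), φ ≠ 0 →
      (K ∩ projSet F n (LinearMap.ker φ)).ncard = θ + Q ∨
      (K ∩ projSet F n (LinearMap.ker φ)).ncard = θ + s * Q ∨
      (K ∩ projSet F n (LinearMap.ker φ)).ncard = θ + (s + 1) * Q)
    (hex : ∃ φ : Dual F (Fin (n + 1) → F), φ ≠ 0 ∧
      (K ∩ projSet F n (LinearMap.ker φ)).ncard = θ + Q) :
    IsUnitalCone F n s K := by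
  have hQ0 : 0 < Q := by rw [hQ]; positivity
  have hs2 : 1 ≤ s ^ 2 := Nat.one_le_pow _ _ (by omega)
  have hk := ncard_eq_of_section_numbers hn hs hq hQ hθ hblock htype hex
  have hcard := le_ncard_subspaceSections hn hs hq hQ hθ hblock htype hk
  have hcone : ∀ (L : Set (PGPoint F n)) (m : ℕ), L.ncard = θ + m * Q →
      (affineCone L).ncard = Q * (1 + (s ^ 2 - 1) * m) := by
    intro L m hm
    rw [ncard_affineCone, hq, hm]
    zify [hs2] at hθ ⊢
    linear_combination hθ
  have hC := hcone K (s ^ 3 + 1) (by rw [hk]; ring)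
  have hle : ∀ G : Submodule F (Fin (n + 1) → F), finrank F G = n →
      (affineCone K ∩ (G : Set (Fin (n + 1) → F))).ncard ≤ Q * (1 + (s ^ 2 - 1) * (s + 1)) := by
    intro G hG
    obtain ⟨φ, hφ, rfl⟩ := exists_ker_eq hG
    have hmono : ∀ m ≤ s + 1, Q * (1 + (s ^ 2 - 1) * m) ≤ Q * (1 + (s ^ 2 - 1) * (s + 1)) := by
      intro m hm
      gcongr
    rw [← affineCone_inter_projSet]
    rcases htype φ hφ with h | h | h
    · rw [hcone _ 1 (by rw [h, one_mul])]
      exact hmono 1 (by omega)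
    · rw [hcone _ s h]
      exact hmono s (by omega)
    · rw [hcone _ (s + 1) h]
  obtain ⟨V, hVf, hVU⟩ := exists_vertex (by omega) hs hq hQ hle hcard
  have hsec : ∀ x ∈ affineCone K, x ∉ V → ∃ U ∈ subspaceSections (affineCone K), x ∈ U :=
    fun x hx hxV => exists_section_of_mem (by omega) hq hQ hC hcard hVf hVU hx hxV
  have hVC : (V : Set (Fin (n + 1) → F)) ⊆ affineCone K := by
    obtain ⟨U, hU⟩ : (subspaceSections (affineCone K)).Nonempty := by
      rw [← Set.ncard_pos (Set.toFinite _)]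
      omega
    exact fun v hv => subset_of_mem_subspaceSections hU (hVU U hU hv)
  have hadd := add_mem_of_sections hVC hVU hsec
  have hVK : projSet F n V ⊆ K := by
    rwa [← affineCone_subset_iff, affineCone_projSet]
  obtain ⟨T, hVT⟩ := Submodule.exists_isCompl V
  have hTf : finrank F T = 3 := by
    have := Submodule.finrank_add_eq_of_isCompl hVT
    rw [Module.finrank_fin_fun] at this
    omega
  have hpow : Fintype.card F ^ finrank F V = Q := by
    rw [hq, hQ, show finrank F V = n - 2 by omega]
  refine ⟨V, T, by omega, hTf, hVT.inf_eq_bot, hVK, ⟨Set.inter_subset_right, ?_, ?_⟩,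
    eq_cone_of_add_mem hVT.sup_eq_top (fun h => ?_) hVK hadd⟩
  · apply ncard_eq_of_affineCone hs hq hQ0
    have h1 := ncard_inter_sup_of_add_mem hadd hVT.inf_eq_bot
    rw [hVT.sup_eq_top, Submodule.top_coe, Set.inter_univ, hpow, hC] at h1
    rw [affineCone_inter_projSet, ← h1]
  · intro L hLT hLf
    have hKL : K ∩ projSet F n T ∩ projSet F n L = K ∩ projSet F n L := by
      have : projSet F n L ⊆ projSet F n T := fun x (hx : x.submodule ≤ L) => hx.trans hLT
      rw [Set.inter_assoc, Set.inter_eq_right.2 this]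
    rw [hKL]
    have hVL : V ⊓ L = ⊥ := (hVT.disjoint.mono_right hLT).eq_bot
    have hVLf : finrank F ↥(V ⊔ L) = n := by
      have := Submodule.finrank_sup_add_finrank_inf_eq V L
      rw [hVL, finrank_bot] at this
      omega
    obtain ⟨ψ, hψ, hker⟩ := exists_ker_eq hVLf
    have h1 := ncard_inter_sup_of_add_mem hadd hVL
    rw [hpow, ← hker, ← affineCone_inter_projSet, ← affineCone_inter_projSet] at h1
    have hcount : ∀ m, (K ∩ projSet F n (LinearMap.ker ψ)).ncard = θ + m * Q →
        (K ∩ projSet F n L).ncard = m := by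
      intro m hm
      apply ncard_eq_of_affineCone hs hq hQ0
      rw [← h1, hcone _ m hm]
    obtain ⟨x, hxK, hxL⟩ := hblock L hLf
    rw [mem_projSet_iff] at hxL
    have hxV : x.rep ∉ V := fun h =>
      x.rep_nonzero ((Submodule.mem_bot F).1 (hVL ▸ Submodule.mem_inf.2 ⟨h, hxL⟩))
    obtain ⟨U, hU, hxU⟩ := hsec _ ((rep_mem_affineCone K x).2 hxK) hxV
    have hUψ : U ≤ LinearMap.ker ψ := by
      have hlt : V < V ⊔ F ∙ x.rep := lt_of_le_of_ne le_sup_left fun h =>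
        hxV (h ▸ Submodule.mem_sup_right (Submodule.mem_span_singleton_self _))
      have h2 := Submodule.finrank_lt_finrank_of_lt hlt
      have h3 := hU.1
      have h4 : V ⊔ F ∙ x.rep = U := Submodule.eq_of_le_of_finrank_le
        (sup_le (hVU U hU) ((Submodule.span_singleton_le_iff_mem _ _).2 hxU)) (by omega)
      rw [hker, ← h4]
      exact sup_le_sup le_rfl ((Submodule.span_singleton_le_iff_mem _ _).2 hxL)
    rcases htype ψ hψ with h | h | h
    · exact Or.inl (hcount 1 (by rw [h, one_mul]))
    · exact absurd h
        (ncard_inter_ne_of_section_le (by omega) hs hq hQ hθ htype hk hU hψ hUψ)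
    · exact Or.inr (hcount _ h)
  · rw [h, finrank_bot] at hVf
    omega

end

lemma mul_theta_add_one {q : ℕ} (hq : 2 ≤ q) (m : ℕ) :
    q * theta q m + 1 = q ^ (m + 1) + theta q m := by
  have h : (q - 1) * theta q m = q ^ (m + 1) - 1 :=
    Nat.mul_div_cancel' (by simpa using Nat.sub_dvd_pow_sub_pow q 1 (m + 1))
  have h1 : 1 ≤ q ^ (m + 1) := Nat.one_le_pow _ _ (by omega)
  zify [h1, (by omega : 1 ≤ q)] at h ⊢
  linear_combination h

lemma theta_succ {q : ℕ} (hq : 2 ≤ q) (m : ℕ) :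
    theta q (m + 1) = theta q m + q ^ (m + 1) := by
  have h1 := mul_theta_add_one hq m
  have h2 := mul_theta_add_one hq (m + 1)
  obtain ⟨r, rfl⟩ := Nat.exists_eq_add_of_le' hq
  refine Nat.eq_of_mul_eq_mul_left (show 0 < r + 1 by omega) ?_
  zify at h1 h2 ⊢
  linear_combination h2 - h1

/-- In `PG(n,q)`, `n ≥ 4`, `q` a square prime power, every `(n-1)`-blocking
set of type `(θ_{n-2}, θ_{n-3} + √q^{2n-3}, θ_{n-2} + √q^{2n-3})_{n-1}` is a unital cone. -/
theorem statement6 [Fintype F] (p e q sq n : ℕ) (hp : p.Prime) (he : 0 < e)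
    (hqdef : q = p ^ (2 * e)) (hsq : sq = p ^ e) (hq : Fintype.card F = q)
    (hn : 4 ≤ n)
    (K : Set (PGPoint F n)) (hblock : BlocksDim F n 1 K)
    (hK : IsType3 F n K (theta q (n - 2)) (theta q (n - 3) + sq ^ (2 * n - 3))
      (theta q (n - 2) + sq ^ (2 * n - 3))) :
    IsUnitalCone F n sq K := by

  have hs : 2 ≤ sq := hsq ▸ hp.two_le.trans (Nat.le_self_pow he.ne' p)
  have hqs : q = sq ^ 2 := by rw [hqdef, hsq, ← pow_mul, mul_comm]
  subst hqs
  have hq2 : 2 ≤ sq ^ 2 := hs.trans (Nat.le_self_pow two_ne_zero sq)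
  have hθ := mul_theta_add_one hq2 (n - 3)
  have hθ' := theta_succ hq2 (n - 3)
  rw [show n - 3 + 1 = n - 2 by omega] at hθ hθ'
  have hb : sq ^ (2 * n - 3) = sq * (sq ^ 2) ^ (n - 2) := by
    rw [← pow_mul, ← pow_succ']
    congr 1
    omega
  have hc : theta (sq ^ 2) (n - 3) + (sq ^ 2) ^ (n - 2) + sq * (sq ^ 2) ^ (n - 2) =
      theta (sq ^ 2) (n - 3) + (sq + 1) * (sq ^ 2) ^ (n - 2) := by ring
  rw [hb, hθ', hc] at hK
  obtain ⟨htype, ⟨W, hW, hWa⟩, -, -⟩ := hK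
  obtain ⟨φ, hφ, rfl⟩ := exists_ker_eq hW
  exact isUnitalCone_of_section_numbers hn hs hq rfl hθ hblock
    (fun φ hφ => htype _ (finrank_ker_of_ne_zero hφ)) ⟨φ, hφ, hWa⟩
end
end

section
/- In PG(n,q), with n ≥ 3 and q a square prime power, every (n−1)-blocking set K of type (a,b,c)_{n-1} with a = θ_{n-2}, b = θ_{n-3} + (√q)^{2n−3} and c = θ_{n-2} + (√q)^{2n−3} is a unital cone (for n = 3 the vertex is a single point and the cone is a cone over a unital in a plane). -/
open Module Set

noncomputable section

variable (F : Type) [Field F]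

section Counting

open scoped Classical in
/-- The number of vectors of `K` lying in the subspace `U`. -/
def vecCount {k E : Type*} [Field k] [AddCommGroup E] [Module k E] (K : Finset E)
    (U : Submodule k E) : ℕ :=
  (K.filter (· ∈ U)).card

open scoped Classical in
/-- The linear forms vanishing on `U`, as a finset. -/
def annFinset {k E : Type*} [Field k] [AddCommGroup E] [Module k E] [Fintype (Dual k E)]
    (U : Submodule k E) : Finset (Dual k E) :=
  Finset.univ.filter (· ∈ U.dualAnnihilator)

variable {k E : Type*} [Field k] [AddCommGroup E] [Module k E]

lemma vecCount_bot {K : Finset E} (h0 : (0 : E) ∈ K) : vecCount K (⊥ : Submodule k E) = 1 := by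
  classical
  have : K.filter (· ∈ (⊥ : Submodule k E)) = {0} := by
    ext; simp; rintro rfl; exact h0
  rw [vecCount, this, Finset.card_singleton]

section Dual

variable [Fintype (Dual k E)]

lemma mem_annFinset {U : Submodule k E} {φ : Dual k E} :
    φ ∈ annFinset U ↔ U ≤ LinearMap.ker φ := by
  simp [annFinset, Submodule.mem_dualAnnihilator, SetLike.le_def]

lemma zero_mem_annFinset (U : Submodule k E) : (0 : Dual k E) ∈ annFinset U := by
  simp [mem_annFinset]

lemma annFinset_bot : annFinset (⊥ : Submodule k E) = Finset.univ := by
  ext; simp [mem_annFinset]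

end Dual

variable [FiniteDimensional k E]

lemma finrank_sup_span_singleton_of_notMem {U : Submodule k E} {v : E} (hv : v ∉ U) :
    finrank k (U ⊔ k ∙ v : Submodule k E) = finrank k U + 1 := by
  have h0 : v ≠ 0 := fun h => hv (h ▸ U.zero_mem)
  have h1 := Submodule.finrank_sup_add_finrank_inf_eq U (k ∙ v)
  have h2 : U ⊓ (k ∙ v) = ⊥ := by
    rw [← disjoint_iff, Submodule.disjoint_span_singleton' h0]
    exact hv
  rw [h2, finrank_bot, finrank_span_singleton h0] at h1
  simpa using h1

variable [Fintype k]

lemma vecCount_eq_of_subset {K : Finset E} {U : Submodule k E} (h : ∀ v ∈ U, v ∈ K) :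
    vecCount K U = Fintype.card k ^ finrank k U := by
  classical
  have : Finite E := Module.finite_of_finite k
  have := Fintype.ofFinite E
  rw [← Module.card_eq_pow_finrank (K := k) (V := U), vecCount, Fintype.card_subtype]
  congr 1
  ext v
  simp
  exact h v

/-- If the cone `K` meets every line of `H`, and has as many vectors in `H` as a hyperplane of
`H`, then it is a subspace there. -/
lemma exists_submodule_of_blocks {K : Finset E} (h0 : (0 : E) ∈ K)
    (hsmul : ∀ (a : k), ∀ v ∈ K, a • v ∈ K)
    (hblock : ∀ W : Submodule k E, finrank k W = 2 → ∃ x ∈ W, x ≠ 0 ∧ x ∈ K)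
    {H : Submodule k E} {d : ℕ} (hH : finrank k H = d + 1)
    (hc : vecCount K H = Fintype.card k ^ d) :
    ∃ S : Submodule k E, finrank k S = d ∧ ∀ v, v ∈ S ↔ v ∈ K ∧ v ∈ H := by
  classical
  have : Finite E := Module.finite_of_finite k
  have := Fintype.ofFinite E
  have key : ∀ u ∈ H, u ∈ K → ∀ v ∈ H, v ∈ K → u - v ∈ K := by
    intro u hu huK v hv hvK
    by_contra hP
    set P : H := ⟨u - v, H.sub_mem hu hv⟩ with hPdef
    have hP0 : P ≠ 0 := by
      intro h
      have : u - v = 0 := congrArg Subtype.val h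
      exact hP (this ▸ h0)
    let Q := H ⧸ (k ∙ P)
    have hQ : Fintype.card Q = Fintype.card k ^ d := by
      rw [Module.card_eq_pow_finrank (K := k)]
      congr 1
      have := Submodule.finrank_quotient_add_finrank (k ∙ P)
      rw [finrank_span_singleton hP0] at this
      exact Nat.add_right_cancel (this.trans hH)
    let X := {x : H // (x : E) ∈ K}
    have hX : Fintype.card X = Fintype.card k ^ d := by
      rw [← hc, vecCount, Fintype.card_subtype]
      refine Finset.card_bij (fun x _ => (x : E)) ?_ ?_ ?_
      · intro x hx; simpa using hx
      · intro x _ y _ h; exact Subtype.ext h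
      · intro y hy
        simp at hy
        exact ⟨⟨y, hy.2⟩, by simpa using hy.1, rfl⟩
    let f : X → Q := fun x => (k ∙ P).mkQ x.1
    have hsurj : Function.Surjective f := by
      intro y
      obtain ⟨x, rfl⟩ := (k ∙ P).mkQ_surjective y
      by_cases hx : x ∈ k ∙ P
      · refine ⟨⟨0, by simpa using h0⟩, ?_⟩
        rw [(Submodule.Quotient.mk_eq_zero _).2 hx |> fun h => (h : (k ∙ P).mkQ x = 0)]
        exact map_zero _
      · have hli : LinearIndependent k ![(P : E), (x : E)] := by
          rw [LinearIndependent.pair_iff' (fun h => hP0 (Subtype.ext h))]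
          intro a ha
          exact hx (Submodule.mem_span_singleton.2 ⟨a, Subtype.ext ha⟩)
        obtain ⟨z, hz, hz0, hzK⟩ := hblock (Submodule.span k (Set.range ![(P : E), (x : E)]))
          (by rw [finrank_span_eq_card hli]; simp)
        simp only [Matrix.range_cons, Matrix.range_empty, Set.union_empty,
          Set.singleton_union] at hz
        obtain ⟨a, b, rfl⟩ := Submodule.mem_span_pair.1 hz
        have hb : b ≠ 0 := by
          rintro rfl
          have ha : a ≠ 0 := by
            rintro rfl; simp at hz0
          apply hP
          have := hsmul a⁻¹ _ hzK
          simpa [smul_smul, ha, hPdef] using this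
        have hw := hsmul b⁻¹ _ hzK
        refine ⟨⟨b⁻¹ • (a • P + b • x), by simpa using hw⟩, ?_⟩
        change (k ∙ P).mkQ (b⁻¹ • (a • P + b • x)) = (k ∙ P).mkQ x
        rw [← sub_eq_zero, ← map_sub]
        refine (Submodule.Quotient.mk_eq_zero _).2 (Submodule.mem_span_singleton.2 ⟨b⁻¹ * a, ?_⟩)
        rw [smul_add, smul_smul, smul_smul, inv_mul_cancel₀ hb, one_smul]
        abel
    have hbij : Function.Bijective f :=
      (Fintype.bijective_iff_surjective_and_card f).2 ⟨hsurj, hX.trans hQ.symm⟩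
    have : f ⟨⟨u, hu⟩, huK⟩ = f ⟨⟨v, hv⟩, hvK⟩ := by
      change (k ∙ P).mkQ _ = (k ∙ P).mkQ _
      rw [← sub_eq_zero, ← map_sub]
      exact (Submodule.Quotient.mk_eq_zero _).2 (Submodule.mem_span_singleton_self P)
    have huv : u = v := congrArg (fun x : X => (x.1 : E)) (hbij.1 this)
    exact hP (by simpa [huv] using h0)
  let S : Submodule k E :=
    { carrier := {v | v ∈ K ∧ v ∈ H}
      zero_mem' := ⟨h0, H.zero_mem⟩
      add_mem' := by
        rintro u v ⟨hu, hu'⟩ ⟨hv, hv'⟩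
        refine ⟨?_, H.add_mem hu' hv'⟩
        have h1 : -v ∈ K := by simpa using hsmul (-1) v hv
        simpa using key u hu' hu (-v) (H.neg_mem hv') h1
      smul_mem' := fun a v hv => ⟨hsmul a v hv.1, H.smul_mem a hv.2⟩ }
  have hS : ∀ v, v ∈ S ↔ v ∈ K ∧ v ∈ H := fun v => Iff.rfl
  refine ⟨S, ?_, hS⟩
  have h1 : vecCount K S = vecCount K H := by
    unfold vecCount
    congr 1
    ext v
    simp [hS]
  rw [vecCount_eq_of_subset fun v hv => ((hS v).1 hv).1, hc] at h1
  exact Nat.pow_right_injective (Fintype.one_lt_card (α := k)) h1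

variable [Fintype (Dual k E)]

lemma card_annFinset {U : Submodule k E} {r : ℕ} (h : finrank k U + r = finrank k E) :
    (annFinset U).card = Fintype.card k ^ r := by
  classical
  have h1 := Subspace.finrank_add_finrank_dualAnnihilator_eq (K := k) U
  have h2 : finrank k U.dualAnnihilator = r := by
    have := h1.trans h.symm
    omega
  rw [← h2, ← Module.card_eq_pow_finrank (K := k) (V := U.dualAnnihilator)]
  rw [annFinset, Fintype.card_subtype]

lemma sum_vecCount_ker (K : Finset E) {U : Submodule k E} {r : ℕ}
    (h : finrank k U + r = finrank k E) :
    Fintype.card k * ∑ φ ∈ annFinset U, vecCount K (LinearMap.ker φ) +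
        Fintype.card k ^ r * vecCount K U =
      Fintype.card k ^ r * (Fintype.card k * vecCount K U + K.card) := by
  classical
  have hsw : ∑ φ ∈ annFinset U, vecCount K (LinearMap.ker φ) =
      ∑ v ∈ K, ((annFinset U).filter (fun φ => φ v = 0)).card := by
    simp only [vecCount, LinearMap.mem_ker, Finset.card_filter]
    exact Finset.sum_comm
  have hv : ∀ v ∈ K, Fintype.card k * ((annFinset U).filter (fun φ => φ v = 0)).card +
      Fintype.card k ^ r * (if v ∈ U then 1 else 0) =
      Fintype.card k ^ r * (Fintype.card k * (if v ∈ U then 1 else 0) + 1) := by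
    intro v _
    by_cases hvU : v ∈ U
    · have : (annFinset U).filter (fun φ => φ v = 0) = annFinset U := by
        refine Finset.filter_true_of_mem fun φ hφ => ?_
        exact mem_annFinset.1 hφ hvU
      rw [this, card_annFinset h]
      simp [hvU]
      ring
    · have hs : (annFinset U).filter (fun φ => φ v = 0) = annFinset (U ⊔ k ∙ v) := by
        ext φ
        simp [mem_annFinset]
      have hf := finrank_sup_span_singleton_of_notMem hvU
      have hle := Submodule.finrank_le (U ⊔ k ∙ v)
      obtain ⟨r, rfl⟩ : ∃ r', r = r' + 1 := ⟨r - 1, by omega⟩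
      rw [hs, card_annFinset (r := r) (by omega)]
      simp [hvU]
      ring
  have := Finset.sum_congr rfl hv
  rw [Finset.sum_add_distrib, ← Finset.mul_sum, ← Finset.mul_sum, ← Finset.mul_sum,
    Finset.sum_add_distrib, ← Finset.mul_sum, ← Finset.card_filter, ← hsw] at this
  simpa [vecCount] using this

lemma sum_sq_vecCount_ker {K : Finset E} (h0 : (0 : E) ∈ K)
    (hsmul : ∀ (a : k), ∀ v ∈ K, a • v ∈ K) {N : ℕ} (hN : finrank k E = N + 1) :
    (Fintype.card k : ℤ) * ∑ φ : Dual k E, (vecCount K (LinearMap.ker φ) : ℤ) ^ 2 =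
      (K.card - 1) * (Fintype.card k ^ N * ((Fintype.card k - 1) * Fintype.card k + K.card)) +
        Fintype.card k ^ (N + 1) * ((Fintype.card k - 1) + K.card) := by
  classical
  have hsw : ∑ φ : Dual k E, (vecCount K (LinearMap.ker φ) : ℤ) ^ 2 =
      ∑ v ∈ K, ∑ φ ∈ annFinset (k ∙ v), (vecCount K (LinearMap.ker φ) : ℤ) := by
    have : ∀ φ : Dual k E, (vecCount K (LinearMap.ker φ) : ℤ) ^ 2 =
        ∑ v ∈ K, if φ v = 0 then (vecCount K (LinearMap.ker φ) : ℤ) else 0 := by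
      intro φ
      rw [← Finset.sum_filter, Finset.sum_const, sq, nsmul_eq_mul]
      rfl
    simp_rw [this]
    rw [Finset.sum_comm]
    refine Finset.sum_congr rfl fun v _ => ?_
    rw [← Finset.sum_filter]
    refine Finset.sum_congr ?_ fun _ _ => rfl
    ext φ
    simp [mem_annFinset]
  rw [hsw, ← Finset.add_sum_erase _ _ h0, mul_add, Finset.mul_sum (K.erase 0)]
  have hz : (Fintype.card k : ℤ) * ∑ φ ∈ annFinset (k ∙ (0 : E)),
      (vecCount K (LinearMap.ker φ) : ℤ) =
      Fintype.card k ^ (N + 1) * ((Fintype.card k - 1) + K.card) := by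
    have := sum_vecCount_ker (k := k) K (U := k ∙ (0 : E)) (r := N + 1) (by simp [hN])
    zify at this
    have hb : vecCount K (k ∙ (0 : E)) = 1 := by
      rw [Submodule.span_zero_singleton]; exact vecCount_bot h0
    rw [hb] at this
    push_cast at this
    linear_combination this
  have hnz : ∀ v ∈ K.erase 0, (Fintype.card k : ℤ) * ∑ φ ∈ annFinset (k ∙ v),
      (vecCount K (LinearMap.ker φ) : ℤ) =
      Fintype.card k ^ N * ((Fintype.card k - 1) * Fintype.card k + K.card) := by
    intro v hv
    have hv0 := (Finset.mem_erase.1 hv).1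
    have hvK := (Finset.mem_erase.1 hv).2
    have hf := finrank_span_singleton (K := k) hv0
    have := sum_vecCount_ker (k := k) K (U := k ∙ v) (r := N) (by omega)
    rw [vecCount_eq_of_subset (K := K) (U := k ∙ v), hf] at this
    · zify at this
      linear_combination this
    · intro w hw
      obtain ⟨a, rfl⟩ := Submodule.mem_span_singleton.1 hw
      exact hsmul a v hvK
  rw [Finset.sum_congr rfl hnz, Finset.sum_const, Finset.card_erase_of_mem h0, hz, nsmul_eq_mul,
    Nat.cast_sub (Finset.card_pos.2 ⟨0, h0⟩)]
  push_cast
  ring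

end Counting

section Arithmetic

lemma weight_sum_of_count_sum {q G D κ z W s α β γ : ℤ} (hq : 1 < q)
    (hκ : κ = q * G + (q - 1) * G * W) (hD : 1 + α + β + γ = D)
    (h : q * (κ + α * (q * G) + β * (G * (1 + (q - 1) * s)) + γ * (G * (q + (q - 1) * s))) +
      D * z = D * (q * z + κ)) :
    q * G * (W + (s - 1) * β + s * γ) = D * (z + G * (W - q)) := by
  refine mul_left_cancel₀ (sub_ne_zero.2 hq.ne') ?_
  linear_combination h + (D - q) * hκ - (q ^ 2 * G) * hD

lemma weight_sq_sum_of_count_sq_sum {q G κ M s α β γ : ℤ} (hq : 1 < q) (hG : 0 < G)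
    (hκ : κ = q * G + (q - 1) * G * (M + q)) (hD : 1 + α + β + γ = q ^ 3 * G)
    (h1 : M + q + (s - 1) * β + s * γ = q ^ 2 + q ^ 2 * G * M)
    (h : q * (κ ^ 2 + α * (G * q) ^ 2 + β * (G * (1 + (q - 1) * s)) ^ 2 +
      γ * (G * (q + (q - 1) * s)) ^ 2) =
      (κ - 1) * (q ^ 2 * G * ((q - 1) * q + κ)) + q ^ 3 * G * ((q - 1) + κ)) :
    (s - 1) ^ 2 * β + s ^ 2 * γ = (q * G - 1) * M ^ 2 + (q ^ 2 - q) * (M + q) := by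
  have hne : q * (q - 1) ^ 2 * G ^ 2 ≠ 0 := by
    have := sub_ne_zero.2 hq.ne'
    positivity
  refine mul_left_cancel₀ hne ?_
  subst hκ
  linear_combination h - q ^ 3 * G ^ 2 * hD - 2 * q ^ 2 * G ^ 2 * (q - 1) * h1

lemma weight_total_cases {q s G a M β γ αS βS γS : ℤ} (hqs : q = s ^ 2) (hs : 2 ≤ s)
    (ha : (q - 1) * a = q * G - 1) (ha' : a = q + 1 ∨ q ^ 2 + q + 1 ≤ a)
    (hβ : 1 ≤ β) (hγ : 1 ≤ γ)
    (h1 : M + q + (s - 1) * β + s * γ = q ^ 2 + q ^ 2 * G * M)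
    (h2 : (s - 1) ^ 2 * β + s ^ 2 * γ = (q * G - 1) * M ^ 2 + (q ^ 2 - q) * (M + q))
    (hα0 : q - 1 ≤ αS) (hβ0 : 0 ≤ βS) (hγ0 : 0 ≤ γS) (hγle : γS ≤ γ)
    (hcard : 1 + αS + βS + γS = q ^ 2) (hS : (s - 1) * βS + s * γS = (q - 1) * (M + q)) :
    M = q * (s - 1) ∨ (s = 2 ∧ a = q + 1 ∧ M = 3 ∧ γS = γ) := by
  have hqs' : 2 * s ≤ q := by
    have : 0 ≤ (s - 2) * s := mul_nonneg (by linarith) (by linarith)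
    linarith
  have hq4 : 4 ≤ q := by linarith
  have haq : q + 1 ≤ a := by
    have := sq_nonneg q
    rcases ha' with h | h <;> linarith
  have hapos : 0 < a := by linarith
  -- the numbers of intersections of the two larger sizes
  have eγ : s * γ = (q - 1) * ((q - s + 1) * (M + q) - a * M * (q * (s - 1) - M)) := by
    linear_combination h2 - (s - 1) * h1 + (-M ^ 2 + (s - 1) * q * M) * ha
  have eβ : (s - 1) * β = (q - 1) * (a * M * (s * q - M) - (q - s) * (M + q)) := by
    linear_combination s * h1 - h2 + (M ^ 2 - s * q * M) * ha
  -- the total weight is at most `s * q`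
  have hMle : M + q ≤ s * q := by
    have : (q - 1) * (M + q) ≤ (q - 1) * (s * q) := by
      rw [← hS]
      have : 0 ≤ s * (q ^ 2 - q - γS - βS) := mul_nonneg (by linarith) (by linarith)
      linarith
    exact le_of_mul_le_mul_left this (by linarith)
  have hMq : 0 ≤ M + q := by
    have : 0 ≤ (q - 1) * (M + q) := by
      rw [← hS]
      have : 0 ≤ (s - 1) * βS := mul_nonneg (by linarith) hβ0
      have : 0 ≤ s * γS := mul_nonneg (by linarith) hγ0
      linarith
    exact nonneg_of_mul_nonneg_right this (by linarith)
  have hMpos : 0 < M := by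
    by_contra hM
    push Not at hM
    have h3 : 0 < (s - 1) * β := mul_pos (by linarith) (by linarith)
    rw [eβ] at h3
    have h4 := pos_of_mul_pos_right h3 (by linarith : (0 : ℤ) ≤ q - 1)
    have h5 : 0 ≤ (q - s) * (M + q) := mul_nonneg (by linarith) hMq
    have h6 : a * M * (s * q - M) ≤ 0 :=
      mul_nonpos_of_nonpos_of_nonneg (mul_nonpos_of_nonneg_of_nonpos hapos.le hM) (by
        have : 0 ≤ s * q := mul_nonneg (by linarith) (by linarith)
        linarith)
    linarith
  have hγpos : 0 < (q - s + 1) * (M + q) - a * M * (q * (s - 1) - M) := by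
    have h3 : 0 < s * γ := mul_pos (by linarith) (by linarith)
    rw [eγ] at h3
    exact pos_of_mul_pos_right h3 (by linarith : (0 : ℤ) ≤ q - 1)
  obtain ⟨j, hj⟩ : ∃ j, j = q * (s - 1) - M := ⟨_, rfl⟩
  rw [← hj] at hγpos eγ
  have hj0 : 0 ≤ j := by linarith
  have haMj : (q + 1) * (M * j) ≤ a * M * j := by
    have : 0 ≤ (a - (q + 1)) * (M * j) := by
      have := mul_nonneg hMpos.le hj0
      exact mul_nonneg (by linarith) this
    linarith
  rcases hj0.eq_or_lt with h0 | h0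
  · left; linarith
  rcases (show 1 ≤ j from h0).eq_or_lt with h1' | h1'
  · subst h1'
    have hsγ : (q - 1) * (q - 1) ≤ γS := by
      have h3 : 0 ≤ (s - 1) * (q ^ 2 - q - γS - βS) := mul_nonneg (by linarith) (by linarith)
      have h4 : M = q * (s - 1) - 1 := by linarith
      subst h4
      linarith
    rcases ha' with rfl | hbig
    · have hγv : γ = (q - 1) * (s + 1) := by
        have : s * γ = s * ((q - 1) * (s + 1)) := by
          rw [eγ, show M = q * (s - 1) - 1 by linarith, hqs]
          ring
        exact mul_left_cancel₀ (by linarith) this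
      have hs2 : s = 2 := by
        have : (q - 1) * (q - 1) ≤ (q - 1) * (s + 1) := by linarith
        have := le_of_mul_le_mul_left this (by linarith)
        clear * - this hs hqs
        nlinarith
      subst hs2
      norm_num at hqs
      subst hqs
      right
      exact ⟨rfl, rfl, by linarith, by linarith⟩
    · exfalso
      have hM3 : q - 1 ≤ M := by
        have : q * 1 ≤ q * (s - 1) := mul_le_mul_of_nonneg_left (by linarith) (by linarith)
        linarith
      have h3 : (q ^ 2 + q + 1) * M ≤ a * M := mul_le_mul_of_nonneg_right hbig hMpos.le
      have h4 : (q - s + 1) * (M + q) ≤ (q + 1) * (M + q) :=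
        mul_le_mul_of_nonneg_right (by linarith) hMq
      have h5 : q ^ 2 * 3 ≤ q ^ 2 * M := mul_le_mul_of_nonneg_left (by linarith) (sq_nonneg q)
      have h6 : q * 4 ≤ q * q := mul_le_mul_of_nonneg_left hq4 (by linarith)
      linarith
  · exfalso
    have hsum : M + j = q * (s - 1) := by linarith
    have hprod : 2 * M + j - 2 ≤ M * j := by
      have : 0 ≤ (M - 1) * (j - 2) := mul_nonneg (by linarith) (by linarith)
      linarith
    rcases hs.eq_or_lt with rfl | hs3
    · norm_num at hqs
      subst hqs
      norm_num at hsum hγpos haq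
      have : M ≤ 2 := by linarith
      interval_cases M
      · obtain rfl : j = 3 := by linarith
        linarith
      · obtain rfl : j = 2 := by linarith
        linarith
    · have h8 : M + q ≤ M * j := by
        have : q * 2 ≤ q * (s - 1) := mul_le_mul_of_nonneg_left (by linarith) (by linarith)
        linarith
      have h4 : (q - s + 1) * (M + q) ≤ (q + 1) * (M + q) :=
        mul_le_mul_of_nonneg_right (by linarith) hMq
      have h5 : (q + 1) * (M + q) ≤ (q + 1) * (M * j) :=
        mul_le_mul_of_nonneg_left h8 (by linarith)
      linarith

end Arithmetic

section ThreeSizes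

/-- A cone `K` of vectors (containing `0`, closed under scalars) in a space of dimension `m + 3`
over the field with `q = s ^ 2` elements which meets every line and which meets the hyperplanes
in three prescribed numbers of vectors. -/
structure IsThreeSizeCone (k : Type*) {E : Type*} [Field k] [Fintype k] [AddCommGroup E]
    [Module k E] (K : Finset E) (q s m : ℕ) : Prop where
  card_field : Fintype.card k = q
  sq_eq : q = s ^ 2
  two_le : 2 ≤ s
  one_le : 1 ≤ m
  finrank_eq : finrank k E = m + 3
  zero_mem : (0 : E) ∈ K
  smul_mem : ∀ (a : k), ∀ v ∈ K, a • v ∈ K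
  blocks : ∀ W : Submodule k E, finrank k W = 2 → ∃ x ∈ W, x ≠ 0 ∧ x ∈ K
  dvd_card : ((q : ℤ) - 1) ∣ K.card - 1
  size : ∀ φ : Dual k E, φ ≠ 0 →
    vecCount K (LinearMap.ker φ) = q ^ m * q ∨
    (vecCount K (LinearMap.ker φ) : ℤ) = q ^ m * (1 + (q - 1) * s) ∨
    (vecCount K (LinearMap.ker φ) : ℤ) = q ^ m * (q + (q - 1) * s)
  exists_small : ∃ φ : Dual k E, φ ≠ 0 ∧ vecCount K (LinearMap.ker φ) = q ^ m * q
  exists_middle : ∃ φ : Dual k E, φ ≠ 0 ∧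
    (vecCount K (LinearMap.ker φ) : ℤ) = q ^ m * (1 + (q - 1) * s)
  exists_large : ∃ φ : Dual k E, φ ≠ 0 ∧
    (vecCount K (LinearMap.ker φ) : ℤ) = q ^ m * (q + (q - 1) * s)

open scoped Classical in
/-- The nonzero linear forms vanishing on `U` whose kernel has `c` vectors in `K`. -/
def sizeClass {k E : Type*} [Field k] [AddCommGroup E] [Module k E] [Fintype (Dual k E)]
    (K : Finset E) (U : Submodule k E) (c : ℤ) : Finset (Dual k E) :=
  (annFinset U).filter fun φ => φ ≠ 0 ∧ (vecCount K (LinearMap.ker φ) : ℤ) = c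

lemma mem_sizeClass {k E : Type*} [Field k] [AddCommGroup E] [Module k E] [Fintype (Dual k E)]
    {K : Finset E} {U : Submodule k E} {c : ℤ} {φ : Dual k E} :
    φ ∈ sizeClass K U c ↔
      U ≤ LinearMap.ker φ ∧ φ ≠ 0 ∧ (vecCount K (LinearMap.ker φ) : ℤ) = c := by
  simp [sizeClass, mem_annFinset]

lemma sizeClass_anti {k E : Type*} [Field k] [AddCommGroup E] [Module k E] [Fintype (Dual k E)]
    {K : Finset E} {U W : Submodule k E} {c : ℤ} (h : U ≤ W) :
    sizeClass K W c ⊆ sizeClass K U c :=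
  fun _ hφ => mem_sizeClass.2 ⟨h.trans (mem_sizeClass.1 hφ).1, (mem_sizeClass.1 hφ).2⟩

lemma smul_mem_sizeClass {k E : Type*} [Field k] [AddCommGroup E] [Module k E]
    [Fintype (Dual k E)] {K : Finset E} {U : Submodule k E} {c : ℤ} {φ : Dual k E}
    (hφ : φ ∈ sizeClass K U c)
    {a : k} (ha : a ≠ 0) : a • φ ∈ sizeClass K U c := by
  rw [mem_sizeClass] at hφ ⊢
  rw [LinearMap.ker_smul _ _ ha]
  exact ⟨hφ.1, smul_ne_zero ha hφ.2.1, hφ.2.2⟩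

/-- The nonzero linear forms vanishing on `U` of smallest size. -/
abbrev smallForms {k E : Type*} [Field k] [AddCommGroup E] [Module k E] [Fintype (Dual k E)]
    (K : Finset E) (q m : ℕ) (U : Submodule k E) : Finset (Dual k E) :=
  sizeClass K U (q ^ m * q)

/-- The nonzero linear forms vanishing on `U` of middle size. -/
abbrev middleForms {k E : Type*} [Field k] [AddCommGroup E] [Module k E] [Fintype (Dual k E)]
    (K : Finset E) (q s m : ℕ) (U : Submodule k E) : Finset (Dual k E) :=
  sizeClass K U (q ^ m * (1 + (q - 1) * s))

/-- The nonzero linear forms vanishing on `U` of largest size. -/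
abbrev largeForms {k E : Type*} [Field k] [AddCommGroup E] [Module k E] [Fintype (Dual k E)]
    (K : Finset E) (q s m : ℕ) (U : Submodule k E) : Finset (Dual k E) :=
  sizeClass K U (q ^ m * (q + (q - 1) * s))

namespace IsThreeSizeCone

variable {k E : Type*} [Field k] [Fintype k] [AddCommGroup E] [Module k E] {K : Finset E}
  {q s m : ℕ}

lemma two_le_cast (h : IsThreeSizeCone k K q s m) : (2 : ℤ) ≤ s := by
  exact_mod_cast h.two_le

lemma sq_eq_cast (h : IsThreeSizeCone k K q s m) : (q : ℤ) = s ^ 2 := by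
  exact_mod_cast h.sq_eq

lemma one_lt_cast (h : IsThreeSizeCone k K q s m) : (1 : ℤ) < q := by
  have h1 := h.two_le_cast
  rw [h.sq_eq_cast]
  nlinarith

lemma pow_pos_cast (h : IsThreeSizeCone k K q s m) : (0 : ℤ) < q ^ m := by
  have := h.one_lt_cast
  positivity

lemma small_ne_middle (h : IsThreeSizeCone k K q s m) :
    (q : ℤ) ^ m * q ≠ q ^ m * (1 + (q - 1) * s) := by
  intro he
  have := mul_left_cancel₀ h.pow_pos_cast.ne' he
  have h1 := h.two_le_cast
  have h2 := h.one_lt_cast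
  nlinarith

lemma small_ne_large (h : IsThreeSizeCone k K q s m) :
    (q : ℤ) ^ m * q ≠ q ^ m * (q + (q - 1) * s) := by
  intro he
  have := mul_left_cancel₀ h.pow_pos_cast.ne' he
  have h1 := h.two_le_cast
  have h2 := h.one_lt_cast
  nlinarith

lemma middle_ne_large (h : IsThreeSizeCone k K q s m) :
    (q : ℤ) ^ m * (1 + (q - 1) * s) ≠ q ^ m * (q + (q - 1) * s) := by
  intro he
  have := mul_left_cancel₀ h.pow_pos_cast.ne' he
  have h2 := h.one_lt_cast
  linarith

lemma size_cast (h : IsThreeSizeCone k K q s m) {φ : Dual k E} (hφ : φ ≠ 0) :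
    (vecCount K (LinearMap.ker φ) : ℤ) = q ^ m * q ∨
    (vecCount K (LinearMap.ker φ) : ℤ) = q ^ m * (1 + (q - 1) * s) ∨
    (vecCount K (LinearMap.ker φ) : ℤ) = q ^ m * (q + (q - 1) * s) := by
  rcases h.size φ hφ with h1 | h1
  · left; exact_mod_cast h1
  · right; exact h1

lemma exists_submodule [FiniteDimensional k E] (h : IsThreeSizeCone k K q s m) {φ : Dual k E}
    (hφ : φ ≠ 0) (hs : (vecCount K (LinearMap.ker φ) : ℤ) = q ^ m * q) :
    ∃ S : Submodule k E, finrank k S = m + 1 ∧ ∀ v, v ∈ S ↔ v ∈ K ∧ φ v = 0 := by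
  have h1 := Module.Dual.finrank_ker_add_one_of_ne_zero hφ
  rw [h.finrank_eq] at h1
  refine exists_submodule_of_blocks h.zero_mem h.smul_mem h.blocks (H := LinearMap.ker φ)
    (by omega) ?_
  rw [h.card_field, pow_succ]
  exact_mod_cast hs

variable [Fintype (Dual k E)]

lemma sum_annFinset (h : IsThreeSizeCone k K q s m) (U : Submodule k E) (f : ℤ → ℤ) :
    ∑ φ ∈ annFinset U, f (vecCount K (LinearMap.ker φ)) =
      f K.card + (smallForms K q m U).card * f (q ^ m * q) +
      (middleForms K q s m U).card * f (q ^ m * (1 + (q - 1) * s)) +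
      (largeForms K q s m U).card * f (q ^ m * (q + (q - 1) * s)) := by
  classical
  have h1 : ∀ c : ℤ, ((sizeClass K U c).card : ℤ) * f c = ∑ φ ∈ annFinset U,
      if φ ≠ 0 ∧ (vecCount K (LinearMap.ker φ) : ℤ) = c then f c else 0 := by
    intro c
    rw [← Finset.sum_filter, Finset.sum_const, nsmul_eq_mul, sizeClass]
  have h2 : f K.card = ∑ φ ∈ annFinset U, if φ = 0 then f K.card else 0 := by
    rw [Finset.sum_ite_eq' (annFinset U) 0 fun _ => f K.card, if_pos (zero_mem_annFinset U)]
  rw [h1, h1, h1, h2, ← Finset.sum_add_distrib, ← Finset.sum_add_distrib,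
    ← Finset.sum_add_distrib]
  refine Finset.sum_congr rfl fun φ _ => ?_
  by_cases hφ : φ = 0
  · subst hφ
    simp [vecCount]
  · have n1 := h.small_ne_middle
    have n2 := h.small_ne_large
    have n3 := h.middle_ne_large
    rcases h.size_cast hφ with h3 | h3 | h3
    · rw [h3, if_neg hφ, if_pos ⟨hφ, rfl⟩, if_neg fun h => n1 h.2, if_neg fun h => n2 h.2]
      ring
    · rw [h3, if_neg hφ, if_neg fun h => n1 h.2.symm, if_pos ⟨hφ, rfl⟩, if_neg fun h => n3 h.2]
      ring
    · rw [h3, if_neg hφ, if_neg fun h => n2 h.2.symm, if_neg fun h => n3 h.2.symm,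
        if_pos ⟨hφ, rfl⟩]
      ring

lemma card_le_sizeClass (h : IsThreeSizeCone k K q s m) {U : Submodule k E} {c : ℤ}
    {φ : Dual k E} (hφ : φ ∈ sizeClass K U c) : (q : ℤ) - 1 ≤ (sizeClass K U c).card := by
  classical
  have hinj : Function.Injective fun a : k => a • φ :=
    smul_left_injective k (mem_sizeClass.1 hφ).2.1
  have h1 : ((Finset.univ.erase (0 : k)).image fun a : k => a • φ) ⊆ sizeClass K U c := by
    intro ψ hψ
    obtain ⟨a, ha, rfl⟩ := Finset.mem_image.1 hψ
    exact smul_mem_sizeClass hφ (Finset.mem_erase.1 ha).1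
  have h2 := Finset.card_le_card h1
  rw [Finset.card_image_of_injective _ hinj, Finset.card_erase_of_mem (Finset.mem_univ _),
    Finset.card_univ, h.card_field] at h2
  omega

variable [FiniteDimensional k E]

lemma card_forms (h : IsThreeSizeCone k K q s m) {U : Submodule k E} {r : ℕ}
    (hr : finrank k U + r = m + 3) :
    (1 : ℤ) + (smallForms K q m U).card + (middleForms K q s m U).card +
      (largeForms K q s m U).card = q ^ r := by
  have := h.sum_annFinset U fun _ => 1
  rw [Finset.sum_const, card_annFinset (hr.trans h.finrank_eq.symm), h.card_field] at this
  simp at this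
  exact this.symm

lemma size_sum (h : IsThreeSizeCone k K q s m) {U : Submodule k E} {r : ℕ}
    (hr : finrank k U + r = m + 3) :
    (q : ℤ) * (K.card + (smallForms K q m U).card * (q ^ m * q) +
      (middleForms K q s m U).card * (q ^ m * (1 + (q - 1) * s)) +
      (largeForms K q s m U).card * (q ^ m * (q + (q - 1) * s))) + q ^ r * vecCount K U =
      q ^ r * (q * vecCount K U + K.card) := by
  have h1 := sum_vecCount_ker K (hr.trans h.finrank_eq.symm)
  rw [h.card_field] at h1
  zify at h1
  rw [h.sum_annFinset U fun x => x] at h1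
  exact h1

lemma size_sq_sum (h : IsThreeSizeCone k K q s m) :
    (q : ℤ) * (K.card ^ 2 + (smallForms K q m (⊥ : Submodule k E)).card * (q ^ m * q) ^ 2 +
      (middleForms K q s m (⊥ : Submodule k E)).card * (q ^ m * (1 + (q - 1) * s)) ^ 2 +
      (largeForms K q s m (⊥ : Submodule k E)).card * (q ^ m * (q + (q - 1) * s)) ^ 2) =
      (K.card - 1) * (q ^ 2 * q ^ m * ((q - 1) * q + K.card)) +
        q ^ 3 * q ^ m * ((q - 1) + K.card) := by
  have h1 := sum_sq_vecCount_ker h.zero_mem h.smul_mem (N := m + 2) h.finrank_eq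
  have h2 := h.sum_annFinset ⊥ fun x => x ^ 2
  rw [annFinset_bot] at h2
  rw [h2, h.card_field] at h1
  rw [h1]
  ring

lemma weight_sum (h : IsThreeSizeCone k K q s m) {U : Submodule k E} {r : ℕ}
    (hr : finrank k U + r = m + 3) {W : ℤ} (hW : (K.card : ℤ) = q * q ^ m + (q - 1) * q ^ m * W) :
    (q : ℤ) * q ^ m * (W + (s - 1) * (middleForms K q s m U).card +
      s * (largeForms K q s m U).card) = q ^ r * (vecCount K U + q ^ m * (W - q)) := by
  refine weight_sum_of_count_sum h.one_lt_cast hW (h.card_forms hr) ?_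
  linear_combination h.size_sum hr

end IsThreeSizeCone

end ThreeSizes

namespace IsThreeSizeCone

variable {k E : Type*} [Field k] [Fintype k] [AddCommGroup E] [Module k E]
  [FiniteDimensional k E] [Fintype (Dual k E)] {K : Finset E} {q s m : ℕ}

lemma exists_weight (h : IsThreeSizeCone k K q s m) {S : Submodule k E}
    (hS : finrank k S = m + 1) (hSK : ∀ v ∈ S, v ∈ K) :
    ∃ W : ℤ, (K.card : ℤ) = q * q ^ m + (q - 1) * q ^ m * W ∧
      ((s : ℤ) - 1) * (middleForms K q s m S).card + s * (largeForms K q s m S).card =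
        (q - 1) * W := by
  have hq1 : (q : ℤ) - 1 ≠ 0 := sub_ne_zero.2 h.one_lt_cast.ne'
  have hq0 : (q : ℤ) ≠ 0 := by linarith [h.one_lt_cast]
  have hz : (vecCount K S : ℤ) = q * q ^ m := by
    rw [vecCount_eq_of_subset hSK, hS, h.card_field]
    push_cast
    ring
  have hsum := h.size_sum (U := S) (r := 2) (by omega)
  have hcard := h.card_forms (U := S) (r := 2) (by omega)
  rw [hz] at hsum
  have hκ : (K.card : ℤ) = q * q ^ m + q ^ m * ((s - 1) * (middleForms K q s m S).card +
      s * (largeForms K q s m S).card) := by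
    refine mul_left_cancel₀ (mul_ne_zero hq0 hq1) ?_
    linear_combination -hsum + q * (q ^ m * q) * hcard
  have hdvd : ((q : ℤ) - 1) ∣ q ^ m * ((s - 1) * (middleForms K q s m S).card +
      s * (largeForms K q s m S).card) := by
    have h1 := h.dvd_card
    rw [hκ] at h1
    have h2 : ((q : ℤ) - 1) ∣ q ^ (m + 1) - 1 := by
      simpa using sub_dvd_pow_sub_pow (q : ℤ) 1 (m + 1)
    refine (dvd_sub h1 h2).trans (Eq.dvd ?_)
    rw [pow_succ]
    ring
  have hcop : IsCoprime ((q : ℤ) - 1) (q ^ m) :=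
    IsCoprime.pow_right ⟨-1, 1, by ring⟩
  obtain ⟨W, hW⟩ := hcop.dvd_of_dvd_mul_left hdvd
  exact ⟨W, by rw [hκ, hW]; ring, hW⟩

lemma card_cases (h : IsThreeSizeCone k K q s m) {S : Submodule k E}
    (hS : finrank k S = m + 1) (hSK : ∀ v ∈ S, v ∈ K) {φ : Dual k E}
    (hφ : φ ∈ smallForms K q m S) :
    (K.card : ℤ) = q * q ^ m + (q - 1) * q ^ m * (s * q) ∨
      (s = 2 ∧ m = 1 ∧ K.card = 100 ∧ largeForms K q s m S = largeForms K q s m ⊥) := by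
  obtain ⟨W, hW, hWS⟩ := h.exists_weight hS hSK
  have hq := h.one_lt_cast
  have hG := h.pow_pos_cast
  obtain ⟨M, rfl⟩ : ∃ M, W = M + q := ⟨W - q, by ring⟩
  have hc := h.card_forms (U := (⊥ : Submodule k E)) (r := m + 3) (by simp)
  have hc' : (1 : ℤ) + (smallForms K q m (⊥ : Submodule k E)).card +
      (middleForms K q s m (⊥ : Submodule k E)).card +
      (largeForms K q s m (⊥ : Submodule k E)).card = q ^ 3 * q ^ m := by
    rw [hc]; ring
  have h1 : M + q + (s - 1) * (middleForms K q s m (⊥ : Submodule k E)).card +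
      s * (largeForms K q s m (⊥ : Submodule k E)).card = q ^ 2 + q ^ 2 * q ^ m * M := by
    have := h.weight_sum (U := (⊥ : Submodule k E)) (r := m + 3) (by simp) hW
    rw [vecCount_bot h.zero_mem] at this
    refine mul_left_cancel₀ (by positivity : (q : ℤ) * q ^ m ≠ 0) ?_
    linear_combination this
  have h2 := weight_sq_sum_of_count_sq_sum hq hG hW hc' h1 h.size_sq_sum
  obtain ⟨a, ha⟩ : ((q : ℤ) - 1) ∣ q ^ (m + 1) - 1 := by
    simpa using sub_dvd_pow_sub_pow (q : ℤ) 1 (m + 1)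
  have ha1 : ((q : ℤ) - 1) * a = q * q ^ m - 1 := by rw [← ha]; ring
  have ha2 : a = q + 1 ∨ (q : ℤ) ^ 2 + q + 1 ≤ a := by
    rcases h.one_le.eq_or_lt with hm | hm
    · left
      refine mul_left_cancel₀ (sub_ne_zero.2 hq.ne') ?_
      rw [ha1, ← hm]
      ring
    · right
      refine le_of_mul_le_mul_left ?_ (by linarith : (0 : ℤ) < q - 1)
      have : (q : ℤ) ^ 3 ≤ q ^ (m + 1) := pow_le_pow_right₀ hq.le (by omega)
      rw [← ha]
      linarith
  obtain ⟨β, hβ0, hβ⟩ := h.exists_middle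
  obtain ⟨γ, hγ0, hγ⟩ := h.exists_large
  have hβ1 : β ∈ middleForms K q s m (⊥ : Submodule k E) := mem_sizeClass.2 ⟨bot_le, hβ0, hβ⟩
  have hγ1 : γ ∈ largeForms K q s m (⊥ : Submodule k E) := mem_sizeClass.2 ⟨bot_le, hγ0, hγ⟩
  have hcS := h.card_forms (U := S) (r := 2) (by omega)
  have hsub : largeForms K q s m S ⊆ largeForms K q s m ⊥ := sizeClass_anti bot_le
  rcases weight_total_cases h.sq_eq_cast h.two_le_cast ha1 ha2
      (by exact_mod_cast Finset.card_pos.2 ⟨β, hβ1⟩)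
      (by exact_mod_cast Finset.card_pos.2 ⟨γ, hγ1⟩) h1 h2 (h.card_le_sizeClass hφ)
      (Nat.cast_nonneg _) (Nat.cast_nonneg _)
      (by exact_mod_cast Finset.card_le_card hsub) hcS hWS with hM | ⟨hs, haq, hM, hγS⟩
  · left
    rw [hW, hM]
    ring
  · right
    have hs2 : s = 2 := by exact_mod_cast hs
    have hq4 : q = 4 := by rw [h.sq_eq, hs2]; norm_num
    have hm : m = 1 := by
      subst hq4
      rw [haq] at ha1
      norm_num at ha1
      have h16 : (4 : ℤ) ^ m = 4 ^ 1 := by linarith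
      exact Nat.pow_right_injective (le_refl 2 |>.trans (by norm_num : 2 ≤ 4))
        (by exact_mod_cast h16)
    refine ⟨hs2, hm, ?_, Finset.eq_of_subset_of_card_le hsub (by exact_mod_cast hγS.ge)⟩
    rw [hM, hq4, hm] at hW
    norm_num at hW
    exact_mod_cast hW

lemma card_eq (h : IsThreeSizeCone k K q s m) :
    (K.card : ℤ) = q * q ^ m + (q - 1) * q ^ m * (s * q) := by
  obtain ⟨φ, hφ0, hφ⟩ := h.exists_small
  have hφ' : (vecCount K (LinearMap.ker φ) : ℤ) = q ^ m * q := by exact_mod_cast hφ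
  obtain ⟨S, hS, hSmem⟩ := h.exists_submodule hφ0 hφ'
  have hφS : φ ∈ smallForms K q m S :=
    mem_sizeClass.2 ⟨fun v hv => ((hSmem v).1 hv).2, hφ0, hφ'⟩
  rcases h.card_cases hS (fun v hv => ((hSmem v).1 hv).1) hφS with h1 | ⟨hs, hm, hc, hL⟩
  · exact h1
  exfalso
  have hq : q = 4 := by rw [h.sq_eq, hs]; norm_num
  subst hs hm hq
  have hsum := h.weight_sum (U := (⊥ : Submodule k E)) (r := 4) (by simp) (W := 7)
    (by rw [hc]; norm_num)
  have hcard := h.card_forms (U := (⊥ : Submodule k E)) (r := 4) (by simp)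
  have hsq := h.size_sq_sum
  rw [vecCount_bot h.zero_mem] at hsum
  rw [hc] at hsq
  norm_num at hsum hcard hsq
  have hγ : (largeForms K 4 2 1 (⊥ : Submodule k E)).card = 9 := by
    zify
    linarith
  have hα : (smallForms K 4 1 (⊥ : Submodule k E)).card = 63 := by
    zify
    linarith
  have hsub : smallForms K 4 1 (⊥ : Submodule k E) ⊆ annFinset S := by
    intro ψ hψ
    obtain ⟨-, hψ0, hψ'⟩ := mem_sizeClass.1 hψ
    obtain ⟨T, hT, hTmem⟩ := h.exists_submodule hψ0 hψ'
    have hψT : T ≤ LinearMap.ker ψ := fun v hv => ((hTmem v).1 hv).2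
    rcases h.card_cases hT (fun v hv => ((hTmem v).1 hv).1)
      (mem_sizeClass.2 ⟨hψT, hψ0, hψ'⟩) with h1 | ⟨-, -, -, hL'⟩
    · rw [hc] at h1
      norm_num at h1
    have hST : S = T := by
      by_contra hne
      have hlt : S < S ⊔ T := by
        refine lt_of_le_of_ne le_sup_left fun he => hne ?_
        have hTS : T ≤ S := he ▸ le_sup_right
        exact (Submodule.eq_of_le_of_finrank_le hTS (by rw [hS, hT])).symm
      have hf := Submodule.finrank_lt_finrank_of_lt hlt
      have hle := Submodule.finrank_le (S ⊔ T)
      rw [h.finrank_eq] at hle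
      have hLsub : largeForms K 4 2 1 (⊥ : Submodule k E) ⊆ annFinset (S ⊔ T) := by
        intro χ hχ
        rw [mem_annFinset, sup_le_iff]
        exact ⟨(mem_sizeClass.1 (hL ▸ hχ)).1, (mem_sizeClass.1 (hL' ▸ hχ)).1⟩
      have h2 := Finset.card_le_card hLsub
      rw [hγ, card_annFinset (r := 4 - finrank k (S ⊔ T : Submodule k E))
        (by rw [h.finrank_eq]; omega), h.card_field] at h2
      have h3 : 4 ^ (4 - finrank k (S ⊔ T : Submodule k E)) ≤ 4 ^ 1 :=
        Nat.pow_le_pow_right (by norm_num) (by omega)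
      omega
    exact mem_annFinset.2 (hST ▸ hψT)
  have h2 := Finset.card_le_card hsub
  rw [hα, card_annFinset (r := 2) (by rw [h.finrank_eq, hS]), h.card_field] at h2
  norm_num at h2

end IsThreeSizeCone

lemma mem_of_vecCount_eq {k E : Type*} [Field k] [Fintype k] [AddCommGroup E] [Module k E]
    [FiniteDimensional k E] {K : Finset E} {U : Submodule k E}
    (h : vecCount K U = Fintype.card k ^ finrank k U) {v : E} (hv : v ∈ U) : v ∈ K := by
  classical
  have : Finite E := Module.finite_of_finite k
  have := Fintype.ofFinite E
  have h1 : K.filter (· ∈ U) ⊆ Finset.univ.filter (· ∈ U) :=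
    Finset.filter_subset_filter _ (Finset.subset_univ K)
  have h2 : (Finset.univ.filter (· ∈ U)).card = Fintype.card k ^ finrank k U := by
    rw [← Module.card_eq_pow_finrank (K := k) (V := U), Fintype.card_subtype]
  have h3 := Finset.eq_of_subset_of_card_le h1 (h2.trans_le h.ge)
  have h4 : v ∈ Finset.univ.filter (· ∈ U) := by simpa using hv
  rw [← h3] at h4
  exact (Finset.mem_filter.1 h4).1

lemma Submodule.inf_le_or_le_sup {k E : Type*} [Field k] [AddCommGroup E] [Module k E]
    [FiniteDimensional k E] {R S T : Submodule k E} {m : ℕ} (hR : finrank k R = m + 1)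
    (hST : finrank k (S ⊓ T : Submodule k E) = m) (hRS : m ≤ finrank k (R ⊓ S : Submodule k E))
    (hRT : m ≤ finrank k (R ⊓ T : Submodule k E)) : S ⊓ T ≤ R ∨ R ≤ S ⊔ T := by
  by_cases hle : R ⊓ S ≤ T
  · left
    have : R ⊓ S = S ⊓ T :=
      Submodule.eq_of_le_of_finrank_le (le_inf inf_le_right hle) (hST.trans_le hRS)
    exact this ▸ inf_le_left
  · right
    have hlt : R ⊓ T < (R ⊓ S) ⊔ (R ⊓ T) :=
      lt_of_le_of_ne le_sup_right fun he => hle (le_sup_left.trans (he ▸ inf_le_right))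
    have h1 := Submodule.finrank_lt_finrank_of_lt hlt
    have h2 : (R ⊓ S) ⊔ (R ⊓ T) = R :=
      Submodule.eq_of_le_of_finrank_le (sup_le inf_le_left inf_le_left) (by omega)
    exact h2 ▸ sup_le_sup inf_le_right inf_le_right

/-- A linear form `φ` of smallest size together with the subspace `S` formed by the vectors of `K`
in its kernel. -/
structure IsSmallPair (k : Type*) {E : Type*} [Field k] [AddCommGroup E] [Module k E]
    (K : Finset E) (q m : ℕ) (φ : Dual k E) (S : Submodule k E) : Prop where
  ne_zero : φ ≠ 0
  size : (vecCount K (LinearMap.ker φ) : ℤ) = q ^ m * q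
  finrank_eq : finrank k S = m + 1
  mem_iff : ∀ v, v ∈ S ↔ v ∈ K ∧ φ v = 0

namespace IsSmallPair

variable {k E : Type*} [Field k] [AddCommGroup E] [Module k E] {K : Finset E} {q m : ℕ}

lemma le_ker {φ : Dual k E} {S : Submodule k E} (hS : IsSmallPair k K q m φ S) :
    S ≤ LinearMap.ker φ :=
  fun v hv => ((hS.mem_iff v).1 hv).2

lemma mem_smallForms [Fintype (Dual k E)] {φ : Dual k E} {S U : Submodule k E}
    (hS : IsSmallPair k K q m φ S) (hU : U ≤ S) : φ ∈ smallForms K q m U :=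
  mem_sizeClass.2 ⟨hU.trans hS.le_ker, hS.ne_zero, hS.size⟩

variable [FiniteDimensional k E]

lemma le_finrank_inf (hE : finrank k E = m + 3) {φ ψ : Dual k E}
    {S T : Submodule k E} (hS : IsSmallPair k K q m φ S) (hT : IsSmallPair k K q m ψ T) :
    m ≤ finrank k (S ⊓ T : Submodule k E) := by
  have h1 : S ⊓ LinearMap.ker ψ = S ⊓ T := by
    ext v
    simp only [Submodule.mem_inf, hS.mem_iff, hT.mem_iff, LinearMap.mem_ker]
    tauto
  have h2 := Submodule.finrank_sup_add_finrank_inf_eq S (LinearMap.ker ψ)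
  have h3 := Module.Dual.finrank_ker_add_one_of_ne_zero hT.ne_zero
  have h4 := Submodule.finrank_le (S ⊔ LinearMap.ker ψ)
  have h5 := hS.finrank_eq
  rw [h1] at h2
  omega

lemma finrank_inf (hE : finrank k E = m + 3) {φ ψ : Dual k E}
    {S T : Submodule k E} (hS : IsSmallPair k K q m φ S) (hT : IsSmallPair k K q m ψ T)
    (hne : S ≠ T) : finrank k (S ⊓ T : Submodule k E) = m := by
  refine le_antisymm ?_ (hS.le_finrank_inf hE hT)
  have hlt : S ⊓ T < S := lt_of_le_of_ne inf_le_left fun he => hne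
    (Submodule.eq_of_le_of_finrank_le (inf_eq_left.1 he) (by rw [hS.finrank_eq, hT.finrank_eq]))
  have := Submodule.finrank_lt_finrank_of_lt hlt
  rw [hS.finrank_eq] at this
  omega

end IsSmallPair

namespace IsThreeSizeCone

variable {k E : Type*} [Field k] [Fintype k] [AddCommGroup E] [Module k E]
  [FiniteDimensional k E] [Fintype (Dual k E)] {K : Finset E} {q s m : ℕ}

lemma vecCount_eq (h : IsThreeSizeCone k K q s m) {U : Submodule k E} {r : ℕ}
    (hr : finrank k U + r = m + 3) :
    (q : ℤ) ^ r * vecCount K U = q * q ^ m * (s * q - s + 1 + (largeForms K q s m U).card -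
      (s - 1) * (smallForms K q m U).card) := by
  linear_combination -h.weight_sum hr h.card_eq + q * q ^ m * (s - 1) * h.card_forms hr

lemma card_forms_bot (h : IsThreeSizeCone k K q s m) :
    (smallForms K q m (⊥ : Submodule k E)).card = ((q : ℤ) - 1) * (s ^ 3 + 1) ∧
      (largeForms K q s m (⊥ : Submodule k E)).card = ((q : ℤ) - 1) * (q * (q - s + 1)) := by
  have hq := h.one_lt_cast
  have hG := h.pow_pos_cast
  have hs := h.two_le_cast
  have hqs := h.sq_eq_cast
  have hc : (1 : ℤ) + (smallForms K q m (⊥ : Submodule k E)).card +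
      (middleForms K q s m (⊥ : Submodule k E)).card +
      (largeForms K q s m (⊥ : Submodule k E)).card = q ^ 3 * q ^ m := by
    rw [h.card_forms (U := (⊥ : Submodule k E)) (r := m + 3) (by simp)]; ring
  have hW : (K.card : ℤ) = q * q ^ m + (q - 1) * q ^ m * (q * (s - 1) + q) := by
    rw [h.card_eq]; ring
  have h1 : (q : ℤ) * (s - 1) + q + (s - 1) * (middleForms K q s m (⊥ : Submodule k E)).card +
      s * (largeForms K q s m (⊥ : Submodule k E)).card = q ^ 2 + q ^ 2 * q ^ m * (q * (s - 1)) := by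
    have := h.weight_sum (U := (⊥ : Submodule k E)) (r := m + 3) (by simp) hW
    rw [vecCount_bot h.zero_mem] at this
    refine mul_left_cancel₀ (by positivity : (q : ℤ) * q ^ m ≠ 0) ?_
    linear_combination this
  have h2 := weight_sq_sum_of_count_sq_sum hq hG hW hc h1 h.size_sq_sum
  have hγ : (largeForms K q s m (⊥ : Submodule k E)).card = ((q : ℤ) - 1) * (q * (q - s + 1)) := by
    refine mul_left_cancel₀ (by linarith : (s : ℤ) ≠ 0) ?_
    linear_combination h2 - (s - 1) * h1
  refine ⟨?_, hγ⟩
  have h3 := h.vecCount_eq (U := (⊥ : Submodule k E)) (r := m + 3) (by simp)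
  rw [vecCount_bot h.zero_mem, hγ] at h3
  have h4 : (q : ℤ) ^ 2 = s * q - s + 1 + ((q : ℤ) - 1) * (q * (q - s + 1)) -
      (s - 1) * (smallForms K q m (⊥ : Submodule k E)).card := by
    refine mul_left_cancel₀ (by positivity : (q : ℤ) * q ^ m ≠ 0) ?_
    linear_combination h3
  refine mul_left_cancel₀ (by linarith : (s : ℤ) - 1 ≠ 0) ?_
  rw [hqs] at h4 ⊢
  linear_combination h4

lemma exists_isSmallPair (h : IsThreeSizeCone k K q s m) {U : Submodule k E} {φ : Dual k E}
    (hφ : φ ∈ smallForms K q m U) : ∃ S, IsSmallPair k K q m φ S := by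
  obtain ⟨-, h0, h1⟩ := mem_sizeClass.1 hφ
  obtain ⟨S, hS, hS'⟩ := h.exists_submodule h0 h1
  exact ⟨S, h0, h1, hS, hS'⟩

lemma card_forms_of_isSmallPair (h : IsThreeSizeCone k K q s m) {φ : Dual k E}
    {S : Submodule k E} (hS : IsSmallPair k K q m φ S) :
    ((smallForms K q m S).card : ℤ) = q - 1 ∧
      ((largeForms K q s m S).card : ℤ) = q ^ 2 - q := by
  have hq := h.one_lt_cast
  have hG := h.pow_pos_cast
  have hs := h.two_le_cast
  have h1 := h.vecCount_eq (U := S) (r := 2) (by rw [hS.finrank_eq])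
  have h2 := h.card_forms (U := S) (r := 2) (by rw [hS.finrank_eq])
  have h3 := h.card_le_sizeClass (hS.mem_smallForms le_rfl)
  rw [vecCount_eq_of_subset fun v hv => ((hS.mem_iff v).1 hv).1, hS.finrank_eq, h.card_field] at h1
  push_cast at h1
  have h4 : (q : ℤ) ^ 2 = s * q - s + 1 + (largeForms K q s m S).card -
      (s - 1) * (smallForms K q m S).card := by
    refine mul_left_cancel₀ (by positivity : (q : ℤ) * q ^ m ≠ 0) ?_
    linear_combination h1
  have h5 : ((smallForms K q m S).card : ℤ) ≤ q - 1 := by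
    refine le_of_mul_le_mul_left ?_ (by linarith : (0 : ℤ) < s)
    have : (0 : ℤ) ≤ (middleForms K q s m S).card := Nat.cast_nonneg _
    linarith
  have h6 : ((smallForms K q m S).card : ℤ) = q - 1 := le_antisymm h5 h3
  refine ⟨h6, ?_⟩
  rw [h6] at h4
  linarith

lemma exists_isSmallPair_ne (h : IsThreeSizeCone k K q s m) :
    ∃ φ ψ : Dual k E, ∃ S T : Submodule k E, IsSmallPair k K q m φ S ∧
      IsSmallPair k K q m ψ T ∧ S ≠ T := by
  obtain ⟨φ, hφ0, hφ⟩ := h.exists_small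
  obtain ⟨S, hS⟩ := h.exists_isSmallPair (U := ⊥)
    (mem_sizeClass.2 ⟨bot_le, hφ0, by exact_mod_cast hφ⟩)
  by_contra hcon
  have hsub : smallForms K q m (⊥ : Submodule k E) ⊆ smallForms K q m S := by
    intro ψ hψ
    obtain ⟨T, hT⟩ := h.exists_isSmallPair hψ
    have hST : S = T := by
      by_contra hne
      exact hcon ⟨φ, ψ, S, T, hS, hT, hne⟩
    exact hT.mem_smallForms hST.le
  have h1 := Finset.card_le_card hsub
  have h2 := h.card_forms_bot.1
  have h3 := (h.card_forms_of_isSmallPair hS).1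
  have hq := h.one_lt_cast
  have hs := h.two_le_cast
  zify at h1
  rw [h2, h3] at h1
  have : (0 : ℤ) < (q - 1) * s ^ 3 := mul_pos (by linarith) (by positivity)
  linarith

lemma exists_not_le (h : IsThreeSizeCone k K q s m) {P : Submodule k E}
    (hP : finrank k P = m + 2) :
    ∃ φ S, IsSmallPair k K q m φ S ∧ ¬ S ≤ P := by
  classical
  by_contra! hcon
  choose! S hS using fun φ (hφ : φ ∈ smallForms K q m (⊥ : Submodule k E)) =>
    h.exists_isSmallPair hφ
  have hq := h.one_lt_cast
  have hs := h.two_le_cast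
  have hqN : 2 ≤ q := by exact_mod_cast hq
  have hcard := Finset.card_mul_le_card_mul (s := smallForms K q m (⊥ : Submodule k E))
    (t := largeForms K q s m (⊥ : Submodule k E) \ annFinset P)
    (m := q ^ 2 - 2 * q) (n := q - 1) (fun φ ψ => S φ ≤ LinearMap.ker ψ) ?_ ?_
  · have h1 := h.card_forms_bot
    have h2 : (smallForms K q m (⊥ : Submodule k E)).card * (q ^ 2 - 2 * q) ≤
        (largeForms K q s m (⊥ : Submodule k E)).card * (q - 1) :=
      hcard.trans (Nat.mul_le_mul_right _ (Finset.card_le_card Finset.sdiff_subset))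
    zify [show 2 * q ≤ q ^ 2 by nlinarith, (by omega : 1 ≤ q)] at h2
    rw [h1.1, h1.2] at h2
    have h3 : ((s : ℤ) ^ 3 + 1) * (q - 2) ≤ (q - s + 1) * (q - 1) := by
      refine le_of_mul_le_mul_left ?_ (mul_pos (by linarith) (by linarith) : (0 : ℤ) < (q - 1) * q)
      linarith
    have h4 : ((s : ℤ) + 1) * (s ^ 2 - 2) ≤ s ^ 2 - 1 := by
      refine le_of_mul_le_mul_left ?_ (by nlinarith : (0 : ℤ) < (s : ℤ) ^ 2 - s + 1)
      rw [h.sq_eq_cast] at h3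
      linarith
    nlinarith
  · intro φ hφ
    have h1 : largeForms K q s m (S φ) \ annFinset P ⊆ Finset.bipartiteAbove
        (fun φ ψ => S φ ≤ LinearMap.ker ψ)
        (largeForms K q s m (⊥ : Submodule k E) \ annFinset P) φ := by
      intro ψ hψ
      rw [Finset.mem_sdiff] at hψ
      rw [Finset.mem_bipartiteAbove, Finset.mem_sdiff]
      exact ⟨⟨sizeClass_anti bot_le hψ.1, hψ.2⟩, (mem_sizeClass.1 hψ.1).1⟩
    have h2 := Finset.le_card_sdiff (annFinset P) (largeForms K q s m (S φ))
    rw [card_annFinset (r := 1) (by rw [hP, h.finrank_eq]), h.card_field, pow_one] at h2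
    have h3 := (h.card_forms_of_isSmallPair (hS φ hφ)).2
    have h4 : (largeForms K q s m (S φ)).card = q ^ 2 - q := by
      zify [show q ≤ q ^ 2 by nlinarith]
      exact h3
    refine le_trans ?_ (Finset.card_le_card h1)
    omega
  · intro ψ hψ
    rw [Finset.mem_sdiff, mem_annFinset] at hψ
    have hinf : finrank k (P ⊓ LinearMap.ker ψ : Submodule k E) ≤ m + 1 := by
      have hlt : P ⊓ LinearMap.ker ψ < P :=
        lt_of_le_of_ne inf_le_left fun he => hψ.2 (inf_eq_left.1 he)
      have := Submodule.finrank_lt_finrank_of_lt hlt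
      omega
    have key : ∀ φ ∈ Finset.bipartiteBelow (fun φ ψ => S φ ≤ LinearMap.ker ψ)
        (smallForms K q m (⊥ : Submodule k E)) ψ,
        IsSmallPair k K q m φ (P ⊓ LinearMap.ker ψ) := by
      intro φ hφ
      rw [Finset.mem_bipartiteBelow] at hφ
      have h1 := hS φ hφ.1
      have h2 : S φ = P ⊓ LinearMap.ker ψ :=
        Submodule.eq_of_le_of_finrank_le (le_inf (hcon φ _ h1) hφ.2)
          (hinf.trans_eq h1.finrank_eq.symm)
      exact h2 ▸ h1
    rcases Finset.eq_empty_or_nonempty (Finset.bipartiteBelow (fun φ ψ => S φ ≤ LinearMap.ker ψ)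
        (smallForms K q m (⊥ : Submodule k E)) ψ) with he | ⟨φ, hφ⟩
    · rw [he]
      simp
    · have h1 := (h.card_forms_of_isSmallPair (key φ hφ)).1
      have h2 : _ ⊆ smallForms K q m (P ⊓ LinearMap.ker ψ) :=
        fun χ hχ => (key χ hχ).mem_smallForms le_rfl
      have h3 := Finset.card_le_card h2
      omega

/-- All the subspaces of `K` cut out by forms of smallest size share a vertex. -/
lemma exists_vertex (h : IsThreeSizeCone k K q s m) :
    ∃ V : Submodule k E, finrank k V = m ∧ (∀ v ∈ V, v ∈ K) ∧
      ∀ φ S, IsSmallPair k K q m φ S → V ≤ S := by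
  obtain ⟨φ, ψ, S, T, hS, hT, hne⟩ := h.exists_isSmallPair_ne
  have hE := h.finrank_eq
  have hV := hS.finrank_inf hE hT hne
  refine ⟨S ⊓ T, hV, fun v hv => ((hS.mem_iff v).1 hv.1).1, ?_⟩
  by_contra! hcon
  obtain ⟨χ, R, hR, hVR⟩ := hcon
  have hdich : ∀ ω Q, IsSmallPair k K q m ω Q → S ⊓ T ≤ Q ∨ Q ≤ S ⊔ T := fun ω Q hQ =>
    Submodule.inf_le_or_le_sup hQ.finrank_eq hV (hQ.le_finrank_inf hE hS)
      (hQ.le_finrank_inf hE hT)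
  have hRP : R ≤ S ⊔ T := (hdich χ R hR).resolve_left hVR
  have hP : finrank k (S ⊔ T : Submodule k E) = m + 2 := by
    have := Submodule.finrank_sup_add_finrank_inf_eq S T
    rw [hS.finrank_eq, hT.finrank_eq, hV] at this
    omega
  obtain ⟨ω, Q, hQ, hQP⟩ := h.exists_not_le hP
  have hVQ : S ⊓ T ≤ Q := (hdich ω Q hQ).resolve_right hQP
  have hlt : Q ⊓ (S ⊔ T) < Q := lt_of_le_of_ne inf_le_left fun he => hQP (inf_eq_left.1 he)
  have h1 := Submodule.finrank_lt_finrank_of_lt hlt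
  rw [hQ.finrank_eq] at h1
  have h2 : S ⊓ T = Q ⊓ (S ⊔ T) :=
    Submodule.eq_of_le_of_finrank_le (le_inf hVQ (inf_le_left.trans le_sup_left)) (by omega)
  have h3 : Q ⊓ R = S ⊓ T :=
    Submodule.eq_of_le_of_finrank_le (h2 ▸ inf_le_inf_left Q hRP)
      (hV.trans_le (hQ.le_finrank_inf hE hR))
  exact hVR (h3 ▸ inf_le_right)

/-- `K` is a cone with an `m`-dimensional vertex, and the hyperplanes through the vertex have
smallest or largest size. -/
lemma exists_cone (h : IsThreeSizeCone k K q s m) :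
    ∃ V : Submodule k E, finrank k V = m ∧ (∀ v ∈ V, v ∈ K) ∧
      (∀ u ∈ K, ∀ v ∈ V, u + v ∈ K) ∧
      ∀ φ : Dual k E, φ ≠ 0 → V ≤ LinearMap.ker φ →
        (vecCount K (LinearMap.ker φ) : ℤ) = q ^ m * q ∨
        (vecCount K (LinearMap.ker φ) : ℤ) = q ^ m * (q + (q - 1) * s) := by
  obtain ⟨V, hV, hVK, hVS⟩ := h.exists_vertex
  have hq := h.one_lt_cast
  have hG := h.pow_pos_cast
  have hsmall : ∀ U : Submodule k E, ∀ φ ∈ smallForms K q m U, V ≤ LinearMap.ker φ := by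
    intro U φ hφ
    obtain ⟨S, hS⟩ := h.exists_isSmallPair hφ
    exact (hVS φ S hS).trans hS.le_ker
  have hα : smallForms K q m V = smallForms K q m ⊥ :=
    (sizeClass_anti bot_le).antisymm fun φ hφ =>
      mem_sizeClass.2 ⟨hsmall _ φ hφ, (mem_sizeClass.1 hφ).2⟩
  have h1 := h.vecCount_eq (U := V) (r := 3) (by rw [hV])
  have h2 := h.vecCount_eq (U := (⊥ : Submodule k E)) (r := m + 3) (by simp)
  rw [vecCount_eq_of_subset hVK, hV, h.card_field, hα] at h1
  rw [vecCount_bot h.zero_mem] at h2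
  push_cast at h1
  have hγ' : ((largeForms K q s m V).card : ℤ) =
      (largeForms K q s m (⊥ : Submodule k E)).card := by
    refine mul_left_cancel₀ (by positivity : (q : ℤ) * q ^ m ≠ 0) ?_
    linear_combination h2 - h1
  have hγ : largeForms K q s m V = largeForms K q s m ⊥ :=
    Finset.eq_of_subset_of_card_le (sizeClass_anti bot_le) (by exact_mod_cast hγ'.ge)
  have hlarge : ∀ U : Submodule k E, ∀ φ ∈ largeForms K q s m U, V ≤ LinearMap.ker φ := by
    intro U φ hφ
    have : φ ∈ largeForms K q s m V := hγ ▸ sizeClass_anti bot_le hφ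
    exact (mem_sizeClass.1 this).1
  have hβ : middleForms K q s m V = ∅ := by
    have h3 := h.card_forms (U := V) (r := 3) (by rw [hV])
    rw [hα, hγ, h.card_forms_bot.1, h.card_forms_bot.2, h.sq_eq_cast] at h3
    rw [← Finset.card_eq_zero]
    zify
    linear_combination h3
  refine ⟨V, hV, hVK, fun u hu v hv => ?_, fun φ hφ hVφ => ?_⟩
  · by_cases huV : u ∈ V
    · exact hVK _ (V.add_mem huV hv)
    have hu0 : u ≠ 0 := fun he => huV (he ▸ V.zero_mem)
    have hclass : ∀ c : ℤ, (∀ U : Submodule k E, ∀ φ ∈ sizeClass K U c, V ≤ LinearMap.ker φ) →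
        sizeClass K (V ⊔ k ∙ u) c = sizeClass K (k ∙ u) c := fun c hc =>
      (sizeClass_anti le_sup_right).antisymm fun φ hφ =>
        mem_sizeClass.2 ⟨sup_le (hc _ φ hφ) (mem_sizeClass.1 hφ).1, (mem_sizeClass.1 hφ).2⟩
    have hr := finrank_sup_span_singleton_of_notMem (k := k) huV
    have h3 := h.vecCount_eq (U := V ⊔ k ∙ u) (r := 2) (by rw [hr, hV])
    have h4 := h.vecCount_eq (U := k ∙ u) (r := m + 2) (by rw [finrank_span_singleton hu0]; ring)
    have huK : ∀ w ∈ k ∙ u, w ∈ K := by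
      intro w hw
      obtain ⟨a, rfl⟩ := Submodule.mem_span_singleton.1 hw
      exact h.smul_mem a u hu
    have hα' : smallForms K q m (V ⊔ k ∙ u) = smallForms K q m (k ∙ u) := hclass _ hsmall
    have hγ'' : largeForms K q s m (V ⊔ k ∙ u) = largeForms K q s m (k ∙ u) := hclass _ hlarge
    rw [hα', hγ''] at h3
    rw [vecCount_eq_of_subset huK, finrank_span_singleton hu0, h.card_field, ← h3] at h4
    have h5 : (vecCount K (V ⊔ k ∙ u) : ℤ) = q ^ (m + 1) := by
      refine mul_left_cancel₀ (by positivity : (q : ℤ) ^ 2 ≠ 0) ?_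
      rw [← h4]
      push_cast
      ring
    refine mem_of_vecCount_eq (U := V ⊔ k ∙ u) ?_
      (Submodule.add_mem _ (Submodule.mem_sup_right (Submodule.mem_span_singleton_self u))
        (Submodule.mem_sup_left hv))
    rw [hr, hV, h.card_field]
    exact_mod_cast h5
  · rcases h.size_cast hφ with h3 | h3 | h3
    · exact Or.inl h3
    · have : φ ∈ middleForms K q s m V := mem_sizeClass.2 ⟨hVφ, hφ, h3⟩
      simp [hβ] at this
    · exact Or.inr h3

end IsThreeSizeCone

lemma vecCount_sup {k E : Type*} [Field k] [Fintype k] [AddCommGroup E] [Module k E]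
    [FiniteDimensional k E] {K : Finset E} {V L : Submodule k E} (hVL : V ⊓ L = ⊥)
    (hadd : ∀ u ∈ K, ∀ v ∈ V, u + v ∈ K) :
    vecCount K (V ⊔ L) = Fintype.card k ^ finrank k V * vecCount K L := by
  classical
  have : Finite E := Module.finite_of_finite k
  have := Fintype.ofFinite E
  have h1 : (Finset.univ.filter (· ∈ V)).card = Fintype.card k ^ finrank k V := by
    rw [← Module.card_eq_pow_finrank (K := k) (V := V), Fintype.card_subtype]
  rw [← h1, vecCount, vecCount, ← Finset.card_product]
  refine (Finset.card_bij (fun x _ => x.2 + x.1) ?_ ?_ ?_).symm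
  · rintro ⟨v, l⟩ hvl
    simp only [Finset.mem_product, Finset.mem_filter, Finset.mem_univ, true_and] at hvl ⊢
    exact ⟨hadd _ hvl.2.1 _ hvl.1,
      Submodule.add_mem _ (Submodule.mem_sup_right hvl.2.2) (Submodule.mem_sup_left hvl.1)⟩
  · rintro ⟨v, l⟩ hvl ⟨v', l'⟩ hvl' he
    simp only [Finset.mem_product, Finset.mem_filter, Finset.mem_univ, true_and] at hvl hvl' he
    have h2 : v - v' ∈ V ⊓ L :=
      ⟨V.sub_mem hvl.1 hvl'.1, by
        rw [show v - v' = l' - l by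
          rw [sub_eq_sub_iff_add_eq_add, add_comm v, he, add_comm]]
        exact L.sub_mem hvl'.2.2 hvl.2.2⟩
    rw [hVL, Submodule.mem_bot, sub_eq_zero] at h2
    subst h2
    rw [add_right_cancel he]
  · intro x hx
    rw [Finset.mem_filter] at hx
    obtain ⟨v, hv, l, hl, rfl⟩ := Submodule.mem_sup.1 hx.2
    have h2 := hadd _ hx.1 _ (V.neg_mem hv)
    rw [show v + l + -v = l by abel] at h2
    exact ⟨(v, l), by simp [hv, hl, h2], add_comm l v⟩

lemma exists_ker_eq_s7 {k E : Type*} [Field k] [AddCommGroup E] [Module k E]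
    [FiniteDimensional k E] {W : Submodule k E} (hW : finrank k W + 1 = finrank k E) :
    ∃ φ : Dual k E, φ ≠ 0 ∧ LinearMap.ker φ = W := by
  have hlt : W < ⊤ := lt_top_iff_ne_top.2 fun he => by
    rw [he, finrank_top] at hW
    omega
  obtain ⟨φ, hφ, hle⟩ := Submodule.exists_le_ker_of_lt_top W hlt
  have h1 := Module.Dual.finrank_ker_add_one_of_ne_zero hφ
  exact ⟨φ, hφ, (Submodule.eq_of_le_of_finrank_le hle (by omega)).symm⟩

section ConeFinset

variable {k E : Type*} [Field k] [AddCommGroup E] [Module k E]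

lemma submodule_le_iff_rep_mem {x : Projectivization k E} {W : Submodule k E} :
    x.submodule ≤ W ↔ x.rep ∈ W := by
  rw [Projectivization.submodule_eq, Submodule.span_singleton_le_iff_mem]

variable [Finite E]

/-- The vectors representing the points of a point set, together with `0`. -/
def coneFinset (K : Set (Projectivization k E)) : Finset E :=
  (Set.toFinite {v : E | ∀ hv : v ≠ 0, Projectivization.mk k v hv ∈ K}).toFinset

variable {K : Set (Projectivization k E)}

lemma mem_coneFinset_iff {v : E} (hv : v ≠ 0) :
    v ∈ coneFinset K ↔ Projectivization.mk k v hv ∈ K := by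
  simp [coneFinset, hv]

lemma zero_mem_coneFinset : (0 : E) ∈ coneFinset K := by
  simp [coneFinset]

lemma rep_mem_coneFinset_iff {x : Projectivization k E} : x.rep ∈ coneFinset K ↔ x ∈ K := by
  rw [mem_coneFinset_iff x.rep_nonzero, x.mk_rep]

lemma smul_mem_coneFinset (a : k) {v : E} (hv : v ∈ coneFinset K) : a • v ∈ coneFinset K := by
  by_cases h : a • v = 0
  · rw [h]
    exact zero_mem_coneFinset
  have hv0 : v ≠ 0 := fun he => h (by rw [he, smul_zero])
  rw [mem_coneFinset_iff hv0] at hv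
  rwa [mem_coneFinset_iff h, (Projectivization.mk_eq_mk_iff' k (a • v) v h hv0).2 ⟨a, rfl⟩]

lemma vecCount_coneFinset [Fintype k] (K : Set (Projectivization k E)) (W : Submodule k E) :
    vecCount (coneFinset K) W =
      1 + (Fintype.card k - 1) * (K ∩ {x | x.submodule ≤ W}).ncard := by
  classical
  have h0 : (0 : E) ∈ (coneFinset K).filter (· ∈ W) := by
    simp [zero_mem_coneFinset]
  rw [vecCount, ← Finset.card_erase_add_one h0, add_comm, ← Fintype.card_units,
    Set.ncard_eq_toFinset_card _ (Set.toFinite _), ← Finset.card_univ, ← Finset.card_product]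
  congr 1
  refine (Finset.card_bij (fun x _ => x.1 • x.2.rep) ?_ ?_ ?_).symm
  · rintro ⟨a, x⟩ hx
    simp only [Finset.mem_product, Finset.mem_univ, true_and, Set.Finite.mem_toFinset,
      Set.mem_inter_iff, Set.mem_ofPred_eq, submodule_le_iff_rep_mem] at hx
    rw [Finset.mem_erase, Finset.mem_filter]
    refine ⟨?_, smul_mem_coneFinset (a : k) (rep_mem_coneFinset_iff.2 hx.1),
      W.smul_mem (a : k) hx.2⟩
    exact (smul_ne_zero_iff_ne a).2 x.rep_nonzero
  · rintro ⟨a, x⟩ - ⟨b, y⟩ - he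
    simp only at he
    have hxy : x = y := by
      rw [← x.mk_rep, ← y.mk_rep, Projectivization.mk_eq_mk_iff]
      exact ⟨a⁻¹ * b, by rw [mul_smul, ← he, inv_smul_smul]⟩
    subst hxy
    rw [Units.ext (smul_left_injective k x.rep_nonzero he)]
  · intro v hv
    rw [Finset.mem_erase, Finset.mem_filter, mem_coneFinset_iff hv.1] at hv
    obtain ⟨a, ha⟩ := Projectivization.exists_smul_eq_mk_rep k v hv.1
    refine ⟨(a⁻¹, Projectivization.mk k v hv.1), ?_, by rw [← ha, inv_smul_smul]⟩
    simp only [Finset.mem_product, Finset.mem_univ, true_and, Set.Finite.mem_toFinset,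
      Set.mem_inter_iff, Set.mem_ofPred_eq, submodule_le_iff_rep_mem]
    exact ⟨hv.2.1, ha ▸ W.smul_mem (a : k) hv.2.2⟩

end ConeFinset

lemma theta_mul {q : ℕ} (hq : 1 ≤ q) (j : ℕ) :
    ((q : ℤ) - 1) * theta q j = q ^ (j + 1) - 1 := by
  have h1 : (q - 1) * theta q j = q ^ (j + 1) - 1 :=
    Nat.mul_div_cancel' (by simpa using Nat.sub_dvd_pow_sub_pow q 1 (j + 1))
  zify [hq, Nat.one_le_pow (j + 1) q hq] at h1
  exact h1

lemma vecCount_coneFinset_cast {F : Type} [Field F] [Fintype F] {n q : ℕ}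
    (hq : Fintype.card F = q) (K : Set (PGPoint F n)) (W : Submodule F (Fin (n + 1) → F)) :
    (vecCount (coneFinset K) W : ℤ) =
      1 + ((q : ℤ) - 1) * (K ∩ projSet F n W).ncard := by
  have h1 : 1 ≤ q := hq ▸ Fintype.card_pos
  rw [vecCount_coneFinset, hq]
  push_cast [h1]
  rfl

lemma isThreeSizeCone_coneFinset {F : Type} [Field F] [Fintype F] {q s l : ℕ}
    (hqs : q = s ^ 2) (hs : 2 ≤ s) (hq : Fintype.card F = q) {K : Set (PGPoint F (l + 3))}
    (hblock : BlocksDim F (l + 3) 1 K)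
    (hK : IsType3 F (l + 3) K (theta q (l + 1)) (theta q l + s ^ (2 * l + 3))
      (theta q (l + 1) + s ^ (2 * l + 3))) :
    IsThreeSizeCone F (coneFinset K) q s (l + 1) := by
  have hE : finrank F (Fin (l + 3 + 1) → F) = l + 3 + 1 := by simp
  have hq1 : 1 ≤ q := hq ▸ Fintype.card_pos
  have hcount := vecCount_coneFinset_cast hq K
  have hpow : (s : ℤ) ^ (2 * l + 3) = q ^ (l + 1) * s := by
    rw [hqs]
    push_cast
    ring
  have hθ := theta_mul hq1
  have hsmall : ∀ W, (K ∩ projSet F (l + 3) W).ncard = theta q (l + 1) →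
      (vecCount (coneFinset K) W : ℤ) = q ^ (l + 1) * q := by
    intro W hW
    rw [hcount, hW, hθ]
    ring
  have hmiddle : ∀ W, (K ∩ projSet F (l + 3) W).ncard = theta q l + s ^ (2 * l + 3) →
      (vecCount (coneFinset K) W : ℤ) = q ^ (l + 1) * (1 + (q - 1) * s) := by
    intro W hW
    rw [hcount, hW]
    push_cast
    rw [mul_add, hθ, hpow]
    ring
  have hlarge : ∀ W, (K ∩ projSet F (l + 3) W).ncard = theta q (l + 1) + s ^ (2 * l + 3) →
      (vecCount (coneFinset K) W : ℤ) = q ^ (l + 1) * (q + (q - 1) * s) := by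
    intro W hW
    rw [hcount, hW]
    push_cast
    rw [mul_add, hθ, hpow]
    ring
  obtain ⟨hall, ⟨W₁, hW₁, h₁⟩, ⟨W₂, hW₂, h₂⟩, ⟨W₃, hW₃, h₃⟩⟩ := hK
  refine ⟨hq, hqs, hs, by omega, by rw [hE], zero_mem_coneFinset,
    fun a v hv => smul_mem_coneFinset a hv, fun W hW => ?_, ?_, fun φ hφ => ?_, ?_, ?_, ?_⟩
  · obtain ⟨x, hxK, hxW⟩ := hblock W hW
    exact ⟨x.rep, submodule_le_iff_rep_mem.1 hxW, x.rep_nonzero, rep_mem_coneFinset_iff.2 hxK⟩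
  · have h1 := hcount ⊤
    have h2 : vecCount (coneFinset K) (⊤ : Submodule F (Fin (l + 3 + 1) → F)) =
        (coneFinset K).card := by simp [vecCount]
    rw [h2] at h1
    rw [h1, add_sub_cancel_left]
    exact dvd_mul_right _ _
  · have h1 := Module.Dual.finrank_ker_add_one_of_ne_zero hφ
    rw [hE] at h1
    rcases hall (LinearMap.ker φ) (by omega) with h | h | h
    · exact Or.inl (by exact_mod_cast hsmall _ h)
    · exact Or.inr (Or.inl (hmiddle _ h))
    · exact Or.inr (Or.inr (hlarge _ h))
  · obtain ⟨φ, hφ, rfl⟩ := exists_ker_eq_s7 (W := W₁) (by rw [hW₁, hE])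
    exact ⟨φ, hφ, by exact_mod_cast hsmall _ h₁⟩
  · obtain ⟨φ, hφ, rfl⟩ := exists_ker_eq_s7 (W := W₂) (by rw [hW₂, hE])
    exact ⟨φ, hφ, hmiddle _ h₂⟩
  · obtain ⟨φ, hφ, rfl⟩ := exists_ker_eq_s7 (W := W₃) (by rw [hW₃, hE])
    exact ⟨φ, hφ, hlarge _ h₃⟩

lemma isUnitalCone_of_isThreeSizeCone {F : Type} [Field F] [Fintype F] {q s l : ℕ}
    {K : Set (PGPoint F (l + 3))}
    (h : IsThreeSizeCone F (coneFinset K) q s (l + 1)) :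
    IsUnitalCone F (l + 3) s K := by
  have : Finite (Dual F (Fin (l + 3 + 1) → F)) := Module.finite_of_finite F
  let _ := Fintype.ofFinite (Dual F (Fin (l + 3 + 1) → F))
  have hE : finrank F (Fin (l + 3 + 1) → F) = l + 3 + 1 := by simp
  have hcount := vecCount_coneFinset_cast h.card_field K
  have hq := h.one_lt_cast
  have hG := h.pow_pos_cast
  obtain ⟨V, hV, hVK, hadd, hsize⟩ := h.exists_cone
  obtain ⟨T, hVT⟩ := V.exists_isCompl
  have hT : finrank F T = 3 := by
    have := Submodule.finrank_add_eq_of_isCompl hVT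
    omega
  have hinf : ∀ L ≤ T, V ⊓ L = ⊥ := fun L hL =>
    le_bot_iff.1 ((inf_le_inf_left V hL).trans_eq hVT.inf_eq_bot)
  have hsup : ∀ L ≤ T, (vecCount (coneFinset K) (V ⊔ L) : ℤ) =
      q ^ (l + 1) * vecCount (coneFinset K) L := by
    intro L hL
    rw [vecCount_sup (hinf L hL) hadd, hV, h.card_field]
    push_cast
    rfl
  have hcancel : ∀ {x y : ℤ}, (q : ℤ) ^ (l + 1) * x = q ^ (l + 1) * y → x = y :=
    fun he => mul_left_cancel₀ hG.ne' he
  have hcancel' : ∀ {N : ℕ} {M : ℤ}, 1 + ((q : ℤ) - 1) * N = 1 + (q - 1) * M → (N : ℤ) = M :=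
    fun he => mul_left_cancel₀ (sub_ne_zero.2 hq.ne') (add_left_cancel he)
  refine ⟨V, T, hV, hT, hVT.inf_eq_bot, ?_, ⟨inter_subset_right, ?_, ?_⟩, ?_⟩
  · intro x hx
    exact rep_mem_coneFinset_iff.1 (hVK _ (submodule_le_iff_rep_mem.1 hx))
  · have h1 := hsup T le_rfl
    have h2 : vecCount (coneFinset K) (⊤ : Submodule F (Fin (l + 3 + 1) → F)) =
        (coneFinset K).card := by simp [vecCount]
    rw [hVT.sup_eq_top, h2, h.card_eq] at h1
    have h3 : (vecCount (coneFinset K) T : ℤ) = 1 + (q - 1) * (s ^ 3 + 1) := by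
      refine hcancel ?_
      rw [← h1, h.sq_eq_cast]
      ring
    rw [hcount] at h3
    exact_mod_cast hcancel' h3
  · intro L hL hL2
    have h1 := Submodule.finrank_sup_add_finrank_inf_eq V L
    rw [hinf L hL, finrank_bot, hV, hL2] at h1
    obtain ⟨φ, hφ, hker⟩ := exists_ker_eq_s7 (W := V ⊔ L) (by rw [hE]; omega)
    have hTL : K ∩ projSet F (l + 3) T ∩ projSet F (l + 3) L = K ∩ projSet F (l + 3) L := by
      have hsub : projSet F (l + 3) L ⊆ projSet F (l + 3) T := fun x hx => le_trans hx hL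
      rw [inter_assoc, inter_eq_right.2 hsub]
    rw [hTL]
    rcases hsize φ hφ (hker ▸ le_sup_left) with h2 | h2
    · left
      rw [hker, hsup L hL] at h2
      have h3 := hcancel h2
      rw [hcount] at h3
      exact_mod_cast hcancel' (M := 1) (by linarith)
    · right
      rw [hker, hsup L hL] at h2
      have h3 := hcancel h2
      rw [hcount] at h3
      exact_mod_cast hcancel' (M := s + 1) (by linarith)
  · have hcover : ∀ a ∈ V, ∃ x ∈ projSet F (l + 3) V, a ∈ x.submodule := by
      intro a ha
      by_cases ha0 : a = 0
      · have hne : V ≠ ⊥ := by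
          rintro rfl
          rw [finrank_bot] at hV
          omega
        obtain ⟨b, hb, hb0⟩ := V.exists_mem_ne_zero_of_ne_bot hne
        refine ⟨Projectivization.mk F b hb0, ?_, ha0 ▸ Submodule.zero_mem _⟩
        simpa [projSet] using hb
      · refine ⟨Projectivization.mk F a ha0, ?_, by simp [Submodule.mem_span_singleton_self]⟩
        simpa [projSet] using ha
    ext z
    simp only [mem_union, mem_iUnion, exists_prop]
    constructor
    · intro hz
      obtain ⟨a, ha, t, ht, hat⟩ := Submodule.mem_sup.1
        (hVT.sup_eq_top ▸ Submodule.mem_top : z.rep ∈ V ⊔ T)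
      by_cases ht0 : t = 0
      · left
        rw [ht0, add_zero] at hat
        exact submodule_le_iff_rep_mem.2 (hat ▸ ha)
      · right
        obtain ⟨x, hx, hax⟩ := hcover a ha
        have htK := hadd _ (rep_mem_coneFinset_iff.2 hz) _ (V.neg_mem ha)
        rw [← hat, show a + t + -a = t by abel, mem_coneFinset_iff ht0] at htK
        refine ⟨Projectivization.mk F t ht0, ⟨htK, by simpa [projSet] using ht⟩, x, hx,
          submodule_le_iff_rep_mem.2 ?_⟩
        rw [← hat]
        exact Submodule.add_mem_sup hax (by simp [Submodule.mem_span_singleton_self])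
    · rintro (hz | ⟨y, hy, x, hx, hz⟩)
      · exact rep_mem_coneFinset_iff.1 (hVK _ (submodule_le_iff_rep_mem.1 hz))
      · obtain ⟨a, ha, b, hb, hab⟩ := Submodule.mem_sup.1 (submodule_le_iff_rep_mem.1 hz)
        rw [Projectivization.submodule_eq y] at hb
        obtain ⟨c, rfl⟩ := Submodule.mem_span_singleton.1 hb
        rw [← rep_mem_coneFinset_iff, ← hab, add_comm a]
        exact hadd _ (smul_mem_coneFinset c (rep_mem_coneFinset_iff.2 hy.1)) _ (hx ha)

/-- In `PG(n,q)`, `n ≥ 3`, `q` a square prime power, every `(n-1)`-blocking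
set of type `(θ_{n-2}, θ_{n-3} + √q^{2n-3}, θ_{n-2} + √q^{2n-3})_{n-1}` is a unital cone
(for `n = 3` the vertex is a single point). -/
theorem statement7 [Fintype F] (p e q sq n : ℕ) (hp : p.Prime) (he : 0 < e)
    (hqdef : q = p ^ (2 * e)) (hsq : sq = p ^ e) (hq : Fintype.card F = q)
    (hn : 3 ≤ n)
    (K : Set (PGPoint F n)) (hblock : BlocksDim F n 1 K)
    (hK : IsType3 F n K (theta q (n - 2)) (theta q (n - 3) + sq ^ (2 * n - 3))
      (theta q (n - 2) + sq ^ (2 * n - 3))) :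
    IsUnitalCone F n sq K := by
  obtain ⟨l, rfl⟩ : ∃ l, n = l + 3 := ⟨n - 3, by omega⟩
  have hs : 2 ≤ sq := hsq ▸ hp.two_le.trans (Nat.le_self_pow he.ne' p)
  have hqs : q = sq ^ 2 := by rw [hqdef, hsq, ← pow_mul, mul_comm]
  rw [show l + 3 - 2 = l + 1 by omega, show l + 3 - 3 = l by omega,
    show 2 * (l + 3) - 3 = 2 * l + 3 by omega] at hK
  exact isUnitalCone_of_isThreeSizeCone (isThreeSizeCone_coneFinset hqs hs hq hblock hK)
end
end

section
/- In PG(3,q), every point set K of type (1, q+2, 2q+1)_2 is a cone over a hyperoval: there exist a point P ∈ K and a plane μ not containing P such that K ∩ μ is a hyperoval of μ and K is the union of all points on lines joining P to points of K ∩ μ. -/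
open Module Set

noncomputable section

variable (F : Type) [Field F]

/-- `A` is a hyperoval of the plane (rank-3 subspace) `Wt` of `PG(n,q)`: a set of
`q + 2` points of the plane meeting every line of the plane in exactly `0` or `2`
points. -/
def IsHyperoval (n q : ℕ) (Wt : Submodule F (Fin (n + 1) → F)) (A : Set (PGPoint F n)) : Prop :=
  A ⊆ projSet F n Wt ∧ A.ncard = q + 2 ∧
  ∀ L : Submodule F (Fin (n + 1) → F), L ≤ Wt → finrank F L = 2 →
    (A ∩ projSet F n L).ncard = 0 ∨ (A ∩ projSet F n L).ncard = 2

/-- `A` is a maximal arc of degree `d` in the plane (rank-3 subspace) `Wt` of `PG(n,q)`: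
a nonempty set of points of the plane meeting every line of the plane in exactly `0`
or `d` points. -/
def IsMaximalArc (n d : ℕ) (Wt : Submodule F (Fin (n + 1) → F)) (A : Set (PGPoint F n)) : Prop :=
  A ⊆ projSet F n Wt ∧ A.Nonempty ∧
  ∀ L : Submodule F (Fin (n + 1) → F), L ≤ Wt → finrank F L = 2 →
    (A ∩ projSet F n L).ncard = 0 ∨ (A ∩ projSet F n L).ncard = d

section Pencils

variable {F}

theorem projSet_mono {n : ℕ} {U W : Submodule F (Fin (n + 1) → F)} (h : U ≤ W) :
    projSet F n U ⊆ projSet F n W :=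
  fun _ hx ↦ le_trans hx h

theorem not_submodule_le_iff {n : ℕ} (x : PGPoint F n)
    (W : Submodule F (Fin (n + 1) → F)) : ¬ x.submodule ≤ W ↔ W ⊓ x.submodule = ⊥ := by
  rw [← disjoint_iff, x.submodule_eq, Submodule.disjoint_span_singleton' x.rep_nonzero,
    Submodule.span_singleton_le_iff_mem]

theorem finrank_sup_point {n : ℕ} {x : PGPoint F n} {W : Submodule F (Fin (n + 1) → F)}
    (h : ¬ x.submodule ≤ W) : finrank F ↥(W ⊔ x.submodule) = finrank F W + 1 := by
  have := Submodule.finrank_sup_add_finrank_inf_eq W x.submodule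
  rwa [(not_submodule_le_iff x W).1 h, finrank_bot, x.finrank_submodule] at this

theorem finrank_sup_two_points {n : ℕ} {x y : PGPoint F n} (h : x ≠ y) :
    finrank F ↥(x.submodule ⊔ y.submodule) = 2 := by
  rw [finrank_sup_point, x.finrank_submodule]
  intro hle
  refine h (Projectivization.submodule_injective (Submodule.eq_of_le_of_finrank_eq hle ?_)).symm
  rw [x.finrank_submodule, y.finrank_submodule]

theorem exists_point_of_not_le {n : ℕ} {U W : Submodule F (Fin (n + 1) → F)} (h : ¬ U ≤ W) :
    ∃ x : PGPoint F n, x.submodule ≤ U ∧ ¬ x.submodule ≤ W := by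
  obtain ⟨v, hvU, hvW⟩ := SetLike.not_le_iff_exists.1 h
  have hv : v ≠ 0 := by
    rintro rfl
    exact hvW W.zero_mem
  refine ⟨Projectivization.mk F v hv, ?_, ?_⟩ <;>
    rw [Projectivization.submodule_mk, Submodule.span_singleton_le_iff_mem] <;> assumption

theorem exists_point_of_finrank_lt {n : ℕ} {U W : Submodule F (Fin (n + 1) → F)}
    (h : finrank F W < finrank F U) :
    ∃ x : PGPoint F n, x.submodule ≤ U ∧ ¬ x.submodule ≤ W :=
  exists_point_of_not_le fun hle ↦ (Submodule.finrank_mono hle).not_gt h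

/-- Two distinct planes of `PG(3,q)` meet in a line. -/
theorem finrank_inf_planes {U W : Submodule F (Fin 4 → F)} (hU : finrank F U = 3)
    (hW : finrank F W = 3) (h : U ≠ W) : finrank F ↥(U ⊓ W) = 2 := by
  have h1 := Submodule.finrank_sup_add_finrank_inf_eq U W
  have h2 : finrank F ↥(U ⊔ W) ≤ 4 := by simpa using Submodule.finrank_le (U ⊔ W)
  have h3 : finrank F ↥(U ⊓ W) ≤ 2 := by
    by_contra! h3
    have hUW : U ⊓ W = U := Submodule.eq_of_le_of_finrank_le inf_le_left (by omega)
    exact h (Submodule.eq_of_le_of_finrank_eq (inf_eq_left.1 hUW) (by omega))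
  omega

theorem exists_plane_not_through (P : PGPoint F 3) :
    ∃ W : Submodule F (Fin 4 → F), finrank F W = 3 ∧ ¬ P.submodule ≤ W := by
  obtain ⟨W, hW⟩ := Submodule.exists_isCompl P.submodule
  refine ⟨W, ?_, (not_submodule_le_iff P W).2 hW.symm.inf_eq_bot⟩
  have := Submodule.finrank_add_eq_of_isCompl hW
  simp [P.finrank_submodule] at this
  omega

theorem ncard_projSet [Fintype F] {n d : ℕ} {W : Submodule F (Fin (n + 1) → F)}
    (h : finrank F W = d) :
    (projSet F n W).ncard = ∑ i ∈ Finset.range d, Fintype.card F ^ i := by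
  rw [← Nat.card_eq_fintype_card, ← Projectivization.card_of_finrank F W h]
  have hinj := W.subtype_injective
  rw [← Set.ncard_univ, ← Set.ncard_image_of_injective univ
    (Projectivization.map_injective W.subtype hinj), Set.image_univ]
  congr 1
  ext x
  constructor
  · intro hx
    have hxW : x.rep ∈ W := by
      rw [← Submodule.span_singleton_le_iff_mem, ← x.submodule_eq]
      exact hx
    have h0 : (⟨x.rep, hxW⟩ : W) ≠ 0 := fun h ↦ x.rep_nonzero (congrArg Subtype.val h)
    refine ⟨Projectivization.mk F ⟨x.rep, hxW⟩ h0, ?_⟩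
    rw [Projectivization.map_mk]
    exact x.mk_rep
  · rintro ⟨y, rfl⟩
    induction y using Projectivization.ind with
    | h v hv =>
      rw [Projectivization.map_mk]
      simp [projSet, Projectivization.submodule_mk, Submodule.span_singleton_le_iff_mem]

variable [Fintype F]

/-- The planes of `PG(3,q)` through `L`. -/
def planesThrough (L : Submodule F (Fin 4 → F)) : Finset (Submodule F (Fin 4 → F)) :=
  {W : Submodule F (Fin 4 → F) | finrank F W = 3 ∧ L ≤ W}.toFinite.toFinset

theorem mem_planesThrough {L W : Submodule F (Fin 4 → F)} :
    W ∈ planesThrough L ↔ finrank F W = 3 ∧ L ≤ W := by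
  simp [planesThrough]

theorem sup_point_eq_plane {L W : Submodule F (Fin 4 → F)} (hL : finrank F L = 2)
    (hW : W ∈ planesThrough L) {x : PGPoint F 3} (hx : ¬ x.submodule ≤ L)
    (hxW : x.submodule ≤ W) : L ⊔ x.submodule = W := by
  rw [mem_planesThrough] at hW
  refine Submodule.eq_of_le_of_finrank_eq (sup_le hW.2 hxW) ?_
  rw [finrank_sup_point hx, hL, hW.1]

theorem sup_point_mem_planesThrough {L : Submodule F (Fin 4 → F)} (hL : finrank F L = 2)
    {x : PGPoint F 3} (hx : ¬ x.submodule ≤ L) : L ⊔ x.submodule ∈ planesThrough L := by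
  rw [mem_planesThrough, finrank_sup_point hx, hL]
  exact ⟨rfl, le_sup_left⟩

/-- The planes through a line partition the points of `K` off the line. -/
theorem ncard_diff_line_eq_sum (K : Set (PGPoint F 3)) {L : Submodule F (Fin 4 → F)}
    (hL : finrank F L = 2) :
    (K \ projSet F 3 L).ncard =
      ∑ W ∈ planesThrough L, ((K ∩ projSet F 3 W) \ projSet F 3 L).ncard := by
  classical
  rw [Set.ncard_eq_toFinset_card _ (Set.toFinite _),
    Finset.card_eq_sum_card_fiberwise (f := fun x : PGPoint F 3 ↦ L ⊔ x.submodule)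
      (t := planesThrough L)]
  · refine Finset.sum_congr rfl fun W hW ↦ ?_
    rw [Set.ncard_eq_toFinset_card _ (Set.toFinite _)]
    congr 1
    ext x
    simp only [Finset.mem_filter, Set.Finite.mem_toFinset, Set.mem_sdiff, Set.mem_inter_iff]
    constructor
    · rintro ⟨⟨hxK, hxL⟩, rfl⟩
      exact ⟨⟨hxK, (le_sup_right : x.submodule ≤ L ⊔ x.submodule)⟩, hxL⟩
    · rintro ⟨⟨hxK, hxW⟩, hxL⟩
      exact ⟨⟨hxK, hxL⟩, sup_point_eq_plane hL hW hxL hxW⟩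
  · intro x hx
    simp only [Finset.mem_coe, Set.Finite.mem_toFinset, Set.mem_sdiff] at hx ⊢
    exact sup_point_mem_planesThrough hL hx.2

theorem sum_ncard_planesThrough (K : Set (PGPoint F 3)) {L : Submodule F (Fin 4 → F)}
    (hL : finrank F L = 2) :
    ∑ W ∈ planesThrough L, (K ∩ projSet F 3 W).ncard + (K ∩ projSet F 3 L).ncard =
      K.ncard + (planesThrough L).card * (K ∩ projSet F 3 L).ncard := by
  rw [← Set.ncard_inter_add_ncard_sdiff_eq_ncard K (projSet F 3 L) (Set.toFinite _),
    ncard_diff_line_eq_sum K hL, Finset.card_eq_sum_ones, Finset.sum_mul, add_assoc,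
    ← Finset.sum_add_distrib, add_comm]
  congr 1
  refine Finset.sum_congr rfl fun W hW ↦ ?_
  rw [← Set.ncard_inter_add_ncard_sdiff_eq_ncard (K ∩ projSet F 3 W) (projSet F 3 L)
    (Set.toFinite _), one_mul, add_comm, Set.inter_assoc,
    Set.inter_eq_right.2 (projSet_mono (mem_planesThrough.1 hW).2)]

theorem card_planesThrough {L : Submodule F (Fin 4 → F)} (hL : finrank F L = 2) :
    (planesThrough L).card = Fintype.card F + 1 := by
  have h := sum_ncard_planesThrough (projSet F 3 (⊤ : Submodule F (Fin 4 → F))) hL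
  have huniv : projSet F 3 (⊤ : Submodule F (Fin 4 → F)) = univ := by
    ext x
    simp [projSet]
  have h4 := ncard_projSet (F := F) (n := 3) (W := ⊤) (d := 4) (by simp)
  have h2 := ncard_projSet (F := F) (n := 3) hL
  rw [huniv] at h h4
  simp only [Set.univ_inter] at h
  rw [Finset.sum_congr rfl fun W hW ↦ ncard_projSet (n := 3) (mem_planesThrough.1 hW).1,
    h4, h2] at h
  simp only [Finset.sum_const, smul_eq_mul, Finset.sum_range_succ, Finset.sum_range_zero] at h
  have hq : 0 < Fintype.card F := Fintype.card_pos
  have : ((planesThrough L).card : ℤ) * Fintype.card F ^ 2 =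
      (Fintype.card F + 1) * Fintype.card F ^ 2 := by
    zify at h
    linarith
  have h0 : (Fintype.card F : ℤ) ^ 2 ≠ 0 := by positivity
  exact_mod_cast mul_right_cancel₀ h0 this

end Pencils

section PlaneCharacters

variable {F} [Fintype F]

open Classical in
/-- The planes of `PG(3,q)` through `L` that meet `K` in exactly `m` points. -/
def planesMeeting (K : Set (PGPoint F 3)) (L : Submodule F (Fin 4 → F)) (m : ℕ) :
    Finset (Submodule F (Fin 4 → F)) :=
  {W ∈ planesThrough L | (K ∩ projSet F 3 W).ncard = m}

theorem mem_planesMeeting {K : Set (PGPoint F 3)} {L W : Submodule F (Fin 4 → F)} {m : ℕ} :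
    W ∈ planesMeeting K L m ↔
      (finrank F W = 3 ∧ L ≤ W) ∧ (K ∩ projSet F 3 W).ncard = m := by
  classical
  simp [planesMeeting, mem_planesThrough]

theorem planesMeeting_subset (K : Set (PGPoint F 3)) (L : Submodule F (Fin 4 → F)) (m : ℕ) :
    planesMeeting K L m ⊆ planesThrough L :=
  Finset.filter_subset _ _

variable {K : Set (PGPoint F 3)}

theorem card_planesMeeting_add
    (hK : IsType3 F 3 K 1 (Fintype.card F + 2) (2 * Fintype.card F + 1))
    {L : Submodule F (Fin 4 → F)} (hL : finrank F L = 2) :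
    (planesMeeting K L (Fintype.card F + 2)).card +
      (planesMeeting K L (2 * Fintype.card F + 1)).card + (planesMeeting K L 1).card =
      Fintype.card F + 1 := by
  classical
  have hq : 1 < Fintype.card F := Fintype.one_lt_card
  rw [← card_planesThrough hL, Finset.card_eq_sum_card_fiberwise (s := planesThrough L)
      (f := fun W ↦ (K ∩ projSet F 3 W).ncard)
      (t := {Fintype.card F + 2, 2 * Fintype.card F + 1, 1})]
  · rw [Finset.sum_insert (by simp; omega), Finset.sum_insert (by simp),
      Finset.sum_singleton, add_assoc]
    rfl
  · intro W hW
    have := hK.1 W (mem_planesThrough.1 hW).1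
    simp only [Finset.coe_insert, Finset.coe_singleton, Set.mem_insert_iff, Set.mem_singleton_iff]
    tauto

theorem planesMeeting_equation
    (hK : IsType3 F 3 K 1 (Fintype.card F + 2) (2 * Fintype.card F + 1))
    {L : Submodule F (Fin 4 → F)} (hL : finrank F L = 2) :
    (planesMeeting K L (Fintype.card F + 2)).card * (Fintype.card F + 1) +
      (planesMeeting K L (2 * Fintype.card F + 1)).card * (2 * Fintype.card F) +
      (Fintype.card F + 1) =
      K.ncard + Fintype.card F * (K ∩ projSet F 3 L).ncard := by
  have hq : 1 < Fintype.card F := Fintype.one_lt_card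
  have hsum := sum_ncard_planesThrough K hL
  have hterm : ∀ W ∈ planesThrough L, (K ∩ projSet F 3 W).ncard =
      (if (K ∩ projSet F 3 W).ncard = Fintype.card F + 2 then Fintype.card F + 1 else 0) +
      (if (K ∩ projSet F 3 W).ncard = 2 * Fintype.card F + 1 then 2 * Fintype.card F else 0) +
      1 := by
    intro W hW
    have := hK.1 W (mem_planesThrough.1 hW).1
    split_ifs <;> omega
  rw [Finset.sum_congr rfl hterm, Finset.sum_add_distrib, Finset.sum_add_distrib,
    ← Finset.sum_filter, ← Finset.sum_filter, Finset.sum_const, Finset.sum_const,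
    Finset.sum_const, card_planesThrough hL] at hsum
  simp only [smul_eq_mul] at hsum
  unfold planesMeeting
  linarith

theorem mem_planesMeeting_of_card_eq {L W W₀ : Submodule F (Fin 4 → F)} {m : ℕ}
    (hL : finrank F L = 2) (hcard : (planesMeeting K L m).card = Fintype.card F)
    (hW₀ : W₀ ∈ planesThrough L) (hW₀m : W₀ ∉ planesMeeting K L m)
    (hW : W ∈ planesThrough L) (hne : W ≠ W₀) : W ∈ planesMeeting K L m := by
  classical
  have : planesMeeting K L m = (planesThrough L).erase W₀ := by
    refine Finset.eq_of_subset_of_card_le (fun V hV ↦ Finset.mem_erase.2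
      ⟨fun h ↦ hW₀m (h ▸ hV), planesMeeting_subset K L m hV⟩) ?_
    rw [Finset.card_erase_of_mem hW₀, card_planesThrough hL, hcard]
    simp
  rw [this]
  exact Finset.mem_erase.2 ⟨hne, hW⟩

theorem eq_zero_and_eq_or_of_pencil_equations {q a₀ a₁ b₀ b₁ : ℕ} (h₀ : a₀ ≤ q)
    (h₁ : a₁ ≤ q)
    (h : a₀ * (q + 1) + b₀ * (2 * q) + q = a₁ * (q + 1) + b₁ * (2 * q)) (hq : 1 < q) :
    (a₀ = q ∧ a₁ = 0) ∨ (a₀ = 0 ∧ a₁ = q) := by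
  zify at h h₀ h₁ hq
  obtain ⟨c, hc⟩ : ∃ c : ℤ, c = a₁ - a₀ + 2 * b₁ - 2 * b₀ - 1 := ⟨_, rfl⟩
  have hdiff : (a₀ : ℤ) - a₁ = q * c := by
    rw [hc]
    linarith
  have hc1 : c ≤ 1 := by nlinarith
  have hc2 : -1 ≤ c := by nlinarith
  obtain rfl | rfl | rfl : c = -1 ∨ c = 0 ∨ c = 1 := by omega
  all_goals omega

/-- If `K` meets the plane `π` only in `P`, then the lines of `π` through `P` lie on no
plane with `q + 2` points and the other lines of `π` lie on exactly `q` of them, or vice versa. -/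
theorem card_planesMeeting_tangent
    (hK : IsType3 F 3 K 1 (Fintype.card F + 2) (2 * Fintype.card F + 1))
    {π : Submodule F (Fin 4 → F)} (hπ : finrank F π = 3) {P : PGPoint F 3}
    (hP : K ∩ projSet F 3 π = {P}) {L₀ L₁ : Submodule F (Fin 4 → F)}
    (hL₀ : finrank F L₀ = 2) (hL₁ : finrank F L₁ = 2) (hL₀π : L₀ ≤ π) (hL₁π : L₁ ≤ π)
    (hPL₀ : ¬ P.submodule ≤ L₀) (hPL₁ : P.submodule ≤ L₁) :
    ((planesMeeting K L₀ (Fintype.card F + 2)).card = Fintype.card F ∧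
      (planesMeeting K L₁ (Fintype.card F + 2)).card = 0 ∧
      K.ncard = Fintype.card F ^ 2 + 2 * Fintype.card F + 1) ∨
    ((planesMeeting K L₀ (Fintype.card F + 2)).card = 0 ∧
      (planesMeeting K L₁ (Fintype.card F + 2)).card = Fintype.card F ∧
      Fintype.card F ∣ K.ncard - 1 ∧ 0 < K.ncard) := by
  have hs₀ : (K ∩ projSet F 3 L₀).ncard = 0 := by
    rw [Set.ncard_eq_zero (Set.toFinite _), Set.eq_empty_iff_forall_notMem]
    rintro x ⟨hxK, hxL⟩
    have hx : x ∈ K ∩ projSet F 3 π := ⟨hxK, projSet_mono hL₀π hxL⟩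
    rw [hP, Set.mem_singleton_iff] at hx
    exact hPL₀ (hx ▸ hxL)
  have hPmem : P ∈ K ∩ projSet F 3 π := by simp [hP]
  have hs₁ : (K ∩ projSet F 3 L₁).ncard = 1 := by
    rw [Set.ncard_eq_one]
    refine ⟨P, Set.Subset.antisymm ?_ ?_⟩
    · rw [← hP]
      exact Set.inter_subset_inter_right K (projSet_mono hL₁π)
    · rw [Set.singleton_subset_iff]
      exact ⟨hPmem.1, hPL₁⟩
  have hpos : ∀ L ≤ π, 0 < (planesMeeting K L 1).card := fun L hL ↦
    Finset.card_pos.2 ⟨π, mem_planesMeeting.2 ⟨⟨hπ, hL⟩, by rw [hP, Set.ncard_singleton]⟩⟩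
  have hpos₀ := hpos L₀ hL₀π
  have hpos₁ := hpos L₁ hL₁π
  have hadd₀ := card_planesMeeting_add hK hL₀
  have hadd₁ := card_planesMeeting_add hK hL₁
  have heq₀ := planesMeeting_equation hK hL₀
  have heq₁ := planesMeeting_equation hK hL₁
  rw [hs₀] at heq₀
  rw [hs₁] at heq₁
  rcases eq_zero_and_eq_or_of_pencil_equations (q := Fintype.card F)
    (a₀ := (planesMeeting K L₀ (Fintype.card F + 2)).card)
    (a₁ := (planesMeeting K L₁ (Fintype.card F + 2)).card)
    (b₀ := (planesMeeting K L₀ (2 * Fintype.card F + 1)).card)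
    (b₁ := (planesMeeting K L₁ (2 * Fintype.card F + 1)).card)
    (by omega) (by omega) (by linarith) Fintype.one_lt_card with ⟨h₀, h₁⟩ | ⟨h₀, h₁⟩
  · refine Or.inl ⟨h₀, h₁, ?_⟩
    have hb : (planesMeeting K L₀ (2 * Fintype.card F + 1)).card = 0 := by omega
    rw [h₀, hb] at heq₀
    linarith
  · refine Or.inr ⟨h₀, h₁, ?_⟩
    rw [h₀] at heq₀
    have hk : K.ncard = Fintype.card F *
        (2 * (planesMeeting K L₀ (2 * Fintype.card F + 1)).card + 1) + 1 := by linarith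
    rw [hk]
    exact ⟨⟨_, Nat.add_sub_cancel _ _⟩, Nat.succ_pos _⟩

end PlaneCharacters

section Vertex

variable {F} [Fintype F] {K : Set (PGPoint F 3)}

/-- If every line of the plane `π` through `P` lies on exactly `q` planes with `q + 2` points and
every other line of `π` lies on none, then some line of the space lies on exactly one of them. -/
theorem exists_card_planesMeeting_eq_one {π : Submodule F (Fin 4 → F)} (hπ : finrank F π = 3)
    {P : PGPoint F 3} (hPπ : P.submodule ≤ π)
    (hπm : (K ∩ projSet F 3 π).ncard ≠ Fintype.card F + 2)
    (hthrough : ∀ L ≤ π, finrank F L = 2 → P.submodule ≤ L →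
      (planesMeeting K L (Fintype.card F + 2)).card = Fintype.card F)
    (hoff : ∀ L ≤ π, finrank F L = 2 → ¬ P.submodule ≤ L →
      (planesMeeting K L (Fintype.card F + 2)).card = 0) :
    ∃ L : Submodule F (Fin 4 → F), finrank F L = 2 ∧
      (planesMeeting K L (Fintype.card F + 2)).card = 1 := by
  obtain ⟨μ, hμ, hPμ⟩ := exists_plane_not_through P
  have hμπ : μ ≠ π := fun h ↦ hPμ (h ▸ hPπ)
  obtain ⟨R, hRμ, hRπ⟩ := exists_point_of_not_le (n := 3)
    fun h ↦ hμπ (Submodule.eq_of_le_of_finrank_eq h (hμ.trans hπ.symm))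
  obtain ⟨S, hSμ, -⟩ := exists_point_of_finrank_lt (n := 3) (W := ⊥) (U := μ ⊓ π)
    (by simp [finrank_inf_planes hμ hπ hμπ])
  rw [le_inf_iff] at hSμ
  have hRS : R ≠ S := fun h ↦ hRπ (h ▸ hSμ.2)
  have hL := finrank_sup_two_points hRS
  have hPL : ¬ P.submodule ≤ R.submodule ⊔ S.submodule :=
    fun h ↦ hPμ (h.trans (sup_le hRμ hSμ.1))
  refine ⟨R.submodule ⊔ S.submodule, hL, Finset.card_eq_one.2
    ⟨R.submodule ⊔ S.submodule ⊔ P.submodule, ?_⟩⟩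
  ext W
  rw [Finset.mem_singleton]
  constructor
  · intro hW
    have hWL := planesMeeting_subset _ _ _ hW
    obtain ⟨⟨hW3, hLW⟩, hWm⟩ := mem_planesMeeting.1 hW
    have hWπ : W ≠ π := fun h ↦ hπm (h ▸ hWm)
    by_cases hPW : P.submodule ≤ W
    · exact (sup_point_eq_plane hL hWL hPL hPW).symm
    · have h := hoff (W ⊓ π) inf_le_right (finrank_inf_planes hW3 hπ hWπ)
        fun h ↦ hPW (h.trans inf_le_left)
      rw [Finset.card_eq_zero, Finset.eq_empty_iff_forall_notMem] at h
      exact (h W (mem_planesMeeting.2 ⟨⟨hW3, inf_le_left⟩, hWm⟩)).elim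
  · intro hW
    have hWL := sup_point_mem_planesThrough hL hPL
    rw [← hW] at hWL
    have hRW : R.submodule ≤ W := hW ▸ le_sup_left.trans le_sup_left
    have hPW : P.submodule ≤ W := hW ▸ le_sup_right
    obtain ⟨hW3, hLW⟩ := mem_planesThrough.1 hWL
    have hWπ : W ≠ π := fun h ↦ hRπ (h ▸ hRW)
    have hM := finrank_inf_planes hW3 hπ hWπ
    have h := mem_planesMeeting_of_card_eq hM
      (hthrough (W ⊓ π) inf_le_right hM (le_inf hPW hPπ))
      (mem_planesThrough.2 ⟨hπ, inf_le_right⟩)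
      (fun h ↦ hπm (mem_planesMeeting.1 h).2) (mem_planesThrough.2 ⟨hW3, inf_le_left⟩) hWπ
    exact mem_planesMeeting.2 ⟨⟨hW3, hLW⟩, (mem_planesMeeting.1 h).2⟩

/-- A set of type `(1, q+2, 2q+1)_2` has `(q+1)²` points, one of which is such that the planes
avoiding it are precisely the planes with `q + 2` points. -/
theorem exists_vertex_s10
    (hK : IsType3 F 3 K 1 (Fintype.card F + 2) (2 * Fintype.card F + 1)) :
    ∃ P ∈ K, K.ncard = Fintype.card F ^ 2 + 2 * Fintype.card F + 1 ∧
      ∀ W : Submodule F (Fin 4 → F), finrank F W = 3 →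
        ((K ∩ projSet F 3 W).ncard = Fintype.card F + 2 ↔ ¬ P.submodule ≤ W) := by
  have hq : 1 < Fintype.card F := Fintype.one_lt_card
  obtain ⟨π, hπ, hπ1⟩ := hK.2.1
  obtain ⟨P, hP⟩ := Set.ncard_eq_one.1 hπ1
  have hPmem : P ∈ K ∩ projSet F 3 π := by simp [hP]
  have hPπ : P.submodule ≤ π := hPmem.2
  have hπm : (K ∩ projSet F 3 π).ncard ≠ Fintype.card F + 2 := by omega
  obtain ⟨μ, hμ, hPμ⟩ := exists_plane_not_through P
  have hL₀ := finrank_inf_planes hμ hπ fun h ↦ hPμ (h ▸ hPπ)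
  have hPL₀ : ¬ P.submodule ≤ μ ⊓ π := fun h ↦ hPμ (h.trans inf_le_left)
  obtain ⟨Q, hQπ, hQP⟩ := exists_point_of_finrank_lt (n := 3) (W := P.submodule) (U := π)
    (by rw [P.finrank_submodule, hπ]; norm_num)
  have hL₁ := finrank_sup_two_points (x := P) (y := Q) fun h ↦ hQP (h ▸ le_rfl)
  have hL₁π : P.submodule ⊔ Q.submodule ≤ π := sup_le hPπ hQπ
  have hmain := fun {L₀ L₁} ↦ card_planesMeeting_tangent hK hπ hP (L₀ := L₀) (L₁ := L₁)
  rcases hmain hL₀ hL₁ inf_le_right hL₁π hPL₀ le_sup_left with ⟨h₀, h₁, hk⟩ | ⟨h₀, h₁, hk, hk0⟩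
  · refine ⟨P, hPmem.1, hk, fun W hW ↦ ?_⟩
    by_cases hWπ : W = π
    · subst hWπ
      exact iff_of_false hπm fun h ↦ h hPπ
    have hM := finrank_inf_planes hW hπ hWπ
    by_cases hPW : P.submodule ≤ W
    · refine iff_of_false (fun hWm ↦ ?_) fun h ↦ h hPW
      have hM0 : (planesMeeting K (W ⊓ π) (Fintype.card F + 2)).card = 0 := by
        rcases hmain hL₀ hM inf_le_right inf_le_right hPL₀ (le_inf hPW hPπ) with h | h <;> omega
      rw [Finset.card_eq_zero, Finset.eq_empty_iff_forall_notMem] at hM0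
      exact hM0 W (mem_planesMeeting.2 ⟨⟨hW, inf_le_left⟩, hWm⟩)
    · refine iff_of_true ?_ hPW
      have hMq : (planesMeeting K (W ⊓ π) (Fintype.card F + 2)).card = Fintype.card F := by
        rcases hmain hM hL₁ inf_le_right hL₁π (fun h ↦ hPW (h.trans inf_le_left)) le_sup_left
          with h | h <;> omega
      exact (mem_planesMeeting.1 (mem_planesMeeting_of_card_eq hM hMq
        (mem_planesThrough.2 ⟨hπ, inf_le_right⟩)
        (fun h ↦ hπm (mem_planesMeeting.1 h).2)
        (mem_planesThrough.2 ⟨hW, inf_le_left⟩) hWπ)).2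
  · exfalso
    obtain ⟨L, hL, hL1⟩ := exists_card_planesMeeting_eq_one hπ hPπ hπm
      (fun L hLπ hL hPL ↦ by
        rcases hmain hL₀ hL inf_le_right hLπ hPL₀ hPL with h | h <;> omega)
      (fun L hLπ hL hPL ↦ by
        rcases hmain hL hL₁ hLπ hL₁π hPL le_sup_left with h | h <;> omega)
    have heq := planesMeeting_equation hK hL
    obtain ⟨c, hc⟩ := hk
    have hk' : K.ncard = Fintype.card F * c + 1 := by omega
    rw [hL1, hk'] at heq
    have h1 : Fintype.card F ∣ 1 := by
      refine (Nat.dvd_add_right (a := Fintype.card F) (b := Fintype.card F *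
        (2 + (planesMeeting K L (2 * Fintype.card F + 1)).card * 2)) ⟨_, rfl⟩).1
        ⟨c + (K ∩ projSet F 3 L).ncard, ?_⟩
      linarith
    exact hq.ne' (Nat.dvd_one.1 h1)

end Vertex

section Cone

variable {F} [Fintype F] {K : Set (PGPoint F 3)}

theorem ncard_line_eq_zero_or_two
    (hK : IsType3 F 3 K 1 (Fintype.card F + 2) (2 * Fintype.card F + 1)) {P : PGPoint F 3}
    (hk : K.ncard = Fintype.card F ^ 2 + 2 * Fintype.card F + 1)
    (hP : ∀ W : Submodule F (Fin 4 → F), finrank F W = 3 →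
        ((K ∩ projSet F 3 W).ncard = Fintype.card F + 2 ↔ ¬ P.submodule ≤ W))
    {L : Submodule F (Fin 4 → F)} (hL : finrank F L = 2) (hPL : ¬ P.submodule ≤ L) :
    (K ∩ projSet F 3 L).ncard = 0 ∨ (K ∩ projSet F 3 L).ncard = 2 := by
  classical
  have hmem := sup_point_mem_planesThrough hL hPL
  have hA : planesMeeting K L (Fintype.card F + 2) =
      (planesThrough L).erase (L ⊔ P.submodule) := by
    ext W
    rw [Finset.mem_erase, mem_planesMeeting, ← mem_planesThrough, and_comm]
    refine and_congr_left fun hW ↦ ?_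
    rw [hP W (mem_planesThrough.1 hW).1, not_iff_not]
    exact ⟨fun h ↦ (sup_point_eq_plane hL hW hPL h).symm, fun h ↦ h ▸ le_sup_right⟩
  have hcard : (planesMeeting K L (Fintype.card F + 2)).card = Fintype.card F := by
    rw [hA, Finset.card_erase_of_mem hmem, card_planesThrough hL, Nat.add_sub_cancel]
  have hadd := card_planesMeeting_add hK hL
  have heq := planesMeeting_equation hK hL
  rw [hcard, hk] at heq
  have h2 : (K ∩ projSet F 3 L).ncard =
      2 * (planesMeeting K L (2 * Fintype.card F + 1)).card :=
    Nat.eq_of_mul_eq_mul_left (Fintype.card_pos (α := F)) (by linarith)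
  omega

theorem projSet_sup_subset
    (hK : IsType3 F 3 K 1 (Fintype.card F + 2) (2 * Fintype.card F + 1)) {P : PGPoint F 3}
    (hPK : P ∈ K) (hk : K.ncard = Fintype.card F ^ 2 + 2 * Fintype.card F + 1)
    (hP : ∀ W : Submodule F (Fin 4 → F), finrank F W = 3 →
        ((K ∩ projSet F 3 W).ncard = Fintype.card F + 2 ↔ ¬ P.submodule ≤ W))
    {R : PGPoint F 3} (hRK : R ∈ K) (hPR : P ≠ R) :
    projSet F 3 (P.submodule ⊔ R.submodule) ⊆ K := by
  have hL := finrank_sup_two_points hPR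
  have ha : planesMeeting K (P.submodule ⊔ R.submodule) (Fintype.card F + 2) = ∅ := by
    refine Finset.eq_empty_iff_forall_notMem.2 fun W hW ↦ ?_
    obtain ⟨⟨hW3, hLW⟩, hWm⟩ := mem_planesMeeting.1 hW
    exact (hP W hW3).1 hWm (le_sup_left.trans hLW)
  have he : planesMeeting K (P.submodule ⊔ R.submodule) 1 = ∅ := by
    refine Finset.eq_empty_iff_forall_notMem.2 fun W hW ↦ hPR ?_
    obtain ⟨⟨hW3, hLW⟩, hWm⟩ := mem_planesMeeting.1 hW
    exact (Set.ncard_le_one (Set.toFinite _)).1 hWm.le P ⟨hPK, le_sup_left.trans hLW⟩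
      R ⟨hRK, le_sup_right.trans hLW⟩
  have hadd := card_planesMeeting_add hK hL
  have heq := planesMeeting_equation hK hL
  rw [ha, he, Finset.card_empty, zero_add, add_zero] at hadd
  rw [ha, hadd, Finset.card_empty, hk] at heq
  have hs : (K ∩ projSet F 3 (P.submodule ⊔ R.submodule)).ncard = Fintype.card F + 1 :=
    Nat.eq_of_mul_eq_mul_left (Fintype.card_pos (α := F)) (by linarith)
  rw [← Set.inter_eq_right]
  refine Set.eq_of_subset_of_ncard_le Set.inter_subset_right ?_ (Set.toFinite _)
  rw [hs, ncard_projSet (n := 3) hL]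
  simp [Finset.sum_range_succ, add_comm]

end Cone

/-- In `PG(3,q)`, every point set of type `(1, q+2, 2q+1)_2` is a cone
over a hyperoval: there are a point `P ∈ K` and a plane `μ` not containing `P` such
that `K ∩ μ` is a hyperoval of `μ` and `K` is the union of all points on lines
joining `P` to points of `K ∩ μ`. -/
theorem statement10 [Fintype F] (q : ℕ) (hq : Fintype.card F = q)
    (K : Set (PGPoint F 3)) (hK : IsType3 F 3 K 1 (q + 2) (2 * q + 1)) :
    ∃ P ∈ K, ∃ Wμ : Submodule F (Fin 4 → F),
      finrank F Wμ = 3 ∧ ¬ P.submodule ≤ Wμ ∧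
      IsHyperoval F 3 q Wμ (K ∩ projSet F 3 Wμ) ∧
      K = ⋃ y ∈ K ∩ projSet F 3 Wμ, projSet F 3 (P.submodule ⊔ y.submodule) := by
  subst hq
  obtain ⟨P, hPK, hk, hP⟩ := exists_vertex_s10 hK
  obtain ⟨μ, hμ, hPμ⟩ := exists_plane_not_through P
  have hμm := (hP μ hμ).2 hPμ
  refine ⟨P, hPK, μ, hμ, hPμ, ⟨Set.inter_subset_right, hμm, fun L hLμ hL ↦ ?_⟩, ?_⟩
  · rw [Set.inter_assoc, Set.inter_eq_right.2 (projSet_mono hLμ)]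
    exact ncard_line_eq_zero_or_two hK hk hP hL fun h ↦ hPμ (h.trans hLμ)
  ext x
  simp only [Set.mem_iUnion, exists_prop]
  constructor
  · intro hx
    by_cases hPx : P = x
    · obtain ⟨y, hy⟩ := Set.nonempty_of_ncard_ne_zero (hμm.trans_ne (Nat.succ_ne_zero _))
      exact ⟨y, hy, hPx ▸ (le_sup_left : P.submodule ≤ P.submodule ⊔ y.submodule)⟩
    · have hL : finrank F ↥(P.submodule ⊔ x.submodule : Submodule F (Fin 4 → F)) = 2 :=
        finrank_sup_two_points hPx
      have hdim := Submodule.finrank_sup_add_finrank_inf_eq μ (P.submodule ⊔ x.submodule)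
      have hle : finrank F ↥(μ ⊔ (P.submodule ⊔ x.submodule)) ≤ 4 := by
        simpa using Submodule.finrank_le (μ ⊔ (P.submodule ⊔ x.submodule))
      have hpos : 0 < finrank F ↥(μ ⊓ (P.submodule ⊔ x.submodule)) := by omega
      obtain ⟨y, hy, -⟩ := exists_point_of_finrank_lt (n := 3) (W := ⊥)
        (U := μ ⊓ (P.submodule ⊔ x.submodule)) (by rwa [finrank_bot])
      rw [le_inf_iff] at hy
      refine ⟨y, ⟨projSet_sup_subset hK hPK hk hP hx hPx hy.2, hy.1⟩, ?_⟩
      have hPy : P ≠ y := fun h ↦ hPμ (h ▸ hy.1)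
      have hline : P.submodule ⊔ y.submodule = P.submodule ⊔ x.submodule :=
        Submodule.eq_of_le_of_finrank_eq (sup_le le_sup_left hy.2)
          ((finrank_sup_two_points hPy).trans hL.symm)
      rw [hline]
      exact (le_sup_right : x.submodule ≤ P.submodule ⊔ x.submodule)
  · rintro ⟨y, ⟨hyK, hyμ⟩, hx⟩
    exact projSet_sup_subset hK hPK hk hP hyK (fun h ↦ hPμ (h ▸ hyμ)) hx
end
end
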